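/- Let p, q, σ₁, σ₂ ∈ (0,∞], α₁, α₂ ∈ ℝ, α₃ ≥ 0, {t_k} ∈ 𝒳^{α₃}_{α,σ,p} with σ₂ ≥ p (α = (α₁,α₂), σ = (σ₁,σ₂)). Let G be a special Lipschitz domain with constant M ≥ 1, φ₀ ∈ D(−K) with ∫φ₀ = 1, φ := φ₀ − 2^{−n}φ₀(·/2), and L_φ + 1 > α₂. Then for all f ∈ S'_e(G): ‖f | B^{φ₀}_{p,q}(G,{t_k})‖ is equivalent to (Σ_{j=0}^{∞} (∫_G t_j^p(x) |φ_j ∗ f(x)|^p dx)^{q/p})^{1/q} (sup-modifications for p = ∞ or q = ∞), with equivalence constants independent of f; in particular f is the restriction to G of an element of B^{φ₀}_{p,q}({t_k}) if and only if the right-hand side is finite. -/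

import Mathlib

open MeasureTheory ENNReal Filter Topology

noncomputable section

def lqNorm (q : ℝ≥0∞) (a : ℕ → ℝ≥0∞) : ℝ≥0∞ :=
  if q = ∞ then ⨆ k, a k else (∑' k, a k ^ q.toReal) ^ (1 / q.toReal)

def lpSum {ι : Type*} (p : ℝ≥0∞) (a : ι → ℝ≥0∞) : ℝ≥0∞ :=
  if p = ∞ then ⨆ m, a m else (∑' m, a m ^ p.toReal) ^ (1 / p.toReal)

def dyadicCube (n k : ℕ) (m : Fin n → ℤ) : Set (Fin n → ℝ) :=
  {x | ∀ i, (m i : ℝ) / 2 ^ k ≤ x i ∧ x i ≤ ((m i : ℝ) + 1) / 2 ^ k}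

def dilatedCube (n : ℕ) (c : ℝ) (k : ℕ) (m : Fin n → ℤ) : Set (Fin n → ℝ) :=
  {x | ∀ i, |x i - ((m i : ℝ) + 1 / 2) / 2 ^ k| ≤ c / (2 * 2 ^ k)}

def tkm (n : ℕ) (p : ℝ≥0∞) (t : ℕ → (Fin n → ℝ) → ℝ) (k : ℕ) (m : Fin n → ℤ) : ℝ≥0∞ :=
  eLpNorm (t k) p (volume.restrict (dyadicCube n k m))

def PAdmissible (n : ℕ) (p : ℝ≥0∞) (t : ℕ → (Fin n → ℝ) → ℝ) : Prop :=
  (∀ k, Measurable (t k)) ∧ (∀ k, ∀ᵐ x : Fin n → ℝ, 0 < t k x) ∧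
    ∀ k m, tkm n p t k m < ∞

def MemX (n : ℕ) (p σ₁ σ₂ : ℝ≥0∞) (α₁ α₂ α₃ : ℝ) (t : ℕ → (Fin n → ℝ) → ℝ) : Prop :=
  PAdmissible n p t ∧
  (∃ C₁ : ℝ, 0 < C₁ ∧ ∀ k j : ℕ, k ≤ j → ∀ m : Fin n → ℤ,
    (((2 : ℝ≥0∞) ^ (k * n)) ^ p⁻¹.toReal * tkm n p t k m) *
      (((2 : ℝ≥0∞) ^ (k * n)) ^ σ₁⁻¹.toReal *
        eLpNorm (fun x => (t j x)⁻¹) σ₁ (volume.restrict (dyadicCube n k m)))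
      ≤ ENNReal.ofReal (C₁ * 2 ^ (α₁ * ((k : ℝ) - (j : ℝ))))) ∧
  (∃ C₂ : ℝ, 0 < C₂ ∧ ∀ k j : ℕ, k ≤ j → ∀ m : Fin n → ℤ,
    ((2 : ℝ≥0∞) ^ (k * n)) ^ σ₂⁻¹.toReal *
        eLpNorm (t j) σ₂ (volume.restrict (dyadicCube n k m))
      ≤ ENNReal.ofReal (C₂ * 2 ^ (α₂ * ((j : ℝ) - (k : ℝ)))) *
        (((2 : ℝ≥0∞) ^ (k * n)) ^ p⁻¹.toReal * tkm n p t k m)) ∧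
  (∀ k m, 0 < tkm n p t k m) ∧
  (∀ (k : ℕ) (m m' : Fin n → ℤ), (∀ i, |m i - m' i| ≤ 1) →
    tkm n p t k m ≤ ENNReal.ofReal (2 ^ α₃) * tkm n p t k m')

def tbar (n : ℕ) (p : ℝ≥0∞) (t : ℕ → (Fin n → ℝ) → ℝ) (k : ℕ) (x : Fin n → ℝ) : ℝ :=
  (2 : ℝ) ^ (((k * n : ℕ) : ℝ) / p.toReal) * (tkm n p t k fun i => ⌊x i * 2 ^ k⌋).toReal

abbrev Dstrb (n : ℕ) := ((Fin n → ℝ) → ℝ) →ₗ[ℝ] ℝ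

def distConv (n : ℕ) (f : Dstrb n) (φ : (Fin n → ℝ) → ℝ) (x : Fin n → ℝ) : ℝ :=
  f fun y => φ (x - y)

def IsTestFun (n : ℕ) (g : (Fin n → ℝ) → ℝ) : Prop :=
  ContDiff ℝ (⊤ : ℕ∞) g ∧ HasCompactSupport g

def phiOf (n : ℕ) (φ₀ : (Fin n → ℝ) → ℝ) (x : Fin n → ℝ) : ℝ :=
  φ₀ x - (2 : ℝ)⁻¹ ^ n * φ₀ ((2 : ℝ)⁻¹ • x)

def phiFam (n : ℕ) (φ₀ : (Fin n → ℝ) → ℝ) : ℕ → (Fin n → ℝ) → ℝ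
  | 0 => φ₀
  | k + 1 => fun x => (2 : ℝ) ^ ((k + 1) * n) * phiOf n φ₀ ((2 : ℝ) ^ (k + 1) • x)

def kernFam (n : ℕ) (ψ₀ ψ : (Fin n → ℝ) → ℝ) : ℕ → (Fin n → ℝ) → ℝ
  | 0 => ψ₀
  | k + 1 => fun x => (2 : ℝ) ^ ((k + 1) * n) * ψ ((2 : ℝ) ^ (k + 1) • x)

def besovNorm (n : ℕ) (p q : ℝ≥0∞) (t : ℕ → (Fin n → ℝ) → ℝ)
    (φ₀ : (Fin n → ℝ) → ℝ) (f : Dstrb n) : ℝ≥0∞ :=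
  lqNorm q fun k =>
    eLpNorm (fun x => t k x * distConv n f (phiFam n φ₀ k) x) p volume

def seSeminorm (n : ℕ) (N : ℕ) (g : (Fin n → ℝ) → ℝ) : ℝ≥0∞ :=
  ⨆ x : Fin n → ℝ, ENNReal.ofReal
    (Real.exp (N * ‖x‖) * ∑ i ∈ Finset.range (N + 1), ‖iteratedFDeriv ℝ i g x‖)

def MemSe' (n : ℕ) (f : Dstrb n) : Prop :=
  ∃ (C : ℝ) (N : ℕ), 0 < C ∧ ∀ g : (Fin n → ℝ) → ℝ, ContDiff ℝ (⊤ : ℕ∞) g →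
    ENNReal.ofReal |f g| ≤ ENNReal.ofReal C * seSeminorm n N g

def MomentsVanish (n : ℕ) (L : ℤ) (ψ : (Fin n → ℝ) → ℝ) : Prop :=
  ∀ β : Fin n → ℕ, ((∑ i, β i : ℕ) : ℤ) ≤ L → (∫ x, (∏ i, x i ^ β i) * ψ x) = 0

def sqNorm (d : ℕ) (y : Fin d → ℝ) : ℝ := Real.sqrt (∑ i, y i ^ 2)

def lowerPart (d : ℕ) (x : Fin (d + 1) → ℝ) : Fin d → ℝ := fun i => x i.castSucc

def IsLipFun (d : ℕ) (M : ℝ) (ϖ : (Fin d → ℝ) → ℝ) : Prop :=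
  ∀ y z, |ϖ y - ϖ z| ≤ M * sqNorm d (fun i => y i - z i)

def specialLip (d : ℕ) (ϖ : (Fin d → ℝ) → ℝ) : Set (Fin (d + 1) → ℝ) :=
  {x | ϖ (lowerPart d x) < x (Fin.last d)}

def negConeK (d : ℕ) (M : ℝ) : Set (Fin (d + 1) → ℝ) :=
  {x | M * sqNorm d (lowerPart d x) < -x (Fin.last d)}

def maxFunG (d : ℕ) (G : Set (Fin (d+1) → ℝ)) (φ₀ : (Fin (d+1) → ℝ) → ℝ) (A : ℝ)
    (m : Fin (d+1) → ℤ) (j : ℕ) (c : ℝ) (f : Dstrb (d+1)) : ℝ≥0∞ :=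
  ⨆ (k : ℕ) (_ : j ≤ k), ⨆ y ∈ dilatedCube (d+1) c j m ∩ G,
    ENNReal.ofReal ((2 : ℝ) ^ (A * ((j : ℝ) - (k : ℝ))) *
      |distConv (d+1) f (phiFam (d+1) φ₀ k) y|)

def MemSeG (n : ℕ) (G : Set (Fin n → ℝ)) (f : Dstrb n) : Prop :=
  ∃ (C : ℝ) (N : ℕ), 0 < C ∧ ∀ θ, IsTestFun n θ → tsupport θ ⊆ G →
    ENNReal.ofReal |f θ| ≤ ENNReal.ofReal C *
      ⨆ x ∈ G, ENNReal.ofReal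
        (Real.exp (N * ‖x‖) * ∑ i ∈ Finset.range (N + 1), ‖iteratedFDeriv ℝ i θ x‖)

def MemD' (n : ℕ) (U : Set (Fin n → ℝ)) (f : Dstrb n) : Prop :=
  ∀ K : Set (Fin n → ℝ), IsCompact K → K ⊆ U →
    ∃ (C : ℝ) (N : ℕ), 0 < C ∧ ∀ θ, IsTestFun n θ → tsupport θ ⊆ K →
      ENNReal.ofReal |f θ| ≤ ENNReal.ofReal C *
        ⨆ x, ENNReal.ofReal (∑ i ∈ Finset.range (N + 1), ‖iteratedFDeriv ℝ i θ x‖)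

/-- Quotient (trace) quasi-norm of `B^{φ₀}_{p,q}(G,{t_k})`. -/
def besovTraceNorm (n : ℕ) (p q : ℝ≥0∞) (t : ℕ → (Fin n → ℝ) → ℝ)
    (φ₀ : (Fin n → ℝ) → ℝ) (G : Set (Fin n → ℝ)) (f : Dstrb n) : ℝ≥0∞ :=
  ⨅ g : {g : Dstrb n // MemSe' n g ∧
      ∀ θ : (Fin n → ℝ) → ℝ, IsTestFun n θ → tsupport θ ⊆ G → g θ = f θ},
    besovNorm n p q t φ₀ g.1

/-! ### Part 1: averaging operators on smooth functions -/

section avg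
variable {n : ℕ} {F : Type*} [NormedAddCommGroup F] [NormedSpace ℝ F]

theorem avg_integrable {g : (Fin n → ℝ) → ℝ} (hg : Continuous g) (hgc : HasCompactSupport g)
    {H : (Fin n → ℝ) → F} (hH : Continuous H) (u : Fin n → ℝ) :
    Integrable (fun z => g z • H (u + z)) := by
  apply Continuous.integrable_of_hasCompactSupport
  · fun_prop
  · exact hgc.smul_right

theorem avg_hasFDerivAt {g : (Fin n → ℝ) → ℝ} (hg : Continuous g) (hgc : HasCompactSupport g)
    {H : (Fin n → ℝ) → F} (hH : ContDiff ℝ 1 H) (u : Fin n → ℝ) :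
    HasFDerivAt (fun u => ∫ z, g z • H (u + z)) (∫ z, g z • fderiv ℝ H (u + z)) u := by
  have hHc : Continuous H := hH.continuous
  have hDc : Continuous (fderiv ℝ H) := hH.continuous_fderiv (by norm_num)
  have hcomp : IsCompact (Set.image (fun p : (Fin n → ℝ) × (Fin n → ℝ) => p.1 + p.2)
      (Metric.closedBall u 1 ×ˢ tsupport g)) :=
    ((isCompact_closedBall u 1).prod hgc).image (by fun_prop)
  obtain ⟨C, hC⟩ := hcomp.exists_bound_of_continuousOn (f := fderiv ℝ H) hDc.continuousOn
  apply hasFDerivAt_integral_of_dominated_of_fderiv_le (s := Metric.ball u 1)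
    (F' := fun u z => g z • fderiv ℝ H (u + z)) (bound := fun z => ‖g z‖ * C)
    (Metric.ball_mem_nhds u one_pos)
  · exact Eventually.of_forall fun x => (avg_integrable hg hgc hHc x).aestronglyMeasurable
  · exact avg_integrable hg hgc hHc u
  · exact (avg_integrable hg hgc hDc u).aestronglyMeasurable
  · refine Eventually.of_forall fun z x hx => ?_
    rw [norm_smul]
    by_cases hz : z ∈ tsupport g
    · gcongr
      exact hC _ ⟨(x, z), ⟨Metric.ball_subset_closedBall hx, hz⟩, rfl⟩
    · rw [image_eq_zero_of_notMem_tsupport hz]; simp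
  · exact (hg.integrable_of_hasCompactSupport hgc).norm.mul_const C
  · refine Eventually.of_forall fun z x hx => ?_
    have h1 : HasFDerivAt H (fderiv ℝ H (x + z)) (x + z) :=
      (hH.differentiable (by norm_num) _).hasFDerivAt
    have h2 : HasFDerivAt (fun x => H (x + z)) (fderiv ℝ H (x + z)) x := by
      have h3 : HasFDerivAt (fun x : Fin n → ℝ => x + z) (ContinuousLinearMap.id ℝ _) x :=
        (hasFDerivAt_id x).add_const z
      have h4 := HasFDerivAt.comp x h1 h3
      rw [ContinuousLinearMap.comp_id] at h4
      exact h4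
    exact h2.const_smul (g z)

/-- The averaging operator. -/
def avg (g θ : (Fin n → ℝ) → ℝ) (u : Fin n → ℝ) : ℝ := ∫ z, g z * θ (u + z)

theorem avg_iteratedFDeriv {g θ : (Fin n → ℝ) → ℝ} (hg : Continuous g) (hgc : HasCompactSupport g)
    (hθ : ContDiff ℝ (⊤ : ℕ∞) θ) (j : ℕ) :
    iteratedFDeriv ℝ j (avg g θ) = fun u => ∫ z, g z • iteratedFDeriv ℝ j θ (u + z) := by
  induction j with
  | zero =>
    funext u
    ext v
    rw [ContinuousMultilinearMap.integral_apply]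
    · simp [avg]
    · exact avg_integrable hg hgc (hθ.continuous_iteratedFDeriv (by exact_mod_cast le_top)) u
  | succ j ih =>
    funext u
    have hD : ContDiff ℝ 1 (iteratedFDeriv ℝ j θ) :=
      hθ.iteratedFDeriv_right (m := 1) (by exact_mod_cast le_top)
    rw [iteratedFDeriv_succ_eq_comp_left, ih, Function.comp_apply,
      (avg_hasFDerivAt hg hgc hD u).fderiv]
    rw [iteratedFDeriv_succ_eq_comp_left]
    simp only [Function.comp_apply]
    have hL := ContinuousLinearMap.integral_comp_comm
      ((continuousMultilinearCurryLeftEquiv ℝ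
        (fun _ : Fin (j + 1) => (Fin n → ℝ))
        ℝ).symm.toContinuousLinearEquiv.toContinuousLinearMap)
      (avg_integrable hg hgc (hD.continuous_fderiv (by norm_num)) u)
    refine hL.symm.trans ?_
    congr 1

theorem avg_contDiff {g θ : (Fin n → ℝ) → ℝ} (hg : Continuous g) (hgc : HasCompactSupport g)
    (hθ : ContDiff ℝ (⊤ : ℕ∞) θ) : ContDiff ℝ (⊤ : ℕ∞) (avg g θ) := by
  apply contDiff_of_differentiable_iteratedFDeriv
  intro m _
  rw [avg_iteratedFDeriv hg hgc hθ]
  have hD : ContDiff ℝ 1 (iteratedFDeriv ℝ m θ) :=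
      hθ.iteratedFDeriv_right (m := 1) (by exact_mod_cast le_top)
  exact fun u => (avg_hasFDerivAt hg hgc hD u).differentiableAt

theorem avg_comm {g h θ : (Fin n → ℝ) → ℝ} (hg : Continuous g) (hgc : HasCompactSupport g)
    (hh : Continuous h) (hhc : HasCompactSupport h) (hθ : Continuous θ) :
    avg g (avg h θ) = avg h (avg g θ) := by
  funext u
  simp only [avg, ← integral_const_mul]
  rw [integral_integral_swap_of_hasCompactSupport]
  · congr 1; funext z; congr 1; funext w; rw [show u + w + z = u + z + w by abel]; ring
  · fun_prop
  · apply HasCompactSupport.intro (hgc.prod hhc)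
    rintro ⟨z, w⟩ hzw
    simp only [Set.mem_prod, not_and_or] at hzw
    rcases hzw with hz | hz
    · simp [Function.uncurry, image_eq_zero_of_notMem_tsupport hz]
    · simp [Function.uncurry, image_eq_zero_of_notMem_tsupport hz]

/-- Symmetry: averaging a reflected kernel. -/
theorem avg_reflect (g h : (Fin n → ℝ) → ℝ) (x : Fin n → ℝ) :
    avg g (fun u => h (x - u)) = avg h (fun u => g (x - u)) := by
  funext u
  simp only [avg]
  rw [← integral_sub_left_eq_self _ volume (x - u)]
  congr 1; funext z
  rw [show x - (u + (x - u - z)) = z by abel, show x - u - z = x - (u + z) by abel]; ring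

theorem avg_flip (g h : (Fin n → ℝ) → ℝ) :
    avg g h = avg (fun z => h (-z)) (fun u => g (-u)) := by
  funext u
  simp only [avg]
  rw [← integral_sub_left_eq_self (fun z => g z * h (u + z)) volume (-u)]
  congr 1; funext z
  rw [show u + (-u - z) = -z by abel, show -u - z = -(u + z) by abel]; ring


end avg

section ops
variable {n : ℕ}

/-- Smooth functions. -/
def Sm (n : ℕ) : Submodule ℝ ((Fin n → ℝ) → ℝ) where
  carrier := {θ | ContDiff ℝ (⊤ : ℕ∞) θ}
  add_mem' := by
    intro a b ha hb
    change ContDiff ℝ (⊤ : ℕ∞) a at ha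
    change ContDiff ℝ (⊤ : ℕ∞) b at hb
    exact ha.add hb
  zero_mem' := by
    change ContDiff ℝ (⊤ : ℕ∞) (fun _ => (0 : ℝ))
    exact contDiff_const
  smul_mem' := by
    intro c x hx
    change ContDiff ℝ (⊤ : ℕ∞) x at hx
    exact contDiff_const.smul hx

theorem Sm_cd (θ : Sm n) : ContDiff ℝ (⊤ : ℕ∞) θ.1 := θ.2

/-- Averaging as an operator on smooth functions. -/
def Aop (g : (Fin n → ℝ) → ℝ) (hg : IsTestFun n g) : Module.End ℝ (Sm n) where
  toFun θ := ⟨avg g θ, avg_contDiff hg.1.continuous hg.2 (Sm_cd θ)⟩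
  map_add' θ η := by
    ext u
    have h1 := avg_integrable hg.1.continuous hg.2 ((Sm_cd θ).continuous) u
    have h2 := avg_integrable hg.1.continuous hg.2 ((Sm_cd η).continuous) u
    simp only [smul_eq_mul] at h1 h2
    simp only [avg, Submodule.coe_add, Pi.add_apply, mul_add]
    exact integral_add h1 h2
  map_smul' c θ := by
    ext u
    simp only [avg, Submodule.coe_smul, Pi.smul_apply, smul_eq_mul, RingHom.id_apply]
    rw [← integral_const_mul]
    congr 1; funext z; ring

theorem Aop_apply (g : (Fin n → ℝ) → ℝ) (hg : IsTestFun n g) (θ : Sm n) :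
    ((Aop g hg θ : Sm n) : (Fin n → ℝ) → ℝ) = avg g θ := rfl

theorem Aop_comm (g h : (Fin n → ℝ) → ℝ) (hg : IsTestFun n g) (hh : IsTestFun n h) :
    Commute (Aop g hg) (Aop h hh) := by
  ext θ : 2
  exact avg_comm hg.1.continuous hg.2 hh.1.continuous hh.2 ((Sm_cd θ).continuous)

/-- Local bound on the derivative of order `j`. -/
def Bd (θ : (Fin n → ℝ) → ℝ) (j : ℕ) (y : Fin n → ℝ) (ρ B : ℝ) : Prop :=
  ∀ z, ‖z - y‖ ≤ ρ → ‖iteratedFDeriv ℝ j θ z‖ ≤ B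

/-- Operator bounds. -/
def OpB (T : Module.End ℝ (Sm n)) (a : ℕ) (δ K : ℝ) : Prop :=
  ∀ (θ : Sm n) (j : ℕ) (y : Fin n → ℝ) (ρ B : ℝ), Bd θ (j + a) y (ρ + δ) B → Bd (T θ) j y ρ (K * B)

theorem OpB.mul {T T' : Module.End ℝ (Sm n)} {a a' : ℕ} {δ δ' K K' : ℝ}
    (h : OpB T a δ K) (h' : OpB T' a' δ' K') : OpB (T * T') (a + a') (δ + δ') (K * K') := by
  intro θ j y ρ B hB
  rw [mul_assoc]
  apply h (T' θ) j y ρ (K' * B)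
  apply h'
  simpa [add_assoc] using hB

theorem OpB.mono {T : Module.End ℝ (Sm n)} {a : ℕ} {δ δ' K K' : ℝ}
    (h : OpB T a δ K) (hδ : δ ≤ δ') (hδ0 : 0 ≤ δ') (hK : K ≤ K') : OpB T a δ' K' := by
  intro θ j y ρ B hB z hz
  have hB0 : 0 ≤ B := (norm_nonneg _).trans (hB z (by linarith))
  have h2 : Bd θ (j + a) y (ρ + δ) B := fun w hw => hB w (by linarith)
  exact (h θ j y ρ B h2 z hz).trans (by gcongr)

theorem OpB.add {T T' : Module.End ℝ (Sm n)} {a : ℕ} {δ K K' : ℝ}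
    (h : OpB T a δ K) (h' : OpB T' a δ K') : OpB (T + T') a δ (K + K') := by
  intro θ j y ρ B hB z hz
  have h1 : ((T + T') θ : Sm n).1 = (T θ).1 + (T' θ).1 := rfl
  rw [h1, iteratedFDeriv_add_apply
    (((Sm_cd (T θ)).of_le (by exact_mod_cast le_top)).contDiffAt)
    (((Sm_cd (T' θ)).of_le (by exact_mod_cast le_top)).contDiffAt), add_mul]
  exact (norm_add_le _ _).trans (add_le_add (h θ j y ρ B hB z hz) (h' θ j y ρ B hB z hz))

theorem OpB.neg {T : Module.End ℝ (Sm n)} {a : ℕ} {δ K : ℝ}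
    (h : OpB T a δ K) : OpB (-T) a δ K := by
  intro θ j y ρ B hB z hz
  have h1 : ((-T) θ : Sm n).1 = - (T θ).1 := rfl
  rw [h1, iteratedFDeriv_neg_apply, norm_neg]
  exact h θ j y ρ B hB z hz

theorem OpB.one {δ : ℝ} (hδ : 0 ≤ δ) : OpB (1 : Module.End ℝ (Sm n)) 0 δ 1 := by
  intro θ j y ρ B hB z hz
  rw [one_mul]
  exact hB z (by linarith)

theorem OpB.zero {a : ℕ} {δ : ℝ} : OpB (0 : Module.End ℝ (Sm n)) a δ 0 := by
  intro θ j y ρ B hB z hz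
  have h1 : ((0 : Module.End ℝ (Sm n)) θ : Sm n).1 = 0 := rfl
  rw [h1]
  simp

theorem OpB.sum {ι : Type*} (s : Finset ι) {T : ι → Module.End ℝ (Sm n)} {a : ℕ} {δ K : ℝ}
    (h : ∀ i ∈ s, OpB (T i) a δ K) : OpB (∑ i ∈ s, T i) a δ (s.card * K) := by
  classical
  induction s using Finset.induction_on with
  | empty => simpa using OpB.zero
  | insert i s hi ih =>
    rw [Finset.sum_insert hi, Finset.card_insert_of_notMem hi]
    have := (h i (by simp)).add (ih fun j hj => h j (by simp [hj]))
    convert this using 1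
    push_cast; ring

theorem OpB.pow {T : Module.End ℝ (Sm n)} {a : ℕ} {δ K : ℝ}
    (h : OpB T a δ K) (m : ℕ) : OpB (T ^ m) (m * a) (m * δ) (K ^ m) := by
  induction m with
  | zero => simpa using OpB.one le_rfl
  | succ m ih =>
    have := ih.mul h
    rw [pow_succ, pow_succ]
    convert this using 1
    · ring
    · push_cast; ring

theorem OpB.aop {g : (Fin n → ℝ) → ℝ} (hg : IsTestFun n g) {c I : ℝ}
    (hc0 : 0 ≤ c)
    (hc : ∀ z, g z ≠ 0 → ‖z‖ ≤ c) (hI : ∫ z, ‖g z‖ ≤ I) : OpB (Aop g hg) 0 c I := by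
  intro θ j y ρ B hB z hz
  rw [Aop_apply, avg_iteratedFDeriv hg.1.continuous hg.2 (Sm_cd θ)]
  have hint : Integrable (fun z => ‖g z‖) :=
    (hg.1.continuous.integrable_of_hasCompactSupport hg.2).norm
  have hB0 : 0 ≤ B := (norm_nonneg _).trans (hB z (by linarith))
  calc ‖∫ w, g w • iteratedFDeriv ℝ j θ.1 (z + w)‖ ≤ ∫ w, ‖g w‖ * B := by
        apply norm_integral_le_of_norm_le (hint.mul_const B)
        refine Eventually.of_forall fun w => ?_
        rw [norm_smul]
        by_cases hw : g w = 0
        · simp [hw]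
        · gcongr
          apply hB
          have := hc w hw
          have h3 := norm_add_le (z - y) w
          rw [show z + w - y = z - y + w by abel]
          linarith
    _ = (∫ w, ‖g w‖) * B := by rw [integral_mul_const]
    _ ≤ I * B := by gcongr

theorem OpB.one_sub_aop {g : (Fin n → ℝ) → ℝ} (hg : IsTestFun n g) {c I : ℝ} (hc0 : 0 ≤ c)
    (hc : ∀ z, g z ≠ 0 → ‖z‖ ≤ c) (hI : ∫ z, ‖g z‖ ≤ I) (h1 : ∫ z, g z = 1) :
    OpB (1 - Aop g hg) 1 c (I * c) := by
  intro θ j y ρ B hB z hz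
  have hθ := (Sm_cd θ)
  have e1 : ((1 - Aop g hg) θ : Sm n).1 = θ.1 + (- avg g θ.1) := by
    rw [← Aop_apply g hg, ← sub_eq_add_neg]; rfl
  have hsm := avg_contDiff hg.1.continuous hg.2 (Sm_cd θ)
  have hsm' : ContDiff ℝ (⊤ : ℕ∞) (-avg g θ.1) := hsm.neg
  rw [e1, iteratedFDeriv_add_apply
    ((hθ.of_le (by exact_mod_cast le_top)).contDiffAt)
    ((hsm'.of_le (by exact_mod_cast le_top)).contDiffAt), iteratedFDeriv_neg_apply,
    avg_iteratedFDeriv hg.1.continuous hg.2 (Sm_cd θ)]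
  have hB0 : 0 ≤ B := (norm_nonneg _).trans (hB z (by linarith))
  have hgi := hg.1.continuous.integrable_of_hasCompactSupport (μ := volume) hg.2
  have hcD : Continuous (iteratedFDeriv ℝ j θ.1) :=
    ContDiff.continuous_iteratedFDeriv (m := j) (by exact_mod_cast le_top) hθ
  have hdD : Differentiable ℝ (iteratedFDeriv ℝ j θ.1) :=
    (ContDiff.iteratedFDeriv_right (m := 1) hθ (by exact_mod_cast le_top)).differentiable
      (by norm_num)
  have e2 : iteratedFDeriv ℝ j θ.1 z + -∫ w, g w • iteratedFDeriv ℝ j θ.1 (z + w)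
      = ∫ w, g w • (iteratedFDeriv ℝ j θ.1 z - iteratedFDeriv ℝ j θ.1 (z + w)) := by
    simp only [smul_sub]
    rw [integral_sub (hgi.smul_const _) (avg_integrable hg.1.continuous hg.2 hcD z),
      integral_smul_const, h1, one_smul, sub_eq_add_neg]
  rw [e2]
  calc ‖∫ w, g w • (iteratedFDeriv ℝ j θ.1 z - iteratedFDeriv ℝ j θ.1 (z + w))‖
      ≤ ∫ w, ‖g w‖ * (B * c) := by
        apply norm_integral_le_of_norm_le (hgi.norm.mul_const _)
        refine Eventually.of_forall fun w => ?_
        rw [norm_smul]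
        by_cases hw : g w = 0
        · simp [hw]
        · have hwc := hc w hw
          gcongr
          have hmv := (convex_closedBall z c).norm_image_sub_le_of_norm_fderiv_le (𝕜 := ℝ)
            (f := iteratedFDeriv ℝ j θ.1) (C := B) (x := z + w) (y := z)
            (fun x _ => hdD x) (by
              intro x hx
              rw [norm_fderiv_iteratedFDeriv]
              apply hB
              rw [Metric.mem_closedBall, dist_eq_norm] at hx
              have := norm_add_le (x - z) (z - y)
              rw [sub_add_sub_cancel] at this
              linarith) (by simpa [Metric.mem_closedBall, dist_eq_norm] using hwc)
              (by simpa using hc0)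
          refine hmv.trans ?_
          gcongr
          simpa using hwc
    _ = (∫ w, ‖g w‖) * (B * c) := by rw [integral_mul_const]
    _ ≤ I * (B * c) := by gcongr
    _ = I * c * B := by ring

end ops

/-! ### Part 2: dyadic kernels and the reproducing operators -/

section kernels
variable {n : ℕ}

/-- Dyadic dilation of the kernel. -/
def Ph (n : ℕ) (φ₀ : (Fin n → ℝ) → ℝ) (k : ℕ) (x : Fin n → ℝ) : ℝ :=
  (2 : ℝ) ^ (k * n) * φ₀ ((2 : ℝ) ^ k • x)

theorem phiFam_zero (φ₀ : (Fin n → ℝ) → ℝ) : phiFam n φ₀ 0 = Ph n φ₀ 0 := by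
  funext x; simp [phiFam, Ph]

theorem phiFam_succ (φ₀ : (Fin n → ℝ) → ℝ) (k : ℕ) :
    phiFam n φ₀ (k + 1) = Ph n φ₀ (k + 1) - Ph n φ₀ k := by
  funext x
  simp only [phiFam, phiOf, Ph, Pi.sub_apply, smul_smul]
  have h1 : (2 : ℝ)⁻¹ * 2 ^ (k + 1) = 2 ^ k := by rw [pow_succ]; field_simp
  have h2 : (2 : ℝ) ^ ((k + 1) * n) * (2 : ℝ)⁻¹ ^ n = 2 ^ (k * n) := by
    rw [add_mul, pow_add, one_mul, mul_assoc, ← mul_pow]; simp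
  rw [h1, mul_sub, ← mul_assoc, h2]

theorem Ph_contDiff {φ₀ : (Fin n → ℝ) → ℝ} (h : ContDiff ℝ (⊤ : ℕ∞) φ₀) (k : ℕ) :
    ContDiff ℝ (⊤ : ℕ∞) (Ph n φ₀ k) := by
  unfold Ph
  exact contDiff_const.mul (h.comp (contDiff_id.const_smul _))

theorem Ph_supp {φ₀ : (Fin n → ℝ) → ℝ} {c : ℝ} (hc : ∀ z, φ₀ z ≠ 0 → ‖z‖ ≤ c) (k : ℕ)
    (z : Fin n → ℝ) (hz : Ph n φ₀ k z ≠ 0) : ‖z‖ ≤ c / 2 ^ k := by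
  have h1 := hc _ (right_ne_zero_of_mul hz)
  rw [norm_smul, norm_pow, Real.norm_ofNat] at h1
  rw [le_div_iff₀ (by positivity)]; linarith

theorem compact_of_bound {g : (Fin n → ℝ) → ℝ} {c : ℝ} (hc : ∀ z, g z ≠ 0 → ‖z‖ ≤ c) :
    HasCompactSupport g := by
  apply HasCompactSupport.intro (isCompact_closedBall (0 : Fin n → ℝ) c)
  intro x hx
  by_contra h
  exact hx (by simpa using hc x h)

theorem exists_supp_bound {g : (Fin n → ℝ) → ℝ} (hg : HasCompactSupport g) :
    ∃ c : ℝ, 0 < c ∧ ∀ z, g z ≠ 0 → ‖z‖ ≤ c := by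
  obtain ⟨c, hc⟩ := hg.isCompact.isBounded.exists_norm_le
  refine ⟨max c 1, by positivity, fun z hz => (hc z (subset_tsupport _ hz)).trans (le_max_left _ _)⟩

theorem Ph_test {φ₀ : (Fin n → ℝ) → ℝ} (h : IsTestFun n φ₀) (k : ℕ) :
    IsTestFun n (Ph n φ₀ k) := by
  obtain ⟨c, _, hc⟩ := exists_supp_bound h.2
  exact ⟨Ph_contDiff h.1 k, compact_of_bound (Ph_supp hc k)⟩

theorem phiFam_test {φ₀ : (Fin n → ℝ) → ℝ} (h : IsTestFun n φ₀) (k : ℕ) :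
    IsTestFun n (phiFam n φ₀ k) := by
  cases k with
  | zero => rw [phiFam_zero]; exact Ph_test h 0
  | succ k =>
    rw [phiFam_succ]
    exact ⟨(Ph_test h (k + 1)).1.sub (Ph_test h k).1, (Ph_test h (k + 1)).2.sub (Ph_test h k).2⟩

theorem integral_scale (φ : (Fin n → ℝ) → ℝ) (k : ℕ) :
    ∫ x, (2 : ℝ) ^ (k * n) * φ ((2 : ℝ) ^ k • x) = ∫ x, φ x := by
  rw [integral_const_mul, Measure.integral_comp_smul]
  simp only [Module.finrank_fintype_fun_eq_card, Fintype.card_fin, smul_eq_mul]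
  rw [← pow_mul, abs_of_pos (by positivity), ← mul_assoc, mul_inv_cancel₀ (by positivity), one_mul]

theorem Ph_integral (φ₀ : (Fin n → ℝ) → ℝ) (k : ℕ) : ∫ x, Ph n φ₀ k x = ∫ x, φ₀ x :=
  integral_scale φ₀ k

theorem Ph_integral_norm (φ₀ : (Fin n → ℝ) → ℝ) (k : ℕ) :
    ∫ x, ‖Ph n φ₀ k x‖ = ∫ x, ‖φ₀ x‖ := by
  rw [← integral_scale (fun x => ‖φ₀ x‖) k]
  congr 1; funext x
  rw [Ph, norm_mul, norm_pow, Real.norm_ofNat]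

theorem norm_iteratedFDeriv_scale {φ : (Fin n → ℝ) → ℝ} (h : ContDiff ℝ (⊤ : ℕ∞) φ) (a v : ℝ)
    (w : Fin n → ℝ) (i : ℕ)
    {B : ℝ} (hB : ∀ z, ‖iteratedFDeriv ℝ i φ z‖ ≤ B) (z : Fin n → ℝ) :
    ‖iteratedFDeriv ℝ i (fun x => v * φ (w + a • x)) z‖ ≤ |v| * (|a| ^ i * B) := by
  have h1 : ContDiff ℝ (⊤ : ℕ∞) (fun x => φ (w + x)) := h.comp (contDiff_const.add contDiff_id)
  have h2 : ContDiff ℝ (⊤ : ℕ∞) (fun x : Fin n → ℝ => φ (w + a • x)) :=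
    h.comp (contDiff_const.add (contDiff_id.const_smul _))
  have e1 : (fun x => v * φ (w + a • x)) = v • (fun x : Fin n → ℝ => φ (w + a • x)) := rfl
  rw [e1, iteratedFDeriv_const_smul_apply ((h2.of_le (by exact_mod_cast le_top)).contDiffAt),
    norm_smul, Real.norm_eq_abs]
  gcongr
  have e2 : (fun x : Fin n → ℝ => φ (w + a • x)) =
    (fun x => φ (w + x)) ∘ (a • ContinuousLinearMap.id ℝ (Fin n → ℝ)) := by funext x; simp
  rw [e2, ContinuousLinearMap.iteratedFDeriv_comp_right _ h1 _ (by exact_mod_cast le_top)]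
  refine (ContinuousMultilinearMap.norm_compContinuousLinearMap_le _ _).trans ?_
  rw [iteratedFDeriv_comp_add_left, mul_comm]
  simp only [Finset.prod_const, Finset.card_univ, Fintype.card_fin]
  gcongr
  · rw [norm_smul, Real.norm_eq_abs]
    have := ContinuousLinearMap.norm_id_le (𝕜 := ℝ) (E := Fin n → ℝ)
    have h0 := abs_nonneg a
    nlinarith
  · exact hB _

theorem exists_deriv_bound {φ : (Fin n → ℝ) → ℝ} (h : IsTestFun n φ) (N : ℕ) :
    ∃ B : ℝ, 0 < B ∧ ∀ i ≤ N, ∀ z, ‖iteratedFDeriv ℝ i φ z‖ ≤ B := by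
  have h1 : ∀ i : ℕ, ∃ B : ℝ, ∀ z, ‖iteratedFDeriv ℝ i φ z‖ ≤ B := by
    intro i
    have hc : HasCompactSupport (iteratedFDeriv ℝ i φ) := h.2.iteratedFDeriv i
    exact hc.exists_bound_of_continuous (h.1.continuous_iteratedFDeriv (by exact_mod_cast le_top))
  choose B hB using h1
  refine ⟨1 + ∑ i ∈ Finset.range (N + 1), |B i|, by positivity, fun i hi z => (hB i z).trans ?_⟩
  have := Finset.single_le_sum (f := fun i => |B i|) (fun i _ => abs_nonneg _)
    (Finset.mem_range.2 (Nat.lt_succ_of_le hi))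
  have := le_abs_self (B i)
  linarith

/-- Derivative bounds for translated reflected members of the families. -/
theorem Ph_reflect_bound {φ₀ : (Fin n → ℝ) → ℝ} (h : IsTestFun n φ₀) (N : ℕ) :
    ∃ B : ℝ, 0 < B ∧ ∀ (k i : ℕ), i ≤ N → ∀ x z : Fin n → ℝ,
      ‖iteratedFDeriv ℝ i (fun u => Ph n φ₀ k (x - u)) z‖ ≤ 2 ^ (k * n) * (2 ^ k) ^ i * B := by
  obtain ⟨B, hB, hb⟩ := exists_deriv_bound h N
  refine ⟨B, hB, fun k i hi x z => ?_⟩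
  have e : (fun u => Ph n φ₀ k (x - u)) = fun u => (2 : ℝ) ^ (k * n) *
      φ₀ ((2 : ℝ) ^ k • x + (-(2 : ℝ) ^ k) • u) := by
    funext u; rw [Ph, smul_sub, neg_smul, sub_eq_add_neg]
  rw [e]
  refine (norm_iteratedFDeriv_scale h.1 _ _ _ i (hb i hi) z).trans (le_of_eq ?_)
  rw [abs_neg, abs_of_pos (by positivity), abs_of_pos (by positivity)]; ring

theorem phiFam_reflect_bound {φ₀ : (Fin n → ℝ) → ℝ} (h : IsTestFun n φ₀) (N : ℕ) :
    ∃ B : ℝ, 0 < B ∧ ∀ (k i : ℕ), i ≤ N → ∀ x z : Fin n → ℝ,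
      ‖iteratedFDeriv ℝ i (fun u => phiFam n φ₀ k (x - u)) z‖ ≤ 2 ^ (k * n) * (2 ^ k) ^ i * B := by
  obtain ⟨B, hB, hb⟩ := Ph_reflect_bound h N
  refine ⟨2 * B, by positivity, fun k i hi x z => ?_⟩
  have sm : ∀ k, ContDiff ℝ (⊤ : ℕ∞) (fun u => Ph n φ₀ k (x - u)) := fun k =>
    (Ph_contDiff h.1 k).comp (contDiff_const.sub contDiff_id)
  have h0 : (0 : ℝ) ≤ 2 ^ (k * n) * (2 ^ k) ^ i * B := by positivity
  cases k with
  | zero =>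
    rw [phiFam_zero]
    have := hb 0 i hi x z
    linarith
  | succ k =>
    rw [phiFam_succ]
    have e : (fun u => (Ph n φ₀ (k + 1) - Ph n φ₀ k) (x - u)) =
      (fun u => Ph n φ₀ (k + 1) (x - u)) - (fun u => Ph n φ₀ k (x - u)) := rfl
    rw [e, iteratedFDeriv_sub_apply (((sm _).of_le (by exact_mod_cast le_top)).contDiffAt)
      (((sm _).of_le (by exact_mod_cast le_top)).contDiffAt)]
    have h1 := hb (k + 1) i hi x z
    have h2 := hb k i hi x z
    have h3 : (2 : ℝ) ^ (k * n) * (2 ^ k) ^ i * B ≤ 2 ^ ((k + 1) * n) * (2 ^ (k + 1)) ^ i * B := by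
      gcongr <;> norm_num
    have := norm_sub_le (iteratedFDeriv ℝ i (fun u => Ph n φ₀ (k + 1) (x - u)) z)
      (iteratedFDeriv ℝ i (fun u => Ph n φ₀ k (x - u)) z)
    linarith

theorem phiFam_supp {φ₀ : (Fin n → ℝ) → ℝ} {c : ℝ} (hc0 : 0 ≤ c) (hc : ∀ z, φ₀ z ≠ 0 → ‖z‖ ≤ c)
    (k : ℕ) (z : Fin n → ℝ) (hz : phiFam n φ₀ k z ≠ 0) : ‖z‖ ≤ 2 * c / 2 ^ k := by
  cases k with
  | zero =>
    rw [phiFam_zero] at hz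
    refine (Ph_supp hc 0 z hz).trans ?_
    gcongr; linarith
  | succ k =>
    rw [phiFam_succ, Pi.sub_apply] at hz
    by_cases h1 : Ph n φ₀ k z = 0
    · have := Ph_supp hc (k + 1) z (by intro h; exact hz (by rw [h, h1, sub_zero]))
      refine this.trans ?_
      gcongr; linarith
    · refine (Ph_supp hc k z h1).trans (le_of_eq ?_)
      rw [pow_succ]; field_simp

end kernels

section ringalg
variable {A : Type*} [Ring A] (S : ℕ → A)

def gQ (h k : ℕ) : A := ∑ i ∈ Finset.range (h + 1), (1 - S k) ^ i

def gR (h k : ℕ) : A := 1 - (1 - S k) ^ (h + 1)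

def gG (h k : ℕ) : A :=
  ∑ i ∈ Finset.range (h + 1), (1 - S k) ^ i * (1 - S (k + 1)) ^ (h - i)

/-- The reproducing operators. -/
def gPsi (h : ℕ) : ℕ → A
  | 0 => S 0 * gQ S h 0 ^ 2
  | k + 1 => (gR S h (k + 1) + gR S h k) * gG S h k

def gD : ℕ → A
  | 0 => S 0
  | k + 1 => S (k + 1) - S k

variable {S}

theorem g_comm1 (hS : ∀ k j, Commute (S k) (S j)) (k j : ℕ) : Commute (1 - S k) (1 - S j) :=
  ((Commute.one_left _).sub_left (((Commute.one_right _)).sub_right (hS k j)))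

theorem g_comm_SR (hS : ∀ k j, Commute (S k) (S j)) (h k j : ℕ) : Commute (S k) (gR S h j) :=
  (Commute.one_right _).sub_right
    (((Commute.one_right _).sub_right (hS k j)).pow_right _)

theorem g_comm_RR (hS : ∀ k j, Commute (S k) (S j)) (h k j : ℕ) : Commute (gR S h k) (gR S h j) :=
  (Commute.one_right _).sub_right ((((Commute.one_right _).sub_right
    (g_comm_SR hS h j k).symm).pow_right _))

theorem g_comm_SQ (hS : ∀ k j, Commute (S k) (S j)) (h k j : ℕ) : Commute (S k) (gQ S h j) :=
  Commute.sum_right _ _ _ fun i _ => ((Commute.one_right _).sub_right (hS k j)).pow_right _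

theorem g_comm_SG (hS : ∀ k j, Commute (S k) (S j)) (h k j : ℕ) : Commute (S k) (gG S h j) :=
  Commute.sum_right _ _ _ fun i _ =>
    (((Commute.one_right _).sub_right (hS k _)).pow_right _).mul_right
    (((Commute.one_right _).sub_right (hS k _)).pow_right _)

theorem g_R_eq (h k : ℕ) : gR S h k = S k * gQ S h k := by
  have := mul_neg_geom_sum (1 - S k) (h + 1)
  rw [_root_.sub_sub_cancel] at this
  exact this.symm

theorem g_D_Psi_zero (hS : ∀ k j, Commute (S k) (S j)) (h : ℕ) : gD S 0 * gPsi S h 0 = gR S h 0 ^ 2 := by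
  rw [gD, gPsi, g_R_eq, (g_comm_SQ hS h 0 0).mul_pow, ← mul_assoc, sq (S 0)]

theorem g_D_Psi_succ (hS : ∀ k j, Commute (S k) (S j)) (h k : ℕ) :
    gD S (k + 1) * gPsi S h (k + 1) = gR S h (k + 1) ^ 2 - gR S h k ^ 2 := by
  have h1 := (g_comm1 hS k (k + 1)).mul_geom_sum₂ (h + 1)
  have h2 : (S (k + 1) - S k) * gG S h k = gR S h (k + 1) - gR S h k := by
    have e : S (k + 1) - S k = (1 - S k) - (1 - S (k + 1)) := by abel
    rw [e, gG, gR, gR]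
    simp only [Nat.add_sub_cancel] at h1
    rw [h1]; abel
  have hc : Commute (S (k + 1) - S k) (gR S h (k + 1) + gR S h k) :=
    ((g_comm_SR hS h _ _).add_right (g_comm_SR hS h _ _)).sub_left
      ((g_comm_SR hS h _ _).add_right (g_comm_SR hS h _ _))
  rw [gD, gPsi, ← mul_assoc, hc.eq, mul_assoc, h2, ← (g_comm_RR hS h (k + 1) k).sq_sub_sq]

theorem g_sum (hS : ∀ k j, Commute (S k) (S j)) (h l J : ℕ) :
    ∑ i ∈ Finset.range J, gD S (l + i + 1) * gPsi S h (l + i + 1) =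
      gR S h (l + J) ^ 2 - gR S h l ^ 2 := by
  induction J with
  | zero => simp
  | succ J ih => rw [Finset.sum_range_succ, ih, g_D_Psi_succ hS]; rw [← add_assoc]; abel

theorem g_one_sub (h k : ℕ) :
    1 - gR S h k ^ 2 = (1 + gR S h k) * (1 - S k) ^ h * (1 - S k) := by
  have : (1 : A) - gR S h k ^ 2 = (1 + gR S h k) * (1 - gR S h k) := by
    noncomm_ring
  rw [this, mul_assoc, ← pow_succ]
  congr 1
  simp [gR]

/-- Decomposition `Psi (k+1) = T * S (k+1) + T' * S k`. -/
theorem g_Psi_succ_eq (hS : ∀ k j, Commute (S k) (S j)) (h k : ℕ) :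
    gPsi S h (k + 1) = (gQ S h (k + 1) * gG S h k) * S (k + 1) + (gQ S h k * gG S h k) * S k := by
  rw [gPsi, g_R_eq, g_R_eq, add_mul, (g_comm_SQ hS h _ _).eq, (g_comm_SQ hS h k k).eq, mul_assoc,
    (g_comm_SG hS h _ _).eq, mul_assoc, (g_comm_SG hS h k k).eq, ← mul_assoc, ← mul_assoc]

theorem g_Psi_zero_eq (hS : ∀ k j, Commute (S k) (S j)) (h : ℕ) : gPsi S h 0 = gQ S h 0 ^ 2 * S 0 := by
  rw [gPsi, ((g_comm_SQ hS h 0 0).pow_right 2).eq]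

theorem g_R_sq_eq (hS : ∀ k j, Commute (S k) (S j)) (h k : ℕ) : gR S h k ^ 2 = S k * gQ S h k ^ 2 * S k := by
  rw [g_R_eq, (g_comm_SQ hS h k k).mul_pow, mul_assoc, ← ((g_comm_SQ hS h k k).pow_right 2).eq,
   ← mul_assoc, sq (S k)]

end ringalg

section repr
variable {n : ℕ} {φ₀ : (Fin n → ℝ) → ℝ}

def So (h0 : IsTestFun n φ₀) (k : ℕ) : Module.End ℝ (Sm n) := Aop (Ph n φ₀ k) (Ph_test h0 k)

def Dl (h0 : IsTestFun n φ₀) (k : ℕ) : Module.End ℝ (Sm n) := Aop (phiFam n φ₀ k) (phiFam_test h0 k)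

theorem Dl_zero (h0 : IsTestFun n φ₀) : Dl h0 0 = So h0 0 := by
  ext θ : 2
  change avg (phiFam n φ₀ 0) θ.1 = avg (Ph n φ₀ 0) θ.1
  rw [phiFam_zero]

theorem Dl_succ (h0 : IsTestFun n φ₀) (k : ℕ) : Dl h0 (k + 1) = So h0 (k + 1) - So h0 k := by
  ext θ u
  change avg (phiFam n φ₀ (k + 1)) θ.1 u = avg (Ph n φ₀ (k + 1)) θ.1 u - avg (Ph n φ₀ k) θ.1 u
  rw [phiFam_succ]
  have h1 := avg_integrable (Ph_test h0 (k + 1)).1.continuous (Ph_test h0 (k + 1)).2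
    (Sm_cd θ).continuous u
  have h2 := avg_integrable (Ph_test h0 k).1.continuous (Ph_test h0 k).2
    (Sm_cd θ).continuous u
  simp only [smul_eq_mul] at h1 h2
  simp only [avg, Pi.sub_apply, sub_mul]
  exact integral_sub h1 h2

theorem So_comm (h0 : IsTestFun n φ₀) (k j : ℕ) : Commute (So h0 k) (So h0 j) := Aop_comm _ _ _ _

theorem Dl_eq (h0 : IsTestFun n φ₀) (k : ℕ) : Dl h0 k = gD (So h0) k := by
  cases k with
  | zero => exact Dl_zero h0
  | succ k => exact Dl_succ h0 k

end repr

/-! ### Part 3: operator bounds -/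

section opb
variable {n : ℕ} {φ₀ : (Fin n → ℝ) → ℝ}

theorem OpB.congr {T T' : Module.End ℝ (Sm n)} {a : ℕ} {δ K : ℝ}
    (h : OpB T a δ K) (e : T = T') : OpB T' a δ K := e ▸ h

/-- Basic data of the kernel. -/
structure KD (φ₀ : (Fin n → ℝ) → ℝ) (c I : ℝ) : Prop where
  test : IsTestFun n φ₀
  hc0 : 0 < c
  hc : ∀ z, φ₀ z ≠ 0 → ‖z‖ ≤ c
  hI : ∫ z, ‖φ₀ z‖ ≤ I
  hI1 : 1 ≤ I
  hint : ∫ z, φ₀ z = 1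

theorem KD.exists (h0 : IsTestFun n φ₀) (hint : ∫ z, φ₀ z = 1) : ∃ c I, KD φ₀ c I := by
  obtain ⟨c, hc0, hc⟩ := exists_supp_bound h0.2
  exact ⟨c, max 1 (∫ z, ‖φ₀ z‖), h0, hc0, hc, le_max_right _ _, le_max_left _ _, hint⟩

variable {c I : ℝ}

theorem KD.S (D : KD φ₀ c I) (k : ℕ) : OpB (So D.test k) 0 (c / 2 ^ k) (1 + I) := by
  have hc0 := D.hc0
  apply (OpB.aop (Ph_test D.test k) (c := c / 2 ^ k) (I := I) (by positivity) (Ph_supp D.hc k)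
    (by rw [Ph_integral_norm]; exact D.hI)).mono le_rfl (by positivity) (by linarith)

theorem KD.U0 (D : KD φ₀ c I) (k : ℕ) : OpB (1 - So D.test k) 0 (c / 2 ^ k) (1 + I) := by
  have hc0 := D.hc0
  have := (OpB.one (n := n) (δ := c / 2 ^ k) (by positivity)).add
    (OpB.aop (Ph_test D.test k) (c := c / 2 ^ k) (I := I) (by positivity) (Ph_supp D.hc k)
    (by rw [Ph_integral_norm]; exact D.hI)).neg
  exact this.congr (by ext θ x; exact (sub_eq_add_neg (θ.1 x) _).symm)

theorem KD.U1 (D : KD φ₀ c I) (k : ℕ) : OpB (1 - So D.test k) 1 (c / 2 ^ k) (I * (c / 2 ^ k)) := by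
  have hc0 := D.hc0
  exact OpB.one_sub_aop (Ph_test D.test k) (c := c / 2 ^ k) (I := I) (by positivity) (Ph_supp D.hc k)
    (by rw [Ph_integral_norm]; exact D.hI) (by rw [Ph_integral]; exact D.hint)

theorem KD.U0pow (D : KD φ₀ c I) (k i : ℕ) :
    OpB ((1 - So D.test k) ^ i) 0 (i * (c / 2 ^ k)) ((1 + I) ^ i) := by
  simpa using (D.U0 k).pow i

theorem KD.Q (D : KD φ₀ c I) (h k : ℕ) :
    OpB (gQ (So D.test) h k) 0 ((h + 1) * (c / 2 ^ k)) ((h + 1) * (1 + I) ^ (h + 1)) := by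
  have hc0 := D.hc0
  have hI1 := D.hI1
  have := OpB.sum (Finset.range (h + 1)) (T := fun i => (1 - So D.test k) ^ i) (a := 0)
    (δ := (h + 1) * (c / 2 ^ k)) (K := (1 + I) ^ (h + 1)) (by
      intro i hi
      have hi := Finset.mem_range.1 hi
      have hi' : (i : ℝ) ≤ h + 1 := by exact_mod_cast hi.le
      exact (D.U0pow k i).mono (by gcongr) (by positivity)
        (pow_le_pow_right₀ (by linarith) hi.le))
  simpa [gQ] using this

theorem KD.R (D : KD φ₀ c I) (h k : ℕ) :
    OpB (gR (So D.test) h k) 0 ((h + 1) * (c / 2 ^ k)) (1 + (1 + I) ^ (h + 1)) := by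
  have hc0 := D.hc0
  have := (OpB.one (n := n) (δ := (h + 1) * (c / 2 ^ k)) (by positivity)).add
    (((D.U0pow k (h + 1)).mono (by push_cast; exact le_rfl) (by positivity) le_rfl)).neg
  exact this.congr (by ext θ x; exact (sub_eq_add_neg (θ.1 x) _).symm)

theorem KD.G0 (D : KD φ₀ c I) (h k : ℕ) :
    OpB (gG (So D.test) h k) 0 ((h + 1) * (c / 2 ^ k)) ((h + 1) * (1 + I) ^ (h + 1)) := by
  have hc0 := D.hc0
  have hI1 := D.hI1
  have := OpB.sum (Finset.range (h + 1))
    (T := fun i => (1 - So D.test k) ^ i * (1 - So D.test (k + 1)) ^ (h - i)) (a := 0)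
    (δ := (h + 1) * (c / 2 ^ k)) (K := (1 + I) ^ (h + 1)) (by
      intro i hi
      have hi := Finset.mem_range.1 hi
      have hi' : (i : ℝ) ≤ h := by exact_mod_cast Nat.lt_succ_iff.1 hi
      refine ((D.U0pow k i).mul (D.U0pow (k + 1) (h - i))).mono ?_ (by positivity) ?_
      · rw [Nat.cast_sub (Nat.lt_succ_iff.1 hi), pow_succ]
        have : c / (2 ^ k * 2) ≤ c / 2 ^ k := by
          gcongr; linarith [show (0 : ℝ) < 2 ^ k by positivity]
        have h2 : 0 < c / 2 ^ k := by positivity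
        nlinarith
      · rw [← pow_add]
        exact (pow_le_pow_right₀ (by linarith) (by omega)))
  simpa [gG] using this

theorem KD.Gh (D : KD φ₀ c I) (h k : ℕ) :
    OpB (gG (So D.test) h k) h ((h + 1) * (c / 2 ^ k)) ((h + 1) * (I * (c / 2 ^ k)) ^ h) := by
  have hc0 := D.hc0
  have hI1 := D.hI1
  have := OpB.sum (Finset.range (h + 1))
    (T := fun i => (1 - So D.test k) ^ i * (1 - So D.test (k + 1)) ^ (h - i)) (a := h)
    (δ := (h + 1) * (c / 2 ^ k)) (K := (I * (c / 2 ^ k)) ^ h) (by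
      intro i hi
      have hi := Nat.lt_succ_iff.1 (Finset.mem_range.1 hi)
      have hi' : (i : ℝ) ≤ h := by exact_mod_cast hi
      have h1 := ((D.U1 k).pow i).mul ((D.U1 (k + 1)).pow (h - i))
      have e : i * 1 + (h - i) * 1 = h := by omega
      rw [e] at h1
      have h3 : c / (2 ^ k * 2) ≤ c / 2 ^ k := by
          gcongr; linarith [show (0 : ℝ) < 2 ^ k by positivity]
      refine h1.mono ?_ (by positivity) ?_
      · rw [Nat.cast_sub hi, pow_succ]
        have h2 : 0 < c / 2 ^ k := by positivity
        nlinarith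
      · calc _ ≤ (I * (c / 2 ^ k)) ^ i * (I * (c / 2 ^ k)) ^ (h - i) := by
              rw [pow_succ]; gcongr
          _ = _ := by rw [← pow_add]; congr 1; omega)
  simpa [gG] using this

/-- localization radius constant -/
def cR (h : ℕ) (c : ℝ) : ℝ := 8 * (h + 2) * c

theorem KD.SQ2 (D : KD φ₀ c I) (h : ℕ) : ∃ C, 0 < C ∧ ∀ k,
    OpB (So D.test k * gQ (So D.test) h k ^ 2) 0 (cR h c / 2 ^ k) C := by
  have hc0 := D.hc0
  have hI1 := D.hI1
  refine ⟨(1 + I) * (((h + 1) * (1 + I) ^ (h + 1)) ^ 2), by positivity, fun k => ?_⟩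
  refine ((D.S k).mul ((D.Q h k).pow 2)).mono ?_ (by unfold cR; positivity) le_rfl
  rw [cR, mul_div_assoc]
  have h2 : 0 < c / 2 ^ k := by positivity
  have h3 : 0 < h * (c / 2 ^ k) + c / 2 ^ k := by positivity
  push_cast; nlinarith

theorem KD.Q2 (D : KD φ₀ c I) (h : ℕ) : ∃ C, 0 < C ∧ ∀ k,
    OpB (gQ (So D.test) h k ^ 2) 0 (cR h c / 2 ^ k) C := by
  have hc0 := D.hc0
  have hI1 := D.hI1
  refine ⟨(((h + 1) * (1 + I) ^ (h + 1)) ^ 2), by positivity, fun k => ?_⟩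
  refine (((D.Q h k).pow 2)).mono ?_ (by unfold cR; positivity) le_rfl
  rw [cR, mul_div_assoc]
  have h2 : 0 < c / 2 ^ k := by positivity
  have h3 : 0 < h * (c / 2 ^ k) + c / 2 ^ k := by positivity
  push_cast; nlinarith

theorem KD.QG (D : KD φ₀ c I) (h : ℕ) : ∃ C, 0 < C ∧ ∀ k,
    OpB (gQ (So D.test) h (k + 1) * gG (So D.test) h k) 0 (cR h c / 2 ^ (k + 1)) C ∧
    OpB (gQ (So D.test) h k * gG (So D.test) h k) 0 (cR h c / 2 ^ (k + 1)) C := by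
  have hc0 := D.hc0
  have hI1 := D.hI1
  refine ⟨(((h + 1) * (1 + I) ^ (h + 1)) * ((h + 1) * (1 + I) ^ (h + 1))), by positivity,
    fun k => ⟨?_, ?_⟩⟩
  · refine ((D.Q h _).mul (D.G0 h k)).mono ?_ (by unfold cR; positivity) le_rfl
    rw [cR, mul_div_assoc, pow_succ]
    have h2 : 0 < c / 2 ^ k := by positivity
    have h4 : c / (2 ^ k * 2) = c / 2 ^ k / 2 := by rw [div_div]
    rw [h4]
    have h3 : 0 < h * (c / 2 ^ k) + c / 2 ^ k := by positivity
    nlinarith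
  · refine ((D.Q h _).mul (D.G0 h k)).mono ?_ (by unfold cR; positivity) le_rfl
    rw [cR, mul_div_assoc, pow_succ]
    have h2 : 0 < c / 2 ^ k := by positivity
    have h4 : c / (2 ^ k * 2) = c / 2 ^ k / 2 := by rw [div_div]
    rw [h4]
    have h3 : 0 < h * (c / 2 ^ k) + c / 2 ^ k := by positivity
    nlinarith

theorem KD.oneSubR (D : KD φ₀ c I) (h : ℕ) : ∃ C, 0 < C ∧ ∀ k,
    OpB (1 - gR (So D.test) h k ^ 2) 1 (cR h c / 2 ^ k) (C / 2 ^ k) := by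
  have hc0 := D.hc0
  have hI1 := D.hI1
  refine ⟨(1 + (1 + (1 + I) ^ (h + 1))) * (1 + I) ^ h * (I * c), by positivity, fun k => ?_⟩
  have h1 := (((OpB.one (n := n) (δ := (h + 1) * (c / 2 ^ k)) (by positivity)).add (D.R h k)).mul
    (D.U0pow k h)).mul (D.U1 k)
  have e := g_one_sub (S := So D.test) h k
  have h2 := h1.congr e.symm
  refine h2.mono ?_ (by unfold cR; positivity) ?_
  · rw [cR, mul_div_assoc]
    have h2 : 0 < c / 2 ^ k := by positivity
    have h3 : 0 < h * (c / 2 ^ k) + c / 2 ^ k := by positivity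
    nlinarith
  · rw [mul_div_assoc, mul_div_assoc]

/-- Order zero bounds of the reproducing operators. -/
theorem KD.Psi0 (D : KD φ₀ c I) (h : ℕ) : ∃ C, 0 < C ∧ ∀ k,
    OpB (gPsi (So D.test) h k) 0 (cR h c / 2 ^ k) C := by
  have hc0 := D.hc0
  have hI1 := D.hI1
  obtain ⟨C, hC, hb⟩ := D.SQ2 h
  refine ⟨C + (1 + (1 + I) ^ (h + 1) + (1 + (1 + I) ^ (h + 1))) * ((h + 1) * (1 + I) ^ (h + 1)),
    by positivity, fun k => ?_⟩
  cases k with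
  | zero => exact (hb 0).mono le_rfl (by unfold cR; positivity) (by simp; positivity)
  | succ k =>
    have h1 := ((((D.R h (k + 1)).mono (δ' := (h + 1) * (c / 2 ^ k)) (by gcongr <;> norm_num)
      (by positivity) le_rfl).add (D.R h k))).mul (D.G0 h k)
    refine OpB.mono (T := gPsi (So D.test) h (k + 1)) h1 ?_ (by unfold cR; positivity) (by linarith)
    rw [cR, mul_div_assoc, pow_succ]
    have h2 : 0 < c / 2 ^ k := by positivity
    have h4 : c / (2 ^ k * 2) = c / 2 ^ k / 2 := by rw [div_div]
    rw [h4]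
    have h3 : 0 < h * (c / 2 ^ k) + c / 2 ^ k := by positivity
    nlinarith

/-- Order `h` bounds of the reproducing operators. -/
theorem KD.Psih (D : KD φ₀ c I) (h : ℕ) : ∃ C, 0 < C ∧ ∀ k,
    OpB (gPsi (So D.test) h (k + 1)) h (cR h c / 2 ^ (k + 1)) (C / (2 ^ (k + 1)) ^ h) := by
  have hc0 := D.hc0
  have hI1 := D.hI1
  refine ⟨(1 + (1 + I) ^ (h + 1) + (1 + (1 + I) ^ (h + 1))) * ((h + 1) * (I * (c * 2)) ^ h),
    by positivity, fun k => ?_⟩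
  have h1 := ((((D.R h (k + 1)).mono (δ' := (h + 1) * (c / 2 ^ k)) (by gcongr <;> norm_num)
      (by positivity) le_rfl).add (D.R h k))).mul (D.Gh h k)
  rw [zero_add] at h1
  refine OpB.mono (T := gPsi (So D.test) h (k + 1)) h1 ?_ (by unfold cR; positivity) ?_
  · rw [cR, mul_div_assoc, pow_succ]
    have h2 : 0 < c / 2 ^ k := by positivity
    have h4 : c / (2 ^ k * 2) = c / 2 ^ k / 2 := by rw [div_div]
    rw [h4]
    have h3 : 0 < h * (c / 2 ^ k) + c / 2 ^ k := by positivity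
    nlinarith
  · rw [mul_div_assoc, mul_div_assoc, ← div_pow]
    apply le_of_eq
    congr 3
    rw [pow_succ]; field_simp

end opb

/-! ### Part 4: Taylor expansion and kernel bounds -/

section taylor
variable {n : ℕ}

theorem moment_poly {φ : (Fin n → ℝ) → ℝ} {L : ℤ} (hφ : IsTestFun n φ) (hm : MomentsVanish n L φ)
    (k : ℕ) (hk : (k : ℤ) ≤ L) (T : (Fin n → ℝ) [×k]→L[ℝ] ℝ) :
    ∫ z, φ z * T (fun _ => z) = 0 := by
  have e : ∀ z : Fin n → ℝ, T (fun _ => z) =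
      ∑ f : Fin k → Fin n, (∏ i, z i ^ (Finset.univ.filter (fun a => f a = i)).card) *
        T (fun a => Pi.single (f a) 1) := by
    intro z
    have h1 : (fun _ : Fin k => z) = fun a : Fin k => ∑ j : Fin n, z j • (Pi.single j (1:ℝ) : Fin n → ℝ) := by
      funext a
      funext i
      simp [Finset.sum_apply, Pi.single_apply]
    rw [h1, ContinuousMultilinearMap.map_sum]
    refine Finset.sum_congr rfl fun f _ => ?_
    rw [ContinuousMultilinearMap.map_smul_univ, smul_eq_mul]
    congr 1
    rw [← Finset.prod_fiberwise (s := Finset.univ) (g := f)]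
    refine Finset.prod_congr rfl fun i _ => ?_
    rw [Finset.prod_congr rfl (g := fun _ => z i) (fun a ha => by rw [(Finset.mem_filter.1 ha).2]),
      Finset.prod_const]
  simp only [e, Finset.mul_sum]
  rw [integral_finsetSum]
  · refine Finset.sum_eq_zero fun f _ => ?_
    have := hm (fun i => (Finset.univ.filter (fun a => f a = i)).card) (by
      rw [← Finset.card_eq_sum_card_fiberwise (f := f) (fun _ _ => Finset.mem_coe.2 (Finset.mem_univ _))]
      simpa using hk)
    calc _ = ∫ z, ((∏ i, z i ^ (Finset.univ.filter (fun a => f a = i)).card) * φ z) *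
          T (fun a => Pi.single (f a) 1) := by congr 1; funext z; ring
      _ = 0 := by rw [integral_mul_const, this, zero_mul]
  · intro f _
    apply Continuous.integrable_of_hasCompactSupport
    · have := hφ.1.continuous
      fun_prop
    · exact hφ.2.mul_right

theorem taylor_moment {φ : (Fin n → ℝ) → ℝ} (hφ : IsTestFun n φ) {L : ℤ} (hL : -1 ≤ L)
    (hm : MomentsVanish n L φ) {s : ℕ} (hs : (s : ℤ) = L + 1) :
    ∃ C : ℝ, 0 < C ∧ ∀ (g : (Fin n → ℝ) → ℝ) (B : ℝ), ContDiff ℝ (⊤ : ℕ∞) g →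
      (∀ z, ‖iteratedFDeriv ℝ s g z‖ ≤ B) → |∫ z, φ z * g z| ≤ C * B := by
  have hφi := hφ.1.continuous.integrable_of_hasCompactSupport (μ := volume) hφ.2
  refine ⟨1 + ∫ z, ‖φ z‖ * ‖z‖ ^ s, by positivity, fun g B hg hB => ?_⟩
  have hB0 : 0 ≤ B := (norm_nonneg _).trans (hB 0)
  have hint : Integrable (fun z => ‖φ z‖ * ‖z‖ ^ s) := by
    apply Continuous.integrable_of_hasCompactSupport
    · have := hφ.1.continuous
      fun_prop
    · exact hφ.2.norm.mul_right
  have key : ∃ r : (Fin n → ℝ) → ℝ, ∫ z, φ z * g z = ∫ z, φ z * r z ∧ ∀ z, |r z| ≤ ‖z‖ ^ s * B := by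
    cases s with
    | zero =>
      refine ⟨g, rfl, fun z => ?_⟩
      have := hB z
      rw [norm_iteratedFDeriv_zero] at this
      simpa using this
    | succ m =>
      set P : (Fin n → ℝ) → ℝ := fun z => ∑ k ∈ Finset.range (m + 1),
        (k.factorial : ℝ)⁻¹ • (iteratedFDeriv ℝ k g 0 (fun _ ↦ z)) with hP
      have hPc : Continuous P := by
        apply continuous_finsetSum
        intro k _
        have : Continuous (fun z : Fin n → ℝ => (fun _ : Fin k => z)) := by fun_prop
        exact ((iteratedFDeriv ℝ k g 0).cont.comp this).const_smul (k.factorial : ℝ)⁻¹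
      refine ⟨fun z => g z - P z, ?_, fun z => ?_⟩
      · have h0 : ∫ z, φ z * P z = 0 := by
          simp only [hP, Finset.mul_sum]
          rw [integral_finsetSum]
          · refine Finset.sum_eq_zero fun k hk => ?_
            have h2 := moment_poly hφ hm k (by have := Finset.mem_range.1 hk; push_cast at hs; omega)
              (iteratedFDeriv ℝ k g 0)
            calc _ = ∫ z, (k.factorial : ℝ)⁻¹ * (φ z * (iteratedFDeriv ℝ k g 0 (fun _ ↦ z))) := by
                  congr 1; funext z; rw [smul_eq_mul]; ring
              _ = 0 := by rw [integral_const_mul, h2, mul_zero]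
          · intro k _
            apply Continuous.integrable_of_hasCompactSupport
            · have : Continuous (fun z : Fin n → ℝ => (fun _ : Fin k => z)) := by fun_prop
              exact hφ.1.continuous.mul
                (((iteratedFDeriv ℝ k g 0).cont.comp this).const_smul (k.factorial : ℝ)⁻¹)
            · exact hφ.2.mul_right
        simp only [mul_sub]
        rw [integral_sub, h0, sub_zero]
        · exact (hφ.1.continuous.mul hg.continuous).integrable_of_hasCompactSupport hφ.2.mul_right
        · exact (hφ.1.continuous.mul hPc).integrable_of_hasCompactSupport hφ.2.mul_right
      · have h1 := map_add_eq_sum_add_integral_iteratedFDeriv (f := g) (x := 0) (y := z) (n := m)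
          (fun t _ => (hg.of_le (by exact_mod_cast le_top)).contDiffAt)
        rw [zero_add] at h1
        have h2 : g z - P z = (m.factorial : ℝ)⁻¹ • ∫ t in (0:ℝ)..1, (1 - t)^m •
          iteratedFDeriv ℝ (m + 1) g (0 + t • z) (fun _ ↦ z) := by rw [h1, hP]; simp
        change |g z - P z| ≤ _
        rw [h2, smul_eq_mul, abs_mul]
        have h3 := intervalIntegral.norm_integral_le_of_norm_le_const (a := (0:ℝ)) (b := 1)
          (f := fun t => (1 - t)^m • iteratedFDeriv ℝ (m + 1) g (0 + t • z) (fun _ ↦ z))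
          (C := ‖z‖ ^ (m + 1) * B) (by
            intro t ht
            rw [Set.uIoc_of_le zero_le_one] at ht
            rw [norm_smul]
            have h4 : ‖(1 - t) ^ m‖ ≤ 1 := by
              rw [norm_pow, Real.norm_eq_abs]
              apply pow_le_one₀ (abs_nonneg _)
              rw [abs_le]; constructor <;> linarith [ht.1, ht.2]
            have h5 : ‖iteratedFDeriv ℝ (m + 1) g (0 + t • z) (fun _ ↦ z)‖ ≤ B * ‖z‖ ^ (m + 1) := by
              refine (ContinuousMultilinearMap.le_opNorm _ _).trans ?_
              simp only [Finset.prod_const, Finset.card_univ, Fintype.card_fin]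
              gcongr
              exact hB _
            calc _ ≤ 1 * (B * ‖z‖ ^ (m + 1)) := by gcongr
              _ = _ := by ring)
        have h6 : |(m.factorial : ℝ)⁻¹| ≤ 1 := by
          rw [abs_of_pos (by positivity)]
          apply inv_le_one_of_one_le₀
          exact_mod_cast Nat.one_le_iff_ne_zero.2 (Nat.factorial_ne_zero m)
        rw [Real.norm_eq_abs] at h3
        simp only [sub_zero, abs_one, mul_one] at h3
        calc _ ≤ 1 * (‖z‖ ^ (m + 1) * B) := by gcongr
          _ = _ := one_mul _
  obtain ⟨r, hr, hrb⟩ := key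
  rw [hr, ← Real.norm_eq_abs]
  calc ‖∫ z, φ z * r z‖ ≤ ∫ z, ‖φ z‖ * ‖z‖ ^ s * B := by
        apply norm_integral_le_of_norm_le (hint.mul_const B)
        refine Eventually.of_forall fun z => ?_
        rw [norm_mul, mul_assoc]
        gcongr
        exact hrb z
    _ = (∫ z, ‖φ z‖ * ‖z‖ ^ s) * B := integral_mul_const _ _
    _ ≤ _ := by gcongr; linarith

theorem phiOf_test {φ₀ : (Fin n → ℝ) → ℝ} (h : IsTestFun n φ₀) : IsTestFun n (phiOf n φ₀) := by
  have h1 := phiFam_test h 1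
  have e : phiOf n φ₀ = fun x => (2 : ℝ)⁻¹ ^ n * phiFam n φ₀ 1 ((2 : ℝ)⁻¹ • x) := by
    funext x
    simp [phiFam, smul_smul]
  obtain ⟨c, hc0, hc⟩ := exists_supp_bound h1.2
  refine ⟨by rw [e]; exact contDiff_const.mul (h1.1.comp (contDiff_id.const_smul _)),
    compact_of_bound (c := 2 * c) ?_⟩
  intro z hz
  rw [e] at hz
  have := hc _ (right_ne_zero_of_mul hz)
  rw [norm_smul, norm_inv, Real.norm_ofNat] at this
  linarith

theorem S_eta_bound {φ₀ : (Fin n → ℝ) → ℝ} (h0 : IsTestFun n φ₀) {L : ℤ} (hL : -1 ≤ L)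
    (hm : MomentsVanish n L (phiOf n φ₀)) {s : ℕ} (hs : (s : ℤ) = L + 1) :
    ∃ C : ℝ, 0 < C ∧ ∀ (k l : ℕ) (x y : Fin n → ℝ),
      |avg (Ph n φ₀ k) (fun u => phiFam n φ₀ (l + 1) (x - u)) y| ≤
        C * 2 ^ (k * n) * (2 ^ k / 2 ^ (l + 1)) ^ s := by
  obtain ⟨C, hC, hb⟩ := taylor_moment (phiOf_test h0) hL hm hs
  obtain ⟨B, hB, hB'⟩ := exists_deriv_bound h0 s
  refine ⟨C * B, by positivity, fun k l x y => ?_⟩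
  rw [avg_reflect]
  have e : avg (phiFam n φ₀ (l + 1)) (fun u => Ph n φ₀ k (x - u)) y =
      ∫ v, phiOf n φ₀ v * ((2 : ℝ) ^ (k * n) * φ₀ ((2 : ℝ) ^ k • (x - y) +
        (-(2 ^ k / 2 ^ (l + 1) : ℝ)) • v)) := by
    rw [← integral_scale _ (l + 1), avg]
    congr 1; funext z
    simp only [phiFam, Ph]
    rw [smul_smul, show x - (y + z) = (x - y) + (-1 : ℝ) • z by rw [neg_one_smul]; abel, smul_add (2 ^ k : ℝ),
      smul_smul, show (2 : ℝ) ^ k * -1 = -(2 ^ k / 2 ^ (l + 1)) * 2 ^ (l + 1) by field_simp]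
    ring
  rw [e]
  refine (hb _ (|(2 : ℝ) ^ (k * n)| * (|(-(2 ^ k / 2 ^ (l + 1) : ℝ))| ^ s * B)) ?_
    (norm_iteratedFDeriv_scale h0.1 _ _ _ s (hB' s le_rfl))).trans (le_of_eq ?_)
  · exact contDiff_const.mul (h0.1.comp (contDiff_const.add (contDiff_id.const_smul _)))
  · rw [abs_neg, abs_of_pos (by positivity), abs_of_pos (by positivity)]; ring

end taylor

section kern
variable {n : ℕ} {φ₀ : (Fin n → ℝ) → ℝ} {c I : ℝ}

def eta (h0 : IsTestFun n φ₀) (l : ℕ) (x : Fin n → ℝ) : Sm n :=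
  ⟨fun u => phiFam n φ₀ l (x - u), (phiFam_test h0 l).1.comp (contDiff_const.sub contDiff_id)⟩

def etaP (h0 : IsTestFun n φ₀) (l : ℕ) (x : Fin n → ℝ) : Sm n :=
  ⟨fun u => Ph n φ₀ l (x - u), (Ph_test h0 l).1.comp (contDiff_const.sub contDiff_id)⟩

theorem So_eta (h0 : IsTestFun n φ₀) (l : ℕ) (x : Fin n → ℝ) :
    So h0 l (eta h0 l x) = Dl h0 l (etaP h0 l x) := by
  apply Subtype.ext
  exact avg_reflect _ _ _

/-- Support from order-zero operator bounds. -/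
theorem OpB.supp {T : Module.End ℝ (Sm n)} {δ K : ℝ} (h : OpB T 0 δ K) (θ : Sm n)
    (y : Fin n → ℝ) (hy : (T θ).1 y ≠ 0) : ∃ z, ‖z - y‖ ≤ δ ∧ θ.1 z ≠ 0 := by
  by_contra! hcon
  have := h θ 0 y 0 0 (by
    intro z hz
    rw [zero_add] at hz
    rw [norm_iteratedFDeriv_zero, hcon z hz, norm_zero]) y (by simp)
  rw [norm_iteratedFDeriv_zero, mul_zero] at this
  exact hy (norm_le_zero_iff.1 this)

/-- Pointwise bound. -/
theorem OpB.pt {T : Module.End ℝ (Sm n)} {a : ℕ} {δ K B : ℝ} (h : OpB T a δ K) (θ : Sm n)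
    (y : Fin n → ℝ) (hB : ∀ z, ‖z - y‖ ≤ δ → ‖iteratedFDeriv ℝ a θ.1 z‖ ≤ B) :
    |(T θ).1 y| ≤ K * B := by
  have := h θ 0 y 0 B (by rw [zero_add, zero_add]; exact hB) y (by simp)
  rwa [norm_iteratedFDeriv_zero] at this

theorem eta_supp (D : KD φ₀ c I) (l : ℕ) (x z : Fin n → ℝ) (hz : (eta D.test l x).1 z ≠ 0) :
    ‖x - z‖ ≤ 2 * c / 2 ^ l := phiFam_supp D.hc0.le D.hc l _ hz

theorem KD.kern_hi (D : KD φ₀ c I) (h : ℕ) : ∃ C, 0 < C ∧ ∀ (k l : ℕ) (x y : Fin n → ℝ), l ≤ k →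
    |(gPsi (So D.test) h k (eta D.test l x)).1 y| ≤ C * 2 ^ (l * n) * (2 ^ l / 2 ^ k) ^ h := by
  obtain ⟨C, hC, hb⟩ := D.Psi0 h
  obtain ⟨C', hC', hb'⟩ := D.Psih h
  obtain ⟨B, hB, hB'⟩ := phiFam_reflect_bound D.test h
  refine ⟨(C + C') * B, by positivity, fun k l x y hlk => ?_⟩
  rcases eq_or_lt_of_le hlk with rfl | hlk
  · have := (hb l).pt (eta D.test l x) y (fun z _ => hB' l 0 (Nat.zero_le _) x z)
    refine this.trans ?_
    rw [div_self (by positivity), one_pow, mul_one, pow_zero, mul_one]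
    have : (0:ℝ) ≤ C' * (2 ^ (l * n) * B) := by positivity
    linarith
  · obtain ⟨m, rfl⟩ : ∃ m, k = m + 1 := ⟨k - 1, by omega⟩
    have := (hb' m).pt (eta D.test l x) y (fun z _ => hB' l h le_rfl x z)
    refine this.trans ?_
    rw [div_pow]
    calc _ = C' * B * 2 ^ (l * n) * ((2 ^ l) ^ h / (2 ^ (m + 1)) ^ h) := by ring
      _ ≤ _ := by gcongr; linarith

theorem KD.kern_lo (D : KD φ₀ c I) (h : ℕ) {L : ℤ} (hL : -1 ≤ L)
    (hm : MomentsVanish n L (phiOf n φ₀)) {s : ℕ} (hs : (s : ℤ) = L + 1) :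
    ∃ C, 0 < C ∧ ∀ (k l : ℕ) (x y : Fin n → ℝ), k < l →
    |(gPsi (So D.test) h k (eta D.test l x)).1 y| ≤ C * 2 ^ (k * n) * (2 ^ k / 2 ^ l) ^ s := by
  obtain ⟨C, hC, hb⟩ := D.Q2 h
  obtain ⟨C', hC', hb'⟩ := D.QG h
  obtain ⟨B, hB, hB'⟩ := S_eta_bound D.test hL hm hs
  refine ⟨(C + 2 * C') * B, by positivity, fun k l x y hkl => ?_⟩
  obtain ⟨l, rfl⟩ : ∃ m, l = m + 1 := ⟨l - 1, by omega⟩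
  cases k with
  | zero =>
    rw [g_Psi_zero_eq (So_comm D.test)]
    have := (hb 0).pt (So D.test 0 (eta D.test (l + 1) x)) y
      (fun z _ => by rw [norm_iteratedFDeriv_zero]; exact hB' 0 l x z)
    refine this.trans ?_
    calc _ = C * B * 2 ^ (0 * n) * (2 ^ 0 / 2 ^ (l + 1)) ^ s := by ring
      _ ≤ _ := by gcongr; linarith
  | succ k =>
    rw [g_Psi_succ_eq (So_comm D.test)]
    have h1 := (hb' k).1.pt (So D.test (k + 1) (eta D.test (l + 1) x)) y
      (fun z _ => by rw [norm_iteratedFDeriv_zero]; exact hB' (k + 1) l x z)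
    have h2 := (hb' k).2.pt (So D.test k (eta D.test (l + 1) x)) y
      (fun z _ => by rw [norm_iteratedFDeriv_zero]; exact hB' k l x z)
    have h3 : B * 2 ^ (k * n) * ((2 : ℝ) ^ k / 2 ^ (l + 1)) ^ s ≤
        B * 2 ^ ((k + 1) * n) * ((2 : ℝ) ^ (k + 1) / 2 ^ (l + 1)) ^ s := by
      gcongr <;> norm_num
    have h4 := mul_le_mul_of_nonneg_left h3 hC'.le
    refine (abs_add_le _ _).trans ?_
    refine (add_le_add h1 h2).trans ?_
    have h5 : 0 ≤ C * (B * 2 ^ ((k + 1) * n) * ((2 : ℝ) ^ (k + 1) / 2 ^ (l + 1)) ^ s) := by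
      positivity
    linarith

theorem KD.kern_supp (D : KD φ₀ c I) (h : ℕ) (k l : ℕ) (x y : Fin n → ℝ)
    (hy : (gPsi (So D.test) h k (eta D.test l x)).1 y ≠ 0) :
    ‖x - y‖ ≤ (cR h c + 2 * c) / 2 ^ (min k l) := by
  have hc0 := D.hc0
  obtain ⟨C, hC, hb⟩ := D.Psi0 h
  obtain ⟨z, hz, hz'⟩ := (hb k).supp _ _ hy
  have h1 := eta_supp D l x z hz'
  have h2 := norm_add_le (x - z) (z - y)
  rw [sub_add_sub_cancel] at h2
  have h3 : cR h c / 2 ^ k ≤ cR h c / 2 ^ (min k l) := by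
    have : 0 ≤ cR h c := by unfold cR; positivity
    gcongr
    · norm_num
    · exact min_le_left _ _
  have h4 : 2 * c / 2 ^ l ≤ 2 * c / 2 ^ (min k l) := by
    gcongr
    · norm_num
    · exact min_le_right _ _
  rw [add_div]; linarith

theorem KD.kern_R (D : KD φ₀ c I) (h : ℕ) : ∃ C, 0 < C ∧ ∀ (l : ℕ) (x y : Fin n → ℝ),
    |((So D.test l * gQ (So D.test) h l ^ 2) (etaP D.test l x)).1 y| ≤ C * 2 ^ (l * n) ∧
    (((So D.test l * gQ (So D.test) h l ^ 2) (etaP D.test l x)).1 y ≠ 0 →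
      ‖x - y‖ ≤ (cR h c + 2 * c) / 2 ^ l) := by
  have hc0 := D.hc0
  obtain ⟨C, hC, hb⟩ := D.SQ2 h
  obtain ⟨B, hB, hB'⟩ := Ph_reflect_bound D.test h
  refine ⟨C * B, by positivity, fun l x y => ⟨?_, fun hy => ?_⟩⟩
  · have := (hb l).pt (etaP D.test l x) y (fun z _ => hB' l 0 (Nat.zero_le _) x z)
    refine this.trans (le_of_eq ?_)
    ring
  · obtain ⟨z, hz, hz'⟩ := (hb l).supp _ _ hy
    have h1 := Ph_supp D.hc l _ hz'
    have h2 := norm_add_le (x - z) (z - y)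
    rw [sub_add_sub_cancel] at h2
    have h4 : c / 2 ^ l ≤ 2 * c / 2 ^ l := by gcongr; linarith
    rw [add_div]; linarith

end kern

/-! ### Part 5: pairing of distributions with averages -/

section pairing
variable {n : ℕ}

/-- Smooth functions supported in a compact subset of `G`. -/
def DG (n : ℕ) (G : Set (Fin n → ℝ)) : Submodule ℝ (Sm n) where
  carrier := {θ | ∃ K : Set (Fin n → ℝ), IsCompact K ∧ K ⊆ G ∧ ∀ x, θ.1 x ≠ 0 → x ∈ K}
  add_mem' := by
    rintro a b ⟨K, hK, hKG, h⟩ ⟨K', hK', hKG', h'⟩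
    refine ⟨K ∪ K', hK.union hK', Set.union_subset hKG hKG', fun x hx => ?_⟩
    by_contra hcon
    rw [Set.mem_union, not_or] at hcon
    apply hx
    have h1 : a.1 x = 0 := by by_contra h1; exact hcon.1 (h x h1)
    have h2 : b.1 x = 0 := by by_contra h1; exact hcon.2 (h' x h1)
    change a.1 x + b.1 x = 0
    rw [h1, h2, add_zero]
  zero_mem' := ⟨∅, isCompact_empty, Set.empty_subset _, fun x hx => (hx rfl).elim⟩
  smul_mem' := by
    rintro c a ⟨K, hK, hKG, h⟩
    refine ⟨K, hK, hKG, fun x hx => h x ?_⟩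
    intro h1
    apply hx
    change c * a.1 x = 0
    rw [h1, mul_zero]

theorem DG_iff {G : Set (Fin n → ℝ)} {θ : Sm n} :
    θ ∈ DG n G ↔ HasCompactSupport θ.1 ∧ tsupport θ.1 ⊆ G := by
  constructor
  · rintro ⟨K, hK, hKG, h⟩
    have : tsupport θ.1 ⊆ K := closure_minimal (fun x hx => h x hx) hK.isClosed
    exact ⟨hK.of_isClosed_subset (isClosed_tsupport _) this, this.trans hKG⟩
  · rintro ⟨h1, h2⟩
    exact ⟨_, h1, h2, fun x hx => subset_tsupport _ hx⟩

theorem DG_test {G : Set (Fin n → ℝ)} {θ : Sm n} (h : θ ∈ DG n G) : IsTestFun n θ.1 :=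
  ⟨Sm_cd θ, (DG_iff.1 h).1⟩

/-- quantitative form of membership in `S'_e(G)`. -/
theorem MemSeG.bound {G : Set (Fin n → ℝ)} {f : Dstrb n} (hf : MemSeG n G f) :
    ∃ (C : ℝ) (N : ℕ), 0 < C ∧ ∀ θ ∈ DG n G, ∀ R B : ℝ, 0 ≤ B → (∀ x, θ.1 x ≠ 0 → ‖x‖ ≤ R) →
      (∀ i ≤ N, ∀ x, ‖iteratedFDeriv ℝ i θ.1 x‖ ≤ B) → |f θ.1| ≤ C * Real.exp (N * R) * B := by
  obtain ⟨C, N, hC, hb⟩ := hf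
  refine ⟨C * (N + 1), N, by positivity, fun θ hθ R B hB0 hR hB => ?_⟩
  have h1 := hb θ.1 (DG_test hθ) (DG_iff.1 hθ).2
  have hcl : tsupport θ.1 ⊆ Metric.closedBall 0 R := closure_minimal
    (fun x hx => by simpa using hR x hx) Metric.isClosed_closedBall
  have h2 : (⨆ x ∈ G, ENNReal.ofReal
        (Real.exp (N * ‖x‖) * ∑ i ∈ Finset.range (N + 1), ‖iteratedFDeriv ℝ i θ.1 x‖)) ≤
      ENNReal.ofReal (Real.exp (N * R) * ((N + 1) * B)) := by
    refine iSup₂_le fun x _ => ENNReal.ofReal_le_ofReal ?_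
    by_cases hx : x ∈ tsupport θ.1
    · have hxR : ‖x‖ ≤ R := by simpa using hcl hx
      gcongr
      calc _ ≤ ∑ i ∈ Finset.range (N + 1), B := Finset.sum_le_sum fun i hi =>
            hB i (Nat.lt_succ_iff.1 (Finset.mem_range.1 hi)) x
        _ = _ := by simp
    · have : ∑ i ∈ Finset.range (N + 1), ‖iteratedFDeriv ℝ i θ.1 x‖ = 0 := by
        refine Finset.sum_eq_zero fun i _ => ?_
        rw [norm_eq_zero]
        by_contra h3
        exact hx (support_iteratedFDeriv_subset (𝕜 := ℝ) i h3)
      rw [this, mul_zero]; positivity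
  have h3 := h1.trans (mul_le_mul_right h2 _)
  rw [← ENNReal.ofReal_mul hC.le, ENNReal.ofReal_le_ofReal_iff (by positivity)] at h3
  calc _ ≤ _ := h3
    _ = _ := by ring

/-- functions supported in `K` -/
def DK (n : ℕ) (K : Set (Fin n → ℝ)) : Submodule ℝ (Sm n) where
  carrier := {θ | ∀ x, θ.1 x ≠ 0 → x ∈ K}
  add_mem' := by
    intro a b h h' x hx
    by_contra hcon
    apply hx
    have h1 : a.1 x = 0 := by by_contra h1; exact hcon (h x h1)
    have h2 : b.1 x = 0 := by by_contra h1; exact hcon (h' x h1)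
    change a.1 x + b.1 x = 0
    rw [h1, h2, add_zero]
  zero_mem' := fun x hx => (hx rfl).elim
  smul_mem' := by
    intro c a h x hx
    apply h
    intro h1
    apply hx
    change c * a.1 x = 0
    rw [h1, mul_zero]

/-- fibre of the jet bundle -/
def JF (n N : ℕ) : Type := (i : Fin (N + 1)) → (Fin n → ℝ) [×(i : ℕ)]→L[ℝ] ℝ

instance (n N : ℕ) : NormedAddCommGroup (JF n N) :=
  inferInstanceAs (NormedAddCommGroup ((i : Fin (N + 1)) → (Fin n → ℝ) [×(i : ℕ)]→L[ℝ] ℝ))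

instance (n N : ℕ) : NormedSpace ℝ (JF n N) :=
  inferInstanceAs (NormedSpace ℝ ((i : Fin (N + 1)) → (Fin n → ℝ) [×(i : ℕ)]→L[ℝ] ℝ))

instance (n N : ℕ) : CompleteSpace (JF n N) :=
  inferInstanceAs (CompleteSpace ((i : Fin (N + 1)) → (Fin n → ℝ) [×(i : ℕ)]→L[ℝ] ℝ))

/-- coordinates of the jet fibre -/
def JFp (n N : ℕ) (i : Fin (N + 1)) : JF n N →L[ℝ] ((Fin n → ℝ) [×(i : ℕ)]→L[ℝ] ℝ) :=
  ContinuousLinearMap.proj (R := ℝ) (φ := fun i : Fin (N + 1) =>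
        (Fin n → ℝ) [×(i : ℕ)]→L[ℝ] ℝ) i

theorem JF_ext {n N : ℕ} {a b : JF n N} (h : ∀ i, JFp n N i a = JFp n N i b) : a = b :=
  funext h

/-- constructor for the jet fibre -/
def JFmk (n N : ℕ) (a : (i : Fin (N + 1)) → (Fin n → ℝ) [×(i : ℕ)]→L[ℝ] ℝ) : JF n N := a

theorem JFp_mk {n N : ℕ} (a : (i : Fin (N + 1)) → (Fin n → ℝ) [×(i : ℕ)]→L[ℝ] ℝ)
    (i : Fin (N + 1)) : JFp n N i (JFmk n N a) = a i := rfl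

theorem JF_norm_le {n N : ℕ} (a : JF n N) (B : ℝ) (hB : 0 ≤ B) (h : ∀ i, ‖JFp n N i a‖ ≤ B) :
    ‖a‖ ≤ B := (pi_norm_le_iff_of_nonneg (ι := Fin (N + 1))
      (G := fun i => (Fin n → ℝ) [×(i : ℕ)]→L[ℝ] ℝ) hB).2 h

theorem JFp_norm_le {n N : ℕ} (a : JF n N) (i : Fin (N + 1)) : ‖JFp n N i a‖ ≤ ‖a‖ :=
  norm_le_pi_norm (ι := Fin (N + 1)) (G := fun i => (Fin n → ℝ) [×(i : ℕ)]→L[ℝ] ℝ) a i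

theorem JFmk_cont {n N : ℕ} {a : (Fin n → ℝ) → (i : Fin (N + 1)) → (Fin n → ℝ) [×(i : ℕ)]→L[ℝ] ℝ}
    (h : ∀ i, Continuous fun u => a u i) : Continuous fun u => JFmk n N (a u) :=
  continuous_pi (ι := Fin (N + 1)) (A := fun i => (Fin n → ℝ) [×(i : ℕ)]→L[ℝ] ℝ) h

theorem JF_uc {n N : ℕ} {J : (Fin n → ℝ) → JF n N}
    (h : ∀ i, UniformContinuous fun u => JFp n N i (J u)) : UniformContinuous J :=
  uniformContinuous_pi (ι := Fin (N + 1)) (α := fun i => (Fin n → ℝ) [×(i : ℕ)]→L[ℝ] ℝ) |>.2 h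

/-- target of the jet map -/
abbrev JX (n N : ℕ) := BoundedContinuousFunction (Fin n → ℝ) (JF n N)

theorem exists_functional {V E : Type*} [AddCommGroup V] [Module ℝ V] [NormedAddCommGroup E]
    [NormedSpace ℝ E] (fl : V →ₗ[ℝ] ℝ) (Jl : V →ₗ[ℝ] E) (hinj : Function.Injective Jl) (C : ℝ)
    (hb : ∀ v, |fl v| ≤ C * ‖Jl v‖) : ∃ Λ : E →L[ℝ] ℝ, ∀ v, fl v = Λ (Jl v) := by
  let P : Submodule ℝ E := LinearMap.range Jl
  let e : V ≃ₗ[ℝ] P := LinearEquiv.ofInjective Jl hinj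
  let g : P →L[ℝ] ℝ := LinearMap.mkContinuous (fl ∘ₗ e.symm.toLinearMap) C (by
      intro v
      obtain ⟨θ, rfl⟩ := e.surjective v
      change |fl (e.symm (e θ))| ≤ _
      rw [e.symm_apply_apply]
      exact hb θ)
  obtain ⟨Λ, hΛ, -⟩ := _root_.exists_extension_norm_eq P g
  refine ⟨Λ, fun v => ?_⟩
  have := hΛ (e v)
  change Λ (Jl v) = fl (e.symm (e v)) at this
  rw [this, e.symm_apply_apply]

theorem jet_exists (N : ℕ) (θ : (Fin n → ℝ) → ℝ) (hθ : IsTestFun n θ) :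
    ∃ J : JX n N, ∀ u (i : Fin (N + 1)), JFp n N i (J u) = iteratedFDeriv ℝ i θ u := by
  obtain ⟨B, hB, hb⟩ := exists_deriv_bound hθ N
  refine ⟨BoundedContinuousFunction.ofNormedAddCommGroup
    (fun u => JFmk n N fun i : Fin (N + 1) => iteratedFDeriv ℝ i θ u) ?_ B ?_, fun u i => rfl⟩
  · refine JFmk_cont fun i => ?_
    exact hθ.1.continuous_iteratedFDeriv (by exact_mod_cast le_top)
  · intro u
    exact JF_norm_le _ _ hB.le fun i => hb i (Nat.lt_succ_iff.1 i.2) u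

/-- Hahn–Banach representation on a fixed compact set. -/
theorem MemSeG.functional {G : Set (Fin n → ℝ)} {f : Dstrb n} (hf : MemSeG n G f)
    (K : Set (Fin n → ℝ)) (hK : IsCompact K) (hKG : K ⊆ G) :
    ∃ (N : ℕ) (Λ : JX n N →L[ℝ] ℝ), ∀ θ ∈ DK n K, ∀ J : JX n N,
      (∀ u (i : Fin (N + 1)), JFp n N i (J u) = iteratedFDeriv ℝ i θ.1 u) → f θ.1 = Λ J := by
  obtain ⟨C, N, hC, hb⟩ := hf.bound
  have hDK : ∀ θ ∈ DK n K, θ ∈ DG n G := fun θ h => ⟨K, hK, hKG, h⟩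
  choose! J hJ using fun θ (h : θ ∈ DK n K) => jet_exists N θ.1 (DG_test (hDK θ h))
  obtain ⟨R, hR⟩ := hK.isBounded.exists_norm_le
  let Jl : DK n K →ₗ[ℝ] JX n N :=
    { toFun := fun θ => J θ.1
      map_add' := by
        intro a b
        refine BoundedContinuousFunction.ext fun u => JF_ext fun i => ?_
        rw [hJ _ (a + b).2, BoundedContinuousFunction.add_apply, map_add, hJ _ a.2, hJ _ b.2]
        exact iteratedFDeriv_add_apply
          (((Sm_cd a.1).of_le (by exact_mod_cast le_top)).contDiffAt)
          (((Sm_cd b.1).of_le (by exact_mod_cast le_top)).contDiffAt)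
      map_smul' := by
        intro c a
        refine BoundedContinuousFunction.ext fun u => JF_ext fun i => ?_
        rw [hJ _ (c • a).2, BoundedContinuousFunction.smul_apply, map_smul, hJ _ a.2]
        exact iteratedFDeriv_const_smul_apply
          (((Sm_cd a.1).of_le (by exact_mod_cast le_top)).contDiffAt) }
  have hinj : Function.Injective Jl := by
    intro a b hab
    apply Subtype.ext; apply Subtype.ext
    funext u
    have h1 : JFp n N 0 (J a.1 u) = JFp n N 0 (J b.1 u) := by
      have : Jl a = Jl b := hab
      change J a.1 = J b.1 at this
      rw [this]
    rw [hJ _ a.2, hJ _ b.2] at h1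
    have h2 := congrArg (fun T => T (fun _ => 0)) h1
    exact (iteratedFDeriv_zero_apply (𝕜 := ℝ) (f := a.1.1) (x := u) (fun _ => 0)).symm.trans
      (h2.trans (iteratedFDeriv_zero_apply (𝕜 := ℝ) (f := b.1.1) (x := u) (fun _ => 0)))
  let fl : DK n K →ₗ[ℝ] ℝ := f ∘ₗ (Sm n).subtype ∘ₗ (DK n K).subtype
  have hbb : ∀ θ : DK n K, |fl θ| ≤ C * Real.exp (N * R) * ‖Jl θ‖ := by
      intro θ
      refine hb θ.1 (hDK _ θ.2) R _ (norm_nonneg _) (fun x hx => hR x (θ.2 x hx)) ?_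
      intro i hi x
      rw [← hJ _ θ.2 x ⟨i, Nat.lt_succ_of_le hi⟩]
      exact (JFp_norm_le _ _).trans ((J θ.1).norm_coe_le_norm x)
  obtain ⟨Λ, hΛ⟩ := exists_functional (V := DK n K) (E := JX n N) fl Jl hinj (C * Real.exp (N * R)) hbb
  refine ⟨N, Λ, fun θ hθ J' hJ' => ?_⟩
  have e3 : J' = Jl ⟨θ, hθ⟩ := by
    refine BoundedContinuousFunction.ext fun u => JF_ext fun i => ?_
    rw [hJ' u i]
    exact (hJ θ hθ u i).symm
  rw [e3, ← hΛ]
  rfl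

/-- reflected translates -/
def rt (n : ℕ) {φ : (Fin n → ℝ) → ℝ} (hφ : IsTestFun n φ) (y : Fin n → ℝ) : Sm n :=
  ⟨fun u => φ (y - u), hφ.1.comp (contDiff_const.sub contDiff_id)⟩

open scoped Pointwise in
theorem pairing_core {G : Set (Fin n → ℝ)} {f : Dstrb n} (hf : MemSeG n G f)
    {φ : (Fin n → ℝ) → ℝ} (hφ : IsTestFun n φ) (hG : ∀ x ∈ G, ∀ z ∈ tsupport φ, x - z ∈ G)
    (A : Set (Fin n → ℝ)) (hA : IsCompact A) (hAG : A ⊆ G) :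
    ContinuousOn (distConv n f φ) A ∧
    ∀ ζ : (Fin n → ℝ) → ℝ, IsTestFun n ζ → tsupport ζ ⊆ A →
      f (avg φ ζ) = ∫ y, ζ y * distConv n f φ y := by
  have hK : IsCompact (A - tsupport φ) := by
    have h := (hA.prod (show IsCompact (tsupport φ) from hφ.2)).image
      (f := fun p : (Fin n → ℝ) × (Fin n → ℝ) => p.1 - p.2) (by fun_prop)
    rwa [Set.image_prod] at h
  have hKG : A - tsupport φ ⊆ G := by
    rintro _ ⟨a, ha, z, hz, rfl⟩
    exact hG a (hAG ha) z hz
  obtain ⟨N, Λ, hΛ⟩ := hf.functional _ hK hKG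
  set ψ : (Fin n → ℝ) → ℝ := fun u => φ (-u) with hψ
  have hψt : IsTestFun n ψ := ⟨hφ.1.comp contDiff_neg, hφ.2.comp_homeomorph (Homeomorph.neg _)⟩
  obtain ⟨J, hJ⟩ := jet_exists N ψ hψt
  have huc : UniformContinuous J := by
    have : ∀ i : Fin (N + 1), UniformContinuous (fun u => JFp n N i (J u)) := by
      intro i
      have h2 : (fun u => JFp n N i (J u)) = iteratedFDeriv ℝ i ψ := by funext u; exact hJ u i
      rw [h2]
      exact (hψt.2.iteratedFDeriv i).uniformContinuous_of_continuous
        (hψt.1.continuous_iteratedFDeriv (by exact_mod_cast le_top))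
    exact JF_uc this
  let X : (Fin n → ℝ) → JX n N := fun y => J.compContinuous ⟨fun u => u - y, by fun_prop⟩
  have hXa : ∀ y u, X y u = J (u - y) := fun y u => rfl
  have hXc : Continuous X := by
    rw [Metric.continuous_iff]
    intro y ε hε
    obtain ⟨δ, hδ, h1⟩ := Metric.uniformContinuous_iff.1 huc (ε / 2) (by positivity)
    refine ⟨δ, hδ, fun a ha => ?_⟩
    refine lt_of_le_of_lt ((BoundedContinuousFunction.dist_le (by positivity)).2 fun u => ?_)
      (half_lt_self hε)
    rw [hXa, hXa]
    apply (h1 _).le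
    rw [dist_sub_left]
    exact ha
  have hXd : ∀ y u (i : Fin (N + 1)), JFp n N i (X y u) = iteratedFDeriv ℝ i (fun u => φ (y - u)) u := by
    intro y u i
    rw [hXa, hJ]
    have : (fun u => φ (y - u)) = fun u => ψ (u - y) := by
      funext u; simp [hψ]
    rw [this, iteratedFDeriv_comp_sub]
  have hF : ∀ y ∈ A, distConv n f φ y = Λ (X y) := by
    intro y hy
    refine hΛ (rt n hφ y) (fun x hx => ?_) (X y) (fun u i => hXd y u i)
    refine ⟨y, hy, y - x, subset_tsupport _ hx, by simp⟩
  refine ⟨(Λ.continuous.comp hXc).continuousOn.congr hF, fun ζ hζ hζA => ?_⟩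
  have hint : Integrable (fun y => ζ y • X y) := by
    apply Continuous.integrable_of_hasCompactSupport
    · exact hζ.1.continuous.smul hXc
    · exact hζ.2.smul_right
  have h1 : ∫ y, ζ y * distConv n f φ y = ∫ y, Λ (ζ y • X y) := by
    congr 1; funext y
    by_cases hy : y ∈ tsupport ζ
    · rw [hF y (hζA hy), map_smul, smul_eq_mul]
    · rw [image_eq_zero_of_notMem_tsupport hy]; simp
  rw [h1, Λ.integral_comp_comm hint]
  refine hΛ ⟨avg φ ζ, avg_contDiff hφ.1.continuous hφ.2 hζ.1⟩ ?_ _ ?_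
  · intro u hu
    have : ∃ z, φ z * ζ (u + z) ≠ 0 := by
      by_contra! hcon
      exact hu (by simp [avg, hcon])
    obtain ⟨z, hz⟩ := this
    exact ⟨u + z, hζA (subset_tsupport _ (right_ne_zero_of_mul hz)), z,
      subset_tsupport _ (left_ne_zero_of_mul hz), by simp⟩
  · intro u i
    have hev : JFp n N i ((∫ y, ζ y • X y) u) = ∫ y, ζ y • JFp n N i (X y u) := by
      have h2 := ((JFp n N i).comp
        (BoundedContinuousFunction.evalCLM ℝ u)).integral_comp_comm hint
      exact h2.symm
    rw [hev]
    change _ = iteratedFDeriv ℝ i (avg φ ζ) u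
    rw [avg_flip, avg_iteratedFDeriv (g := fun z => ζ (-z)) (θ := ψ)
      (hζ.1.continuous.comp continuous_neg)
      (hζ.2.comp_homeomorph (Homeomorph.neg _)) hψt.1]
    rw [← integral_neg_eq_self]
    congr 1; funext y
    rw [hXa, hJ]
    rw [sub_neg_eq_add]

end pairing

/-! ### Part 6: reproducing formula -/

theorem g_comm_XD {A : Type*} [Ring A] {S : ℕ → A} {X : A} (hk : ∀ k, Commute X (S k)) (l : ℕ) :
    Commute X (gD S l) := by
  cases l with
  | zero => exact hk 0
  | succ l => exact (hk _).sub_right (hk _)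

section reprf
variable {n : ℕ} {φ₀ : (Fin n → ℝ) → ℝ} {G : Set (Fin n → ℝ)} {c I : ℝ} {f : Dstrb n}

/-- domain compatible with the kernel -/
structure DomK (G : Set (Fin n → ℝ)) (φ₀ : (Fin n → ℝ) → ℝ) : Prop where
  op : IsOpen G
  cone : ∀ (k : ℕ), ∀ x ∈ G, ∀ z ∈ tsupport (Ph n φ₀ k), x - z ∈ G

theorem tsupport_phiFam (φ₀ : (Fin n → ℝ) → ℝ) (k : ℕ) : ∀ z ∈ tsupport (phiFam n φ₀ k),
    ∃ j, z ∈ tsupport (Ph n φ₀ j) := by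
  intro z hz
  cases k with
  | zero => exact ⟨0, by rwa [phiFam_zero] at hz⟩
  | succ k =>
    rw [phiFam_succ, sub_eq_add_neg] at hz
    rcases tsupport_add _ _ hz with h | h
    · exact ⟨_, h⟩
    · refine ⟨k, ?_⟩
      rwa [tsupport, Function.support_neg (Ph n φ₀ k)] at h

theorem DomK.cone' (H : DomK G φ₀) (k : ℕ) : ∀ x ∈ G, ∀ z ∈ tsupport (phiFam n φ₀ k), x - z ∈ G := by
  intro x hx z hz
  obtain ⟨j, hj⟩ := tsupport_phiFam φ₀ k z hz
  exact H.cone j x hx z hj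

/-- operators preserving `D(G)` -/
def presRing (G : Set (Fin n → ℝ)) : Subring (Module.End ℝ (Sm n)) where
  carrier := {T | ∀ θ ∈ DG n G, T θ ∈ DG n G}
  mul_mem' := fun ha hb θ h => ha _ (hb θ h)
  one_mem' := fun θ h => h
  add_mem' := fun ha hb θ h => (DG n G).add_mem (ha θ h) (hb θ h)
  zero_mem' := fun θ h => (DG n G).zero_mem
  neg_mem' := fun ha θ h => (DG n G).neg_mem (ha θ h)

theorem So_pres (H : DomK G φ₀) (h0 : IsTestFun n φ₀) (k : ℕ) : So h0 k ∈ presRing G := by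
  rintro θ ⟨K, hK, hKG, hs⟩
  refine ⟨Set.image (fun p : (Fin n → ℝ) × (Fin n → ℝ) => p.1 - p.2) (K ×ˢ tsupport (Ph n φ₀ k)),
    (hK.prod (show IsCompact (tsupport (Ph n φ₀ k)) from (Ph_test h0 k).2)).image (by fun_prop), ?_, ?_⟩
  · rintro _ ⟨⟨a, b⟩, ⟨h1, h2⟩, rfl⟩
    exact H.cone k a (hKG h1) b h2
  · intro u hu
    have : ∃ z, Ph n φ₀ k z * θ.1 (u + z) ≠ 0 := by
      by_contra! hcon
      apply hu
      change avg (Ph n φ₀ k) θ.1 u = 0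
      simp [avg, hcon]
    obtain ⟨z, hz⟩ := this
    exact ⟨(u + z, z), ⟨hs _ (right_ne_zero_of_mul hz), subset_tsupport _ (left_ne_zero_of_mul hz)⟩,
      by simp⟩

theorem gQ_pres (H : DomK G φ₀) (h0 : IsTestFun n φ₀) (h k : ℕ) : gQ (So h0) h k ∈ presRing G :=
  sum_mem fun i _ => pow_mem (sub_mem (one_mem _) (So_pres H h0 k)) _

theorem gR_pres (H : DomK G φ₀) (h0 : IsTestFun n φ₀) (h k : ℕ) : gR (So h0) h k ∈ presRing G :=
  sub_mem (one_mem _) (pow_mem (sub_mem (one_mem _) (So_pres H h0 k)) _)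

theorem gPsi_pres (H : DomK G φ₀) (h0 : IsTestFun n φ₀) (h k : ℕ) : gPsi (So h0) h k ∈ presRing G := by
  cases k with
  | zero => exact mul_mem (So_pres H h0 _) (pow_mem (gQ_pres H h0 _ _) _)
  | succ k =>
    refine mul_mem (add_mem (gR_pres H h0 _ _) (gR_pres H h0 _ _)) (sum_mem fun i _ => ?_)
    exact mul_mem (pow_mem (sub_mem (one_mem _) (So_pres H h0 _)) _)
      (pow_mem (sub_mem (one_mem _) (So_pres H h0 _)) _)

theorem rt_DG {φ : (Fin n → ℝ) → ℝ} (hφ : IsTestFun n φ)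
    (hG : ∀ x ∈ G, ∀ z ∈ tsupport φ, x - z ∈ G) (x : Fin n → ℝ) (hx : x ∈ G) :
    (⟨fun u => φ (x - u), hφ.1.comp (contDiff_const.sub contDiff_id)⟩ : Sm n) ∈ DG n G := by
  refine ⟨Set.image (fun z => x - z) (tsupport φ),
    (show IsCompact (tsupport φ) from hφ.2).image (by fun_prop), ?_, ?_⟩
  · rintro _ ⟨z, hz, rfl⟩
    exact hG x hx z hz
  · intro u hu
    exact ⟨x - u, subset_tsupport _ hu, by simp⟩

theorem eta_DG (H : DomK G φ₀) (h0 : IsTestFun n φ₀) (l : ℕ) (x : Fin n → ℝ) (hx : x ∈ G) :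
    eta h0 l x ∈ DG n G := rt_DG (phiFam_test h0 l) (H.cone' l) x hx

theorem etaP_DG (H : DomK G φ₀) (h0 : IsTestFun n φ₀) (l : ℕ) (x : Fin n → ℝ) (hx : x ∈ G) :
    etaP h0 l x ∈ DG n G := rt_DG (Ph_test h0 l) (H.cone l) x hx

/-- the local means of `f` on `G`, extended by zero -/
def FI (n : ℕ) (G : Set (Fin n → ℝ)) (f : Dstrb n) (φ₀ : (Fin n → ℝ) → ℝ) (k : ℕ) :
    (Fin n → ℝ) → ℝ := G.indicator (distConv n f (phiFam n φ₀ k))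

theorem FI_contOn (hf : MemSeG n G f) (H : DomK G φ₀) (h0 : IsTestFun n φ₀) (k : ℕ) :
    ContinuousOn (distConv n f (phiFam n φ₀ k)) G := by
  intro x hx
  obtain ⟨ε, hε, hb⟩ := Metric.nhds_basis_closedBall.mem_iff.1 (H.op.mem_nhds hx)
  have h1 := (pairing_core hf (phiFam_test h0 k) (H.cone' k) _ (isCompact_closedBall x ε) hb).1
  exact (h1.continuousAt (Metric.closedBall_mem_nhds x hε)).continuousWithinAt

theorem FI_meas (hf : MemSeG n G f) (H : DomK G φ₀) (h0 : IsTestFun n φ₀) (k : ℕ) :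
    Measurable (FI n G f φ₀ k) := by
  classical
  have := ContinuousOn.measurable_piecewise (FI_contOn hf H h0 k)
    (continuousOn_const (c := (0 : ℝ)) (s := Gᶜ)) H.op.measurableSet
  convert this using 1
  funext x
  simp [FI, Set.indicator, Set.piecewise]

theorem pair_Dl (hf : MemSeG n G f) (H : DomK G φ₀) (h0 : IsTestFun n φ₀) (k : ℕ) (θ : Sm n)
    (hθ : θ ∈ DG n G) : f (Dl h0 k θ).1 = ∫ y, θ.1 y * FI n G f φ₀ k y := by
  have h1 := (DG_iff.1 hθ)
  have := (pairing_core hf (phiFam_test h0 k) (H.cone' k) _ h1.1.isCompact h1.2).2 θ.1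
    (DG_test hθ) le_rfl
  refine this.trans ?_
  congr 1; funext y
  by_cases hy : y ∈ tsupport θ.1
  · rw [FI, Set.indicator_of_mem (h1.2 hy)]
  · rw [image_eq_zero_of_notMem_tsupport hy]; simp

theorem FI_apriori (hf : MemSeG n G f) (H : DomK G φ₀) (D : KD φ₀ c I) :
    ∃ (C : ℝ) (A b : ℕ), 0 < C ∧ ∀ k y, |FI n G f φ₀ k y| ≤ C * (2 ^ k) ^ A * Real.exp (b * ‖y‖) := by
  obtain ⟨C, N, hC, hb⟩ := hf.bound
  obtain ⟨B, hB, hB'⟩ := phiFam_reflect_bound D.test N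
  have hc0 := D.hc0
  refine ⟨C * Real.exp (N * (2 * c)) * B, n + N, N, by positivity, fun k y => ?_⟩
  by_cases hy : y ∈ G
  · rw [FI, Set.indicator_of_mem hy]
    have h1 := hb (eta D.test k y) (eta_DG H D.test k y hy) (‖y‖ + 2 * c)
      (2 ^ (k * n) * (2 ^ k) ^ N * B) (by positivity) ?_ ?_
    · refine (show |distConv n f (phiFam n φ₀ k) y| ≤ _ from h1).trans (le_of_eq ?_)
      rw [mul_add, Real.exp_add, pow_add, pow_mul]; ring
    · intro x hx
      have h2 := eta_supp D k y x hx
      have h3 : 2 * c / 2 ^ k ≤ 2 * c := div_le_self (by positivity) (one_le_pow₀ (by norm_num))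
      have h4 : ‖x‖ ≤ ‖y‖ + ‖y - x‖ := by
        have := norm_sub_le y (y - x)
        simpa using this
      linarith
    · intro i hi x
      refine (hB' k i hi y x).trans ?_
      have : ((2 : ℝ) ^ k) ^ i ≤ (2 ^ k) ^ N := pow_le_pow_right₀ (one_le_pow₀ (by norm_num)) hi
      gcongr
  · rw [FI, Set.indicator_of_notMem hy, abs_zero]; positivity

theorem lim_R (hf : MemSeG n G f) (H : DomK G φ₀) (D : KD φ₀ c I) (h : ℕ) (θ : Sm n)
    (hθ : θ ∈ DG n G) :
    Tendsto (fun J => f ((gR (So D.test) h J ^ 2) θ).1) atTop (𝓝 (f θ.1)) := by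
  obtain ⟨C, N, hC, hb⟩ := hf.bound
  obtain ⟨C', hC', hb'⟩ := D.oneSubR h
  obtain ⟨B, hB, hB'⟩ := exists_deriv_bound (DG_test hθ) (N + 1)
  obtain ⟨R, hR⟩ := (DG_iff.1 hθ).1.isCompact.isBounded.exists_norm_le
  have hc0 := D.hc0
  have hcR : 0 ≤ cR h c := by unfold cR; positivity
  have key : ∀ J, |f θ.1 - f ((gR (So D.test) h J ^ 2) θ).1| ≤
      C * Real.exp (N * (R + cR h c)) * (C' * B) * (1 / 2) ^ J := by
    intro J
    have e : f θ.1 - f ((gR (So D.test) h J ^ 2) θ).1 =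
        f ((1 - gR (So D.test) h J ^ 2 : Module.End ℝ (Sm n)) θ).1 := by
      rw [← map_sub]; rfl
    rw [e]
    have hmem : (1 - gR (So D.test) h J ^ 2 : Module.End ℝ (Sm n)) θ ∈ DG n G :=
      (sub_mem (one_mem _) (pow_mem (gR_pres H D.test h J) 2) :
        (1 - gR (So D.test) h J ^ 2 : Module.End ℝ (Sm n)) ∈ presRing G) θ hθ
    refine (hb _ hmem (R + cR h c) (C' / 2 ^ J * B) (by positivity) ?_ ?_).trans (le_of_eq ?_)
    · intro x hx
      have : ∃ z, ‖z - x‖ ≤ cR h c / 2 ^ J ∧ iteratedFDeriv ℝ 1 θ.1 z ≠ 0 := by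
        by_contra! hcon
        have h2 := (hb' J).pt θ x (B := 0) (fun z hz => by rw [hcon z hz]; simp)
        rw [mul_zero] at h2
        exact hx (abs_nonpos_iff.1 h2)
      obtain ⟨z, hz, hz'⟩ := this
      have h3 : z ∈ tsupport θ.1 := support_iteratedFDeriv_subset (𝕜 := ℝ) 1 hz'
      have h4 : cR h c / 2 ^ J ≤ cR h c := div_le_self hcR (one_le_pow₀ (by norm_num))
      have h5 : ‖x‖ ≤ ‖z‖ + ‖z - x‖ := by
        have := norm_sub_le z (z - x)
        simpa using this
      linarith [hR z h3]
    · intro i hi x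
      exact hb' J θ i x 0 B (fun z _ => hB' (i + 1) (by omega) z) x (by simp)
    · rw [one_div, inv_pow]; ring
  rw [tendsto_iff_norm_sub_tendsto_zero]
  refine squeeze_zero (fun _ => norm_nonneg _) (fun J => ?_)
    (g := fun J => C * Real.exp (N * (R + cR h c)) * (C' * B) * (1 / 2) ^ J) ?_
  · rw [norm_sub_rev]; exact key J
  · have := (tendsto_pow_atTop_nhds_zero_of_lt_one (r := (1 / 2 : ℝ)) (by norm_num)
      (by norm_num)).const_mul (C * Real.exp (N * (R + cR h c)) * (C' * B))
    simpa using this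

theorem repr_lim (hf : MemSeG n G f) (H : DomK G φ₀) (D : KD φ₀ c I) (h l : ℕ) (θ : Sm n)
    (hθ : θ ∈ DG n G) :
    Tendsto (fun J => f ((gR (So D.test) h l ^ 2) θ).1 + ∑ i ∈ Finset.range J,
      ∫ y, (gPsi (So D.test) h (l + i + 1) θ).1 y * FI n G f φ₀ (l + i + 1) y) atTop (𝓝 (f θ.1)) := by
  have h1 : (fun J => f ((gR (So D.test) h l ^ 2) θ).1 + ∑ i ∈ Finset.range J,
      ∫ y, (gPsi (So D.test) h (l + i + 1) θ).1 y * FI n G f φ₀ (l + i + 1) y) =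
      fun J => f ((gR (So D.test) h (J + l) ^ 2) θ).1 := by
    funext J
    have e : gR (So D.test) h (J + l) ^ 2 = gR (So D.test) h l ^ 2 + ∑ i ∈ Finset.range J,
      gD (So D.test) (l + i + 1) * gPsi (So D.test) h (l + i + 1) := by
      rw [g_sum (So_comm D.test), add_comm J l]; abel
    rw [e]
    have e2 : ((gR (So D.test) h l ^ 2 + ∑ i ∈ Finset.range J,
      gD (So D.test) (l + i + 1) * gPsi (So D.test) h (l + i + 1)) θ).1 =
      ((gR (So D.test) h l ^ 2) θ).1 + ∑ i ∈ Finset.range J,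
        (Dl D.test (l + i + 1) (gPsi (So D.test) h (l + i + 1) θ)).1 := by
      rw [LinearMap.add_apply, LinearMap.sum_apply]
      simp only [Dl_eq, Submodule.coe_add, Submodule.coe_sum]
      rfl
    rw [e2, map_add, map_sum]
    congr 1
    refine Finset.sum_congr rfl fun i _ => ?_
    exact (pair_Dl hf H D.test _ _ (gPsi_pres H D.test h _ θ hθ)).symm
  rw [h1]
  exact (lim_R hf H D h θ hθ).comp (tendsto_add_atTop_nat l)

theorem repr_zero (hf : MemSeG n G f) (H : DomK G φ₀) (D : KD φ₀ c I) (h : ℕ) (θ : Sm n)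
    (hθ : θ ∈ DG n G) :
    Tendsto (fun J => ∑ i ∈ Finset.range J,
      ∫ y, (gPsi (So D.test) h i θ).1 y * FI n G f φ₀ i y) atTop (𝓝 (f θ.1)) := by
  rw [← tendsto_add_atTop_iff_nat 1]
  refine (repr_lim hf H D h 0 θ hθ).congr fun J => ?_
  rw [Finset.sum_range_succ', add_comm]
  simp only [zero_add]
  congr 1
  rw [← g_D_Psi_zero (So_comm D.test), ← Dl_eq]
  exact pair_Dl hf H D.test _ _ (gPsi_pres H D.test h _ θ hθ)

/-- powers of two -/
def pw (x : ℝ) : ℝ≥0∞ := ENNReal.ofReal ((2 : ℝ) ^ x)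

theorem pw_add (x y : ℝ) : pw (x + y) = pw x * pw y := by
  rw [pw, pw, pw, ← ENNReal.ofReal_mul (by positivity), Real.rpow_add (by norm_num)]

theorem lint_ker {K F : (Fin n → ℝ) → ℝ} {x : Fin n → ℝ} {B ρ : ℝ}
    (hK : ∀ y, |K y| ≤ B) (hs : ∀ y, K y ≠ 0 → ‖x - y‖ ≤ ρ) :
    ∫⁻ y, ‖K y * F y‖ₑ ≤ ENNReal.ofReal B * ∫⁻ y in Metric.closedBall x ρ, ‖F y‖ₑ := by
  rw [← lintegral_const_mul' _ _ ENNReal.ofReal_ne_top,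
    ← lintegral_indicator Metric.isClosed_closedBall.measurableSet]
  refine lintegral_mono fun y => ?_
  by_cases hy : K y = 0
  · simp [hy]
  · rw [Set.indicator_of_mem]
    · rw [enorm_mul, Real.enorm_eq_ofReal_abs]
      gcongr
      exact hK y
    · rw [Metric.mem_closedBall, dist_eq_norm, norm_sub_rev]
      exact hs y hy

/-- Main local estimate. -/
theorem main_local (H : DomK G φ₀) (D : KD φ₀ c I) (h : ℕ) :
    ∃ C : ℝ, 0 < C ∧ ∀ f : Dstrb n, MemSeG n G f → ∀ (l : ℕ) (x : Fin n → ℝ), 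
      ‖FI n G f φ₀ l x‖ₑ ≤ ENNReal.ofReal C * ∑' i : ℕ, pw (l * n - i * h) *
        ∫⁻ y in Metric.closedBall x ((cR h c + 2 * c) / 2 ^ l), ‖FI n G f φ₀ (l + i) y‖ₑ := by
  obtain ⟨C, hC, hb⟩ := D.kern_R h
  obtain ⟨C', hC', hb'⟩ := D.kern_hi h
  refine ⟨C + C', by positivity, fun f hf l x => ?_⟩
  by_cases hx : x ∉ G
  · rw [FI, Set.indicator_of_notMem hx]; simp
  rw [not_not] at hx
  have hpw : ∀ (i : ℕ), ENNReal.ofReal ((C + C') * 2 ^ (l * n) * (2 ^ l / 2 ^ (l + i)) ^ h) =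
      ENNReal.ofReal (C + C') * pw (l * n - i * h) := by
    intro i
    rw [pw, ← ENNReal.ofReal_mul (by positivity), mul_assoc]
    congr 2
    rw [Real.rpow_sub (by norm_num), pow_add, ← div_div, div_self (by positivity), one_div, inv_pow,
      ← pow_mul, div_eq_mul_inv]
    norm_cast
  have hpr : FI n G f φ₀ l x = f (eta D.test l x).1 := by
    rw [FI, Set.indicator_of_mem hx]; rfl
  rw [hpr, ← ENNReal.tsum_mul_left]
  have hlim := (repr_lim hf H D h l _ (eta_DG H D.test l x hx)).enorm
  refine le_of_tendsto hlim (Eventually.of_forall fun J => ?_)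
  refine (enorm_add_le _ _).trans ?_
  rw [tsum_eq_zero_add' ENNReal.summable]
  refine add_le_add ?_ ?_
  · have e : (gR (So D.test) h l ^ 2) (eta D.test l x) =
        Dl D.test l ((So D.test l * gQ (So D.test) h l ^ 2) (etaP D.test l x)) := by
      rw [g_R_sq_eq (So_comm D.test), Module.End.mul_apply, So_eta]
      have : Commute (So D.test l * gQ (So D.test) h l ^ 2) (Dl D.test l) := by
        rw [Dl_eq]
        have hk : ∀ k, Commute (So D.test l * gQ (So D.test) h l ^ 2) (So D.test k) := fun k =>
          ((So_comm D.test l k)).mul_left ((g_comm_SQ (So_comm D.test) h k l).symm.pow_left 2)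
        exact g_comm_XD hk l
      exact congrArg (fun T : Module.End ℝ (Sm n) => T (etaP D.test l x)) this.eq
    rw [e, pair_Dl hf H D.test _ _ ((mul_mem (So_pres H D.test l)
      (pow_mem (gQ_pres H D.test h l) 2) : So D.test l * gQ (So D.test) h l ^ 2 ∈ presRing G) _
        (etaP_DG H D.test l x hx))]
    refine (enorm_integral_le_lintegral_enorm _).trans ?_
    rw [← mul_assoc, ← hpw]
    refine (lint_ker (fun y => (hb l x y).1) (fun y => (hb l x y).2)).trans ?_
    rw [add_zero, div_self (by positivity), one_pow, mul_one]
    gcongr; linarith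
  · refine (enorm_sum_le _ _).trans ?_
    refine le_trans (Finset.sum_le_sum fun i _ => ?_) (ENNReal.sum_le_tsum (Finset.range J))
    refine (enorm_integral_le_lintegral_enorm _).trans ?_
    rw [← mul_assoc, ← hpw, ← add_assoc]
    refine (lint_ker (fun y => hb' (l + i + 1) l x y (by omega))
      (fun y hy => D.kern_supp h (l + i + 1) l x y hy)).trans ?_
    rw [min_eq_right (by omega)]
    gcongr; linarith

end reprf

/-! ### Part 7: maximal function estimates -/

theorem pw_mono {x y : ℝ} (h : x ≤ y) : pw x ≤ pw y :=
  ENNReal.ofReal_le_ofReal (Real.rpow_le_rpow_of_exponent_le (by norm_num) h)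

theorem pw_rpow (x y : ℝ) : pw x ^ y = pw (x * y) := by
  rw [pw, pw, ENNReal.ofReal_rpow_of_pos (by positivity), ← Real.rpow_mul (by norm_num)]

theorem pw_ne_top (x : ℝ) : pw x ≠ ∞ := ENNReal.ofReal_ne_top

theorem pw_ne_zero (x : ℝ) : pw x ≠ 0 := by
  rw [pw]; simp only [ne_eq, ENNReal.ofReal_eq_zero, not_le]; positivity

theorem pw_zero : pw 0 = 1 := by simp [pw]

theorem pw_mul_neg (x : ℝ) : pw x * pw (-x) = 1 := by rw [← pw_add, add_neg_cancel, pw_zero]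

theorem pw_meas {α : Type*} [MeasurableSpace α] {g : α → ℝ} (hg : Measurable g) :
    Measurable fun x => pw (g x) := by
  unfold pw
  exact ENNReal.measurable_ofReal.comp (measurable_const.pow hg)

theorem pw_natpow (k : ℕ) : pw k = 2 ^ k := by
  rw [pw, Real.rpow_natCast, ENNReal.ofReal_pow (by norm_num)]; norm_num

section maxfun
variable {n : ℕ}

/-- averaged quantity -/
def IA (F : ℕ → (Fin n → ℝ) → ℝ≥0∞) (r A b : ℝ) (l : ℕ) (x : Fin n → ℝ) : ℝ≥0∞ :=
  ∑' i : ℕ, pw (-(r * A * i) + (l + i) * n) *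
    ∫⁻ z, F (l + i) z ^ r * pw (-(r * b * 2 ^ l * ‖x - z‖))

/-- maximal quantity -/
def MA (F : ℕ → (Fin n → ℝ) → ℝ≥0∞) (A b : ℝ) (l : ℕ) (x : Fin n → ℝ) : ℝ≥0∞ :=
  ⨆ (i : ℕ) (y : Fin n → ℝ), pw (-(A * i) - b * 2 ^ l * ‖x - y‖) * F (l + i) y

theorem MA_le_iff {F : ℕ → (Fin n → ℝ) → ℝ≥0∞} {A b : ℝ} {l : ℕ} {x : Fin n → ℝ} {B : ℝ≥0∞} :
    MA F A b l x ≤ B ↔ ∀ (i : ℕ) (y : Fin n → ℝ), pw (-(A * i) - b * 2 ^ l * ‖x - y‖) * F (l + i) y ≤ B := by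
  simp only [MA, iSup_le_iff]

theorem le_MA (F : ℕ → (Fin n → ℝ) → ℝ≥0∞) (A b : ℝ) (l : ℕ) (x : Fin n → ℝ) (i : ℕ) (y : Fin n → ℝ) :
    F (l + i) y ≤ pw (A * i + b * 2 ^ l * ‖x - y‖) * MA F A b l x := by
  have h := MA_le_iff.1 (le_refl (MA F A b l x)) i y
  calc F (l + i) y = pw (A * i + b * 2 ^ l * ‖x - y‖) *
        (pw (-(A * i) - b * 2 ^ l * ‖x - y‖) * F (l + i) y) := by
        rw [← mul_assoc, ← pw_add]
        rw [show A * i + b * 2 ^ l * ‖x - y‖ + (-(A * i) - b * 2 ^ l * ‖x - y‖) = 0 by ring, pw_zero,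
          one_mul]
    _ ≤ _ := by gcongr

theorem IA_mono (F : ℕ → (Fin n → ℝ) → ℝ≥0∞) {r A b A' b' : ℝ} (hr : 0 < r) (hA : A ≤ A') (hb : b ≤ b')
    (l : ℕ) (x : Fin n → ℝ) : IA F r A' b' l x ≤ IA F r A b l x := by
  refine ENNReal.tsum_le_tsum fun i => mul_le_mul' (pw_mono ?_) (lintegral_mono fun z =>
    mul_le_mul' le_rfl (pw_mono ?_))
  · gcongr
  · gcongr

theorem IA_shift (F : ℕ → (Fin n → ℝ) → ℝ≥0∞) {r A b : ℝ} (hr : 0 < r) (hb : 0 ≤ b)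
    (l i : ℕ) (x y : Fin n → ℝ) :
    IA F r A b (l + i) y ≤ pw (r * A * i + r * b * 2 ^ l * ‖x - y‖) * IA F r A b l x := by
  have h1 : ∑' j : ℕ, pw (-(r * A * (j + i : ℕ)) + (l + (j + i : ℕ)) * n) *
      ∫⁻ z, F (l + (j + i)) z ^ r * pw (-(r * b * 2 ^ l * ‖x - z‖)) ≤ IA F r A b l x :=
    ENNReal.tsum_comp_le_tsum_of_injective (add_left_injective i)
      (fun m : ℕ => pw (-(r * A * m) + (l + m) * n) *
      ∫⁻ z, F (l + m) z ^ r * pw (-(r * b * 2 ^ l * ‖x - z‖)))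
  refine le_trans ?_ (mul_le_mul' le_rfl h1)
  rw [← ENNReal.tsum_mul_left]
  refine ENNReal.tsum_le_tsum fun j => ?_
  have e : l + (j + i) = l + i + j := by ring
  rw [e, pw_add (r * A * i), show ∀ a b c d : ℝ≥0∞, a * b * (c * d) = (a * c) * (b * d) from
    fun a b c d => by ring, ← pw_add]
  have e2 := lintegral_const_mul' (μ := volume) (pw (r * b * 2 ^ l * ‖x - y‖))
    (fun z => F (l + i + j) z ^ r * pw (-(r * b * 2 ^ l * ‖x - z‖))) (pw_ne_top _)
  rw [← e2]
  refine mul_le_mul' (pw_mono ?_) (lintegral_mono fun z => ?_)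
  · push_cast; apply le_of_eq; ring
  · rw [mul_left_comm, ← pw_add]
    refine mul_le_mul' le_rfl (pw_mono ?_)
    have h2 : ‖x - z‖ ≤ ‖x - y‖ + ‖y - z‖ := norm_sub_le_norm_sub_add_norm_sub x y z
    have h3 : (2 : ℝ) ^ l ≤ 2 ^ (l + i) := pow_le_pow_right₀ (by norm_num) (by omega)
    have h4 : r * b * 2 ^ l * ‖x - z‖ ≤ r * b * 2 ^ l * (‖x - y‖ + ‖y - z‖) := by gcongr
    have h5 : r * b * 2 ^ l * ‖y - z‖ ≤ r * b * 2 ^ (l + i) * ‖y - z‖ := by gcongr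
    linarith

/-- hypothesis: local mean estimate with parameter `h`. -/
def ML (F : ℕ → (Fin n → ℝ) → ℝ≥0∞) (h : ℕ) (C : ℝ≥0∞) (c : ℝ) : Prop :=
  ∀ (l : ℕ) (x : Fin n → ℝ), F l x ≤ C * ∑' i : ℕ, pw (l * n - i * h) *
        ∫⁻ y in Metric.closedBall x (c / 2 ^ l), F (l + i) y

theorem MA_le_of_ML {F : ℕ → (Fin n → ℝ) → ℝ≥0∞} {h : ℕ} {C : ℝ≥0∞} {c : ℝ} (hF : ML F h C c)
    {r A b : ℝ} (hr : 0 < r) (hr1 : r ≤ 1) (hA : 0 ≤ A) (hb : 0 ≤ b) (hc : 0 ≤ c) (hAh : A ≤ h)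
    (l : ℕ) (x : Fin n → ℝ) (hM : MA F A b l x ≠ ∞) :
    MA F A b l x ^ r ≤ C * pw (b * c) * IA F r A b l x := by
  set M := MA F A b l x with hMdef
  have hM1r : M ^ (1 - r) ≠ ∞ := ENNReal.rpow_ne_top_of_nonneg (by linarith) hM
  have key : M ≤ C * pw (b * c) * IA F r A b l x * M ^ (1 - r) := by
    rw [hMdef, MA_le_iff, ← hMdef]
    intro i y
    have h1 : ∑' j : ℕ, pw (-(r * A * (j + i : ℕ)) + (l + (j + i : ℕ)) * n) *
        ∫⁻ z, F (l + (j + i)) z ^ r * pw (-(r * b * 2 ^ l * ‖x - z‖)) ≤ IA F r A b l x :=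
      ENNReal.tsum_comp_le_tsum_of_injective (add_left_injective i)
        (fun m : ℕ => pw (-(r * A * m) + (l + m) * n) *
        ∫⁻ z, F (l + m) z ^ r * pw (-(r * b * 2 ^ l * ‖x - z‖)))
    refine (mul_le_mul' le_rfl (hF (l + i) y)).trans ?_
    rw [mul_left_comm, mul_assoc C, mul_assoc C]
    refine mul_le_mul' le_rfl ?_
    refine le_trans ?_ (mul_le_mul' (mul_le_mul' le_rfl h1) le_rfl)
    rw [← ENNReal.tsum_mul_left, ← ENNReal.tsum_mul_left, ← ENNReal.tsum_mul_right]
    refine ENNReal.tsum_le_tsum fun j => ?_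
    have e : l + (j + i) = l + i + j := by ring
    rw [e, ← lintegral_const_mul' _ _ (pw_ne_top _), ← lintegral_const_mul' _ _ (pw_ne_top _),
      ← lintegral_const_mul' _ _ (pw_ne_top _), ← lintegral_const_mul' _ _ (pw_ne_top _),
      ← lintegral_mul_const' _ _ hM1r]
    rw [← lintegral_indicator Metric.isClosed_closedBall.measurableSet]
    refine lintegral_mono fun z => ?_
    by_cases hz : z ∈ Metric.closedBall y (c / 2 ^ (l + i))
    · rw [Set.indicator_of_mem hz]
      have hz' : ‖y - z‖ ≤ c / 2 ^ (l + i) := by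
        rw [Metric.mem_closedBall, dist_eq_norm] at hz; rwa [norm_sub_rev]
      have h2 : F (l + i + j) z = F (l + i + j) z ^ r * F (l + i + j) z ^ (1 - r) := by
        rw [← ENNReal.rpow_add_of_nonneg _ _ hr.le (by linarith)]; simp
      have h3 : F (l + i + j) z ≤ pw (A * (j + i : ℕ) + b * 2 ^ l * ‖x - z‖) * M := by
        have := le_MA F A b l x (j + i) z
        rwa [e] at this
      have h4 : F (l + i + j) z ^ (1 - r) ≤
          pw ((A * (j + i : ℕ) + b * 2 ^ l * ‖x - z‖) * (1 - r)) * M ^ (1 - r) := by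
        rw [← pw_rpow, ← ENNReal.mul_rpow_of_nonneg _ _ (by linarith)]
        exact ENNReal.rpow_le_rpow h3 (by linarith)
      conv_lhs => rw [h2]
      refine (mul_le_mul' le_rfl (mul_le_mul' le_rfl (mul_le_mul' le_rfl h4))).trans ?_
      have e1 : ∀ a b c d m : ℝ≥0∞, a * (b * (c * (d * m))) = (a * (b * d)) * c * m := fun a b c d m => by
        ring
      have e2 : ∀ a b c d m : ℝ≥0∞, a * (b * (c * d)) * m = (a * (b * d)) * c * m := fun a b c d m => by
        ring
      rw [e1, e2]
      refine mul_le_mul' (mul_le_mul' ?_ le_rfl) le_rfl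
      rw [← pw_add, ← pw_add, ← pw_add, ← pw_add]
      apply pw_mono
      have h5 : ‖x - z‖ ≤ ‖x - y‖ + ‖y - z‖ := norm_sub_le_norm_sub_add_norm_sub x y z
      have h6 : (2 : ℝ) ^ l * ‖y - z‖ ≤ c := by
        have : (2 : ℝ) ^ l * ‖y - z‖ ≤ 2 ^ (l + i) * ‖y - z‖ := by
          gcongr
          · norm_num
          · omega
        have h7 := mul_le_mul_of_nonneg_left hz' (by positivity : (0 : ℝ) ≤ 2 ^ (l + i))
        rw [mul_div_cancel₀ _ (by positivity)] at h7
        linarith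
      have h8 : b * 2 ^ l * ‖x - z‖ ≤ b * 2 ^ l * ‖x - y‖ + b * c := by
        have : b * 2 ^ l * ‖x - z‖ ≤ b * 2 ^ l * (‖x - y‖ + ‖y - z‖) := by gcongr
        nlinarith
      have h9 : A * j ≤ h * j := by gcongr
      have h10 : (0 : ℝ) ≤ j * n := by positivity
      push_cast
      nlinarith
    · rw [Set.indicator_of_notMem hz]; exact bot_le
  by_cases hM0 : M = 0
  · rw [hM0, ENNReal.zero_rpow_of_pos hr]; exact bot_le
  have hM1r0 : M ^ (1 - r) ≠ 0 := by
    intro h0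
    rcases ENNReal.rpow_eq_zero_iff.1 h0 with h | h
    · exact hM0 h.1
    · exact hM h.1
  have e : M ^ r * M ^ (1 - r) = M := by
    rw [← ENNReal.rpow_add_of_nonneg _ _ hr.le (by linarith)]; simp
  rw [← ENNReal.mul_le_mul_iff_left hM1r0 hM1r]
  rw [e]; exact key

theorem F_rpow_le_MA (F : ℕ → (Fin n → ℝ) → ℝ≥0∞) (A b : ℝ) (l : ℕ) (x : Fin n → ℝ) :
    F l x ≤ MA F A b l x := by
  have := le_MA F A b l x 0 x
  simpa [pw_zero] using this

/-- The self-improving estimate. -/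
theorem r_trick {F : ℕ → (Fin n → ℝ) → ℝ≥0∞} {Cm : ℕ → ℝ≥0∞} {cm : ℕ → ℝ} (hCm : ∀ h, Cm h ≠ ∞)
    (hcm : ∀ h, 0 ≤ cm h) (hF : ∀ h, ML F h (Cm h) (cm h))
    (hap : ∃ (C : ℝ≥0∞) (A b : ℕ), C ≠ ∞ ∧ ∀ k y, F k y ≤ C * pw (A * k + b * ‖y‖))
    {r A b : ℝ} (hr : 0 < r) (hr1 : r ≤ 1) (hA : 0 ≤ A) (hb : 0 ≤ b) {h : ℕ} (hAh : A ≤ h)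
    (l : ℕ) (x : Fin n → ℝ) :
    F l x ^ r ≤ Cm h * pw (b * cm h) * IA F r A b l x := by
  obtain ⟨C, Af, bf, hC, hap⟩ := hap
  set A₁ := max A Af with hA₁
  set b₁ := max b bf with hb₁
  obtain ⟨h₁, hh₁⟩ := exists_nat_ge A₁
  have hA1 : 0 ≤ A₁ := hA.trans (le_max_left _ _)
  have hb1 : 0 ≤ b₁ := hb.trans (le_max_left _ _)
  have s1 : ∀ l x, MA F A₁ b₁ l x ≠ ∞ := by
    intro l x
    refine ne_top_of_le_ne_top (b := C * pw (Af * l + bf * ‖x‖)) (ENNReal.mul_ne_top hC (pw_ne_top _)) ?_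
    rw [MA_le_iff]
    intro i y
    refine (mul_le_mul' le_rfl (hap _ _)).trans ?_
    rw [mul_left_comm, ← pw_add]
    refine mul_le_mul' le_rfl (pw_mono ?_)
    have h1 : ‖y‖ ≤ ‖x‖ + ‖x - y‖ := by
      have := norm_sub_le x (x - y); simpa using this
    have h2 : (Af : ℝ) * i ≤ A₁ * i := by
      have : (Af : ℝ) ≤ A₁ := le_max_right _ _
      gcongr
    have h3 : (bf : ℝ) * ‖x - y‖ ≤ b₁ * 2 ^ l * ‖x - y‖ := by
      gcongr
      calc (bf : ℝ) ≤ b₁ := le_max_right _ _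
        _ ≤ b₁ * 2 ^ l := le_mul_of_one_le_right hb1 (one_le_pow₀ (by norm_num))
    have h4 : (bf : ℝ) * ‖y‖ ≤ bf * (‖x‖ + ‖x - y‖) := by gcongr
    push_cast
    have h5 : (bf : ℝ) * (‖x‖ + ‖x - y‖) = bf * ‖x‖ + bf * ‖x - y‖ := by ring
    have h6 : (Af : ℝ) * (l + i) = Af * l + Af * i := by ring
    linarith
  have s2 : ∀ l x, F l x ^ r ≤ Cm h₁ * pw (b₁ * cm h₁) * IA F r A b l x := by
    intro l x
    refine (ENNReal.rpow_le_rpow (F_rpow_le_MA F A₁ b₁ l x) hr.le).trans ?_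
    refine (MA_le_of_ML (hF h₁) hr hr1 hA1 hb1 (hcm _) hh₁ l x (s1 l x)).trans ?_
    exact mul_le_mul' le_rfl (IA_mono F hr (le_max_left _ _) (le_max_left _ _) l x)
  by_cases hI : IA F r A b l x = ∞
  · by_cases h0 : Cm h = 0
    · have : F l x = 0 := by
        have := hF h l x
        rw [h0, zero_mul] at this
        exact le_antisymm this (bot_le)
      rw [this, ENNReal.zero_rpow_of_pos hr]; exact bot_le
    · rw [hI, ENNReal.mul_top (mul_ne_zero h0 (pw_ne_zero _))]; exact le_top
  have s3 : MA F A b l x ≠ ∞ := by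
    refine ne_top_of_le_ne_top (b := (Cm h₁ * pw (b₁ * cm h₁) * IA F r A b l x) ^ (1 / r)) ?_ ?_
    · exact ENNReal.rpow_ne_top_of_nonneg (by positivity)
        (ENNReal.mul_ne_top (ENNReal.mul_ne_top (hCm _) (pw_ne_top _)) hI)
    · rw [MA_le_iff]
      intro i y
      rw [one_div, ENNReal.le_rpow_inv_iff hr, ENNReal.mul_rpow_of_nonneg _ _ hr.le, pw_rpow]
      refine (mul_le_mul' le_rfl ((s2 (l + i) y).trans
        (mul_le_mul' le_rfl (IA_shift F hr hb l i x y)))).trans ?_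
      rw [mul_left_comm, ← mul_assoc (pw _), ← pw_add]
      rw [show (-(A * i) - b * 2 ^ l * ‖x - y‖) * r + (r * A * i + r * b * 2 ^ l * ‖x - y‖) = 0 by ring,
        pw_zero, one_mul]
  exact (ENNReal.rpow_le_rpow (F_rpow_le_MA F A b l x) hr.le).trans
    (MA_le_of_ML (hF h) hr hr1 hA hb (hcm _) hAh l x s3)

end maxfun

/-! ### Part 8: cubes, weights -/

theorem pw_geom {s : ℝ} (hs : 0 < s) : ∑' i : ℕ, pw (-(s * i)) ≠ ∞ := by
  have h : ∀ i : ℕ, pw (-(s * i)) = pw (-s) ^ i := by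
    intro i
    rw [← ENNReal.rpow_natCast, pw_rpow, neg_mul]
  simp_rw [h, ENNReal.tsum_geometric]
  have h1 : pw (-s) < 1 := by
    rw [pw, ENNReal.ofReal_lt_one]
    exact Real.rpow_lt_one_of_one_lt_of_neg (by norm_num) (by linarith)
  exact ENNReal.inv_ne_top.2 (tsub_pos_of_lt h1).ne'

section cubes
variable {n : ℕ}

/-- index of the dyadic cube of level `l` containing `x` -/
def ix (l : ℕ) (x : Fin n → ℝ) : Fin n → ℤ := fun i => ⌊x i * 2 ^ l⌋

theorem ix_meas (l : ℕ) : Measurable (ix (n := n) l) := by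
  refine measurable_pi_lambda _ fun i => ?_
  exact Int.measurable_floor.comp ((measurable_pi_apply i).mul_const _)

/-- half-open cube -/
def hcube (l : ℕ) (ν : Fin n → ℤ) : Set (Fin n → ℝ) := ix l ⁻¹' {ν}

theorem hcube_meas (l : ℕ) (ν : Fin n → ℤ) : MeasurableSet (hcube l ν) :=
  ix_meas l (measurableSet_singleton ν)

theorem mem_hcube {l : ℕ} {ν : Fin n → ℤ} {x : Fin n → ℝ} : x ∈ hcube l ν ↔ ix l x = ν := Iff.rfl

theorem hcube_eq (l : ℕ) (ν : Fin n → ℤ) :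
    hcube l ν = Set.univ.pi fun i => Set.Ico ((ν i : ℝ) / 2 ^ l) (((ν i : ℝ) + 1) / 2 ^ l) := by
  ext x
  rw [mem_hcube]
  simp only [Set.mem_pi, Set.mem_univ, true_imp_iff, Set.mem_Ico, ix, funext_iff, Int.floor_eq_iff]
  refine forall_congr' fun i => ?_
  rw [div_le_iff₀ (by positivity), lt_div_iff₀ (by positivity)]

theorem hcube_sub (l : ℕ) (ν : Fin n → ℤ) : hcube l ν ⊆ dyadicCube n l ν := by
  rw [hcube_eq]
  intro x hx i
  exact ⟨(hx i trivial).1, (hx i trivial).2.le⟩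

theorem prod_side (l : ℕ) (ν : Fin n → ℤ) :
    (∏ i : Fin n, ENNReal.ofReal (((ν i : ℝ) + 1) / 2 ^ l - (ν i : ℝ) / 2 ^ l)) = pw (-(l * n)) := by
  have h : ∀ i : Fin n, ENNReal.ofReal (((ν i : ℝ) + 1) / 2 ^ l - (ν i : ℝ) / 2 ^ l) = pw (-(l : ℝ)) := by
    intro i
    rw [pw, Real.rpow_neg (by norm_num), Real.rpow_natCast]
    congr 1; ring
  simp_rw [h]
  rw [Finset.prod_const, Finset.card_univ, Fintype.card_fin, ← ENNReal.rpow_natCast, pw_rpow, neg_mul]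

theorem hcube_vol (l : ℕ) (ν : Fin n → ℤ) : volume (hcube l ν) = pw (-(l * n)) := by
  rw [hcube_eq, Real.volume_pi_Ico, prod_side]

theorem dyadic_vol (l : ℕ) (ν : Fin n → ℤ) : volume (dyadicCube n l ν) = pw (-(l * n)) := by
  have : dyadicCube n l ν = Set.Icc (fun i => (ν i : ℝ) / 2 ^ l) (fun i => ((ν i : ℝ) + 1) / 2 ^ l) := by
    ext x
    simp only [dyadicCube, Set.mem_setOf_eq, Set.mem_Icc, Pi.le_def, forall_and]
  rw [this, Real.volume_Icc_pi, prod_side]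

theorem lint_cubes (l : ℕ) (g : (Fin n → ℝ) → ℝ≥0∞) : ∫⁻ x, g x = ∑' ν, ∫⁻ x in hcube l ν, g x := by
  rw [← lintegral_iUnion (hcube_meas l)]
  · have : ⋃ ν : Fin n → ℤ, hcube l ν = Set.univ := by
      rw [Set.eq_univ_iff_forall]
      intro x
      rw [Set.mem_iUnion]
      exact ⟨ix l x, rfl⟩
    rw [this, Measure.restrict_univ]
  · intro a b hab
    rw [Function.onFun, Set.disjoint_left]
    intro x hx hy
    exact hab (hx.symm.trans hy)

theorem ix_dist (l : ℕ) (x z : Fin n → ℝ) : ‖ix l x - ix l z‖ ≤ 2 ^ l * ‖x - z‖ + 1 := by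
  rw [pi_norm_le_iff_of_nonneg (by positivity)]
  intro i
  rw [Pi.sub_apply, Int.norm_eq_abs]
  have h1 : |x i - z i| ≤ ‖x - z‖ := by
    have := norm_le_pi_norm (x - z) i
    simpa using this
  have h2 : |x i * 2 ^ l - z i * 2 ^ l| ≤ 2 ^ l * ‖x - z‖ := by
    rw [← sub_mul, abs_mul, abs_of_nonneg (by positivity : (0 : ℝ) ≤ 2 ^ l), mul_comm]
    gcongr
  have h3 := Int.floor_le (x i * 2 ^ l)
  have h4 := Int.lt_floor_add_one (x i * 2 ^ l)
  have h5 := Int.floor_le (z i * 2 ^ l)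
  have h6 := Int.lt_floor_add_one (z i * 2 ^ l)
  rw [abs_le] at h2 ⊢
  simp only [ix]
  push_cast
  constructor <;> linarith [h2.1, h2.2]

theorem pw_poly {s : ℝ} (hs : 0 < s) (N : ℕ) : ∃ K : ℝ, 0 < K ∧ ∀ u : ℝ, 0 ≤ u →
    pw (-(s * u)) ≤ ENNReal.ofReal K * ENNReal.ofReal ((1 + u) ^ (-(N : ℝ))) := by
  have ha : 0 < s * Real.log 2 := mul_pos hs (Real.log_pos (by norm_num))
  set a := s * Real.log 2 with hadef
  refine ⟨Real.exp a * N.factorial / a ^ N, by positivity, fun u hu => ?_⟩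
  rw [pw, ← ENNReal.ofReal_mul (by positivity)]
  apply ENNReal.ofReal_le_ofReal
  have h := Real.pow_div_factorial_le_exp (a * (1 + u)) (by positivity) N
  have e1 : (2 : ℝ) ^ (-(s * u)) = Real.exp (-(a * u)) := by
    rw [Real.rpow_def_of_pos (by norm_num), hadef]; congr 1; ring
  rw [e1, Real.rpow_neg (by positivity), Real.rpow_natCast, Real.exp_neg]
  rw [mul_pow, mul_add, mul_one, Real.exp_add, div_le_iff₀ (by positivity)] at h
  rw [← div_eq_mul_inv, le_div_iff₀ (by positivity), inv_mul_le_iff₀ (by positivity), mul_div_assoc',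
    le_div_iff₀ (by positivity)]
  linarith

theorem sumZ {s : ℝ} (hs : 0 < s) : ∑' ν : Fin n → ℤ, pw (-(s * ‖ν‖)) ≠ ∞ := by
  obtain ⟨K, hK, hKu⟩ := pw_poly hs (n + 1)
  have h1 : ∑' ν : Fin n → ℤ, pw (-(s * ‖ν‖)) ≤ ∫⁻ x : Fin n → ℝ, pw s * (ENNReal.ofReal K *
      ENNReal.ofReal ((1 + ‖x‖) ^ (-((n + 1 : ℕ) : ℝ)))) := by
    rw [lint_cubes 0]
    refine ENNReal.tsum_le_tsum fun ν => ?_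
    calc pw (-(s * ‖ν‖)) = ∫⁻ x in hcube 0 ν, pw (-(s * ‖ν‖)) := by
          rw [setLIntegral_const, hcube_vol]; simp [pw_zero]
      _ ≤ _ := by
          refine setLIntegral_mono' (hcube_meas 0 ν) fun x hx => ?_
          refine le_trans ?_ (mul_le_mul' le_rfl (hKu ‖x‖ (norm_nonneg _)))
          rw [← pw_add]
          apply pw_mono
          have h2 : ‖x‖ ≤ ‖ν‖ + 1 := by
            rw [pi_norm_le_iff_of_nonneg (by positivity)]
            intro i
            have h3 : (|ν i| : ℝ) ≤ ‖ν‖ := by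
              have := norm_le_pi_norm ν i
              rwa [Int.norm_eq_abs] at this
            have h4 := hcube_sub 0 ν hx i
            simp only [pow_zero, div_one] at h4
            rw [Real.norm_eq_abs, abs_le]
            rw [abs_le] at h3
            constructor <;> linarith [h3.1, h3.2, h4.1, h4.2]
          nlinarith
  refine ne_top_of_le_ne_top ?_ h1
  rw [lintegral_const_mul' _ _ (pw_ne_top _), lintegral_const_mul' _ _ ENNReal.ofReal_ne_top]
  refine ENNReal.mul_ne_top (pw_ne_top _) (ENNReal.mul_ne_top ENNReal.ofReal_ne_top ?_)
  refine (finite_integral_one_add_norm ?_).ne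
  simp

theorem sumZ_shift (s : ℝ) (μ : Fin n → ℤ) :
    ∑' ν : Fin n → ℤ, pw (-(s * ‖μ - ν‖)) = ∑' ν : Fin n → ℤ, pw (-(s * ‖ν‖)) :=
  (Equiv.subLeft μ).tsum_eq (fun ν : Fin n → ℤ => pw (-(s * ‖ν‖)))

theorem sumZ_shift' (s : ℝ) (ν : Fin n → ℤ) :
    ∑' μ : Fin n → ℤ, pw (-(s * ‖μ - ν‖)) = ∑' ν : Fin n → ℤ, pw (-(s * ‖ν‖)) :=
  (Equiv.subRight ν).tsum_eq (fun ν : Fin n → ℤ => pw (-(s * ‖ν‖)))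

end cubes

section weights
variable {n : ℕ} {p σ₁ σ₂ : ℝ≥0∞} {α₁ α₂ α₃ : ℝ} {t : ℕ → (Fin n → ℝ) → ℝ}

theorem MemX.pos (ht : MemX n p σ₁ σ₂ α₁ α₂ α₃ t) (l : ℕ) (μ : Fin n → ℤ) : tkm n p t l μ ≠ 0 :=
  (ht.2.2.2.1 l μ).ne'

theorem MemX.fin (ht : MemX n p σ₁ σ₂ α₁ α₂ α₃ t) (l : ℕ) (μ : Fin n → ℤ) : tkm n p t l μ ≠ ∞ :=
  (ht.1.2.2 l μ).ne

theorem MemX.comp_nat (ht : MemX n p σ₁ σ₂ α₁ α₂ α₃ t) (l N : ℕ) : ∀ (μ ν : Fin n → ℤ),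
    (∀ i, |μ i - ν i| ≤ N) → tkm n p t l μ ≤ pw (α₃ * N) * tkm n p t l ν := by
  induction N with
  | zero =>
    intro μ ν h
    have : μ = ν := by
      ext i; have := h i; simp at this; omega
    rw [this]; simp [pw_zero]
  | succ N ih =>
    intro μ ν h
    set m' : Fin n → ℤ := fun i => ν i + max (-(N : ℤ)) (min (N : ℤ) (μ i - ν i)) with hm'
    have h1 := ht.2.2.2.2 l μ m' (by
      intro i
      have := h i
      rw [abs_le] at this ⊢
      push_cast at this
      simp only [hm']
      omega)
    have h2 := ih m' ν (by
      intro i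
      rw [abs_le]
      simp only [hm']
      omega)
    refine h1.trans ((mul_le_mul' le_rfl h2).trans (le_of_eq ?_))
    rw [← mul_assoc]
    change pw α₃ * _ * _ = _
    rw [← pw_add]; congr 2; push_cast; ring

theorem MemX.comp (ht : MemX n p σ₁ σ₂ α₁ α₂ α₃ t) (hα₃ : 0 ≤ α₃) (l : ℕ) (μ ν : Fin n → ℤ) :
    tkm n p t l μ ≤ pw (α₃ * ‖μ - ν‖) * tkm n p t l ν := by
  refine (ht.comp_nat l ⌊‖μ - ν‖⌋₊ μ ν fun i => ?_).trans (mul_le_mul' (pw_mono ?_) le_rfl)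
  · have h := norm_le_pi_norm (μ - ν) i
    rw [Pi.sub_apply, Int.norm_eq_abs] at h
    have h2 : ((|μ i - ν i|.toNat : ℕ) : ℝ) ≤ ‖μ - ν‖ := by
      refine le_trans (le_of_eq ?_) h
      have : ((|μ i - ν i|.toNat : ℤ) : ℝ) = ((|μ i - ν i| : ℤ) : ℝ) := by
        rw [Int.toNat_of_nonneg (abs_nonneg _)]
      push_cast at this
      push_cast
      rw [← this]
    have h3 := Nat.le_floor h2
    omega
  · exact mul_le_mul_of_nonneg_left (Nat.floor_le (norm_nonneg _)) hα₃

theorem two_pow_rpow (k n : ℕ) (s : ℝ) : ((2 : ℝ≥0∞) ^ (k * n)) ^ s = pw (k * n * s) := by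
  rw [← pw_natpow, pw_rpow]; push_cast; rfl

/-- consequence of (ii) -/
theorem MemX.two (ht : MemX n p σ₁ σ₂ α₁ α₂ α₃ t) (hps : p ≤ σ₂) :
    ∃ C : ℝ≥0∞, C ≠ ∞ ∧ ∀ k j : ℕ, k ≤ j → ∀ m : Fin n → ℤ,
      eLpNorm (t j) p (volume.restrict (dyadicCube n k m)) ≤ C * pw (α₂ * (j - k)) * tkm n p t k m := by
  obtain ⟨C₂, hC₂, h⟩ := ht.2.2.1
  refine ⟨ENNReal.ofReal C₂, ENNReal.ofReal_ne_top, fun k j hkj m => ?_⟩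
  have h1 := h k j hkj m
  rw [two_pow_rpow, two_pow_rpow, ENNReal.ofReal_mul hC₂.le] at h1
  change _ ≤ ENNReal.ofReal C₂ * pw _ * _ at h1
  have h2 := eLpNorm_le_eLpNorm_mul_rpow_measure_univ hps
    ((ht.1.1 j).aestronglyMeasurable (μ := volume.restrict (dyadicCube n k m)))
  rw [Measure.restrict_apply_univ, dyadic_vol, pw_rpow] at h2
  refine h2.trans ?_
  have h3 : eLpNorm (t j) σ₂ (volume.restrict (dyadicCube n k m)) * pw (-(k * n) * (1 / p.toReal - 1 / σ₂.toReal))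
    = pw (-(k * n) * (1 / p.toReal)) *
      (pw (k * n * σ₂⁻¹.toReal) * eLpNorm (t j) σ₂ (volume.restrict (dyadicCube n k m))) := by
    rw [← mul_assoc, ← pw_add, mul_comm]
    congr 2
    rw [ENNReal.toReal_inv]; ring
  rw [h3]
  refine (mul_le_mul' le_rfl h1).trans (le_of_eq ?_)
  rw [mul_left_comm, ← mul_assoc (pw (-(k * n) * (1 / p.toReal))), ← pw_add,
    show -(k * n : ℝ) * (1 / p.toReal) + k * n * p⁻¹.toReal = 0 by rw [ENNReal.toReal_inv]; ring, pw_zero,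
    one_mul]

/-- the exponent `r` -/
def rE (p σ₁ : ℝ≥0∞) : ℝ≥0∞ := min (p⁻¹ + σ₁⁻¹)⁻¹ 1

theorem rE_ne_top (p σ₁ : ℝ≥0∞) : rE p σ₁ ≠ ∞ := ne_top_of_le_ne_top one_ne_top (min_le_right _ _)

theorem rE_ne_zero (hp : 0 < p) (hs : 0 < σ₁) : rE p σ₁ ≠ 0 := by
  rw [rE]
  refine (lt_min ?_ one_pos).ne'
  rw [ENNReal.inv_pos]
  exact ENNReal.add_ne_top.2 ⟨ENNReal.inv_ne_top.2 hp.ne', ENNReal.inv_ne_top.2 hs.ne'⟩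

theorem rE_pos (hp : 0 < p) (hs : 0 < σ₁) : 0 < (rE p σ₁).toReal :=
  ENNReal.toReal_pos (rE_ne_zero hp hs) (rE_ne_top _ _)

theorem rE_le_one : (rE p σ₁).toReal ≤ 1 := by
  have := ENNReal.toReal_mono one_ne_top (min_le_right (p⁻¹ + σ₁⁻¹)⁻¹ 1)
  simpa [rE] using this

theorem MemX.one (ht : MemX n p σ₁ σ₂ α₁ α₂ α₃ t) (hp : 0 < p) (hs : 0 < σ₁) :
    ∃ C : ℝ≥0∞, C ≠ ∞ ∧ ∀ (Fr : (Fin n → ℝ) → ℝ), Measurable Fr → ∀ (l i : ℕ) (ν : Fin n → ℤ),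
      tkm n p t l ν ^ (rE p σ₁).toReal * ∫⁻ x in hcube l ν, ‖Fr x‖ₑ ^ (rE p σ₁).toReal ≤
        (C * pw (-(α₁ * i)) * eLpNorm (fun x => t (l + i) x * Fr x) p (volume.restrict (hcube l ν)))
          ^ (rE p σ₁).toReal * pw (-(l * n)) := by
  obtain ⟨C₁, hC₁, h⟩ := ht.2.1
  have hr := rE_pos hp hs
  set r := (rE p σ₁).toReal with hrdef
  refine ⟨ENNReal.ofReal C₁, ENNReal.ofReal_ne_top, fun Fr hFr l i ν => ?_⟩
  have h1 := h l (l + i) (by omega) ν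
  rw [two_pow_rpow, two_pow_rpow, ENNReal.ofReal_mul hC₁.le] at h1
  change _ ≤ ENNReal.ofReal C₁ * pw _ at h1
  set μ := volume.restrict (hcube l ν) with hμ
  haveI : ENNReal.HolderTriple σ₁ p (p⁻¹ + σ₁⁻¹)⁻¹ := ⟨by rw [inv_inv, add_comm]⟩
  have htm := (ht.1.1 (l + i))
  have h2 : eLpNorm Fr (rE p σ₁) μ ≤ eLpNorm Fr (p⁻¹ + σ₁⁻¹)⁻¹ μ *
      μ Set.univ ^ (1 / (rE p σ₁).toReal - 1 / ((p⁻¹ + σ₁⁻¹)⁻¹).toReal) :=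
    eLpNorm_le_eLpNorm_mul_rpow_measure_univ (min_le_left _ _) hFr.aestronglyMeasurable
  have h3 : eLpNorm Fr (p⁻¹ + σ₁⁻¹)⁻¹ μ ≤ eLpNorm (fun x => (t (l + i) x)⁻¹) σ₁ μ *
      eLpNorm (fun x => t (l + i) x * Fr x) p μ := by
    have := eLpNorm_smul_le_mul_eLpNorm (μ := μ) (p := σ₁) (q := p) (r := (p⁻¹ + σ₁⁻¹)⁻¹)
      (f := fun x => t (l + i) x * Fr x) (htm.mul hFr).aestronglyMeasurable
      (φ := fun x => (t (l + i) x)⁻¹) htm.inv.aestronglyMeasurable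
    refine le_trans (le_of_eq ?_) this
    refine eLpNorm_congr_ae ?_
    filter_upwards [ae_restrict_of_ae (ht.1.2.1 (l + i))] with x hx
    simp only [Pi.smul_apply', smul_eq_mul]
    rw [inv_mul_cancel_left₀ hx.ne']
  have h4 : eLpNorm (fun x => (t (l + i) x)⁻¹) σ₁ μ ≤
      eLpNorm (fun x => (t (l + i) x)⁻¹) σ₁ (volume.restrict (dyadicCube n l ν)) :=
    eLpNorm_mono_measure _ (Measure.restrict_mono (hcube_sub l ν) le_rfl)
  have h5 : μ Set.univ = pw (-(l * n)) := by rw [hμ, Measure.restrict_apply_univ, hcube_vol]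
  have hinv : 1 / ((p⁻¹ + σ₁⁻¹)⁻¹).toReal = p⁻¹.toReal + σ₁⁻¹.toReal := by
    rw [ENNReal.toReal_inv, one_div, inv_inv,
      ENNReal.toReal_add (ENNReal.inv_ne_top.2 hp.ne') (ENNReal.inv_ne_top.2 hs.ne')]
  rw [h5, pw_rpow, hinv] at h2
  have h6 : (∫⁻ x in hcube l ν, ‖Fr x‖ₑ ^ r) = eLpNorm Fr (rE p σ₁) μ ^ r := by
    rw [eLpNorm_eq_lintegral_rpow_enorm_toReal (rE_ne_zero hp hs) (rE_ne_top _ _), ← ENNReal.rpow_mul,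
      ← hrdef, one_div, inv_mul_cancel₀ hr.ne', ENNReal.rpow_one]
  have h7 : pw (-(l * n)) = pw (-(l * n) * (1 / r)) ^ r := by
    rw [pw_rpow, mul_assoc, one_div, inv_mul_cancel₀ hr.ne', mul_one]
  rw [h6, h7, ← ENNReal.mul_rpow_of_nonneg _ _ hr.le, ← ENNReal.mul_rpow_of_nonneg _ _ hr.le]
  refine ENNReal.rpow_le_rpow ?_ hr.le
  refine (mul_le_mul' le_rfl (h2.trans (mul_le_mul' (h3.trans (mul_le_mul' h4 le_rfl)) le_rfl))).trans ?_
  set g := eLpNorm (fun x => t (l + i) x * Fr x) p μ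
  set I := eLpNorm (fun x => (t (l + i) x)⁻¹) σ₁ (volume.restrict (dyadicCube n l ν))
  set T := tkm n p t l ν
  have h8 : T * (I * g * pw (-(l * n) * (1 / r - (p⁻¹.toReal + σ₁⁻¹.toReal)))) =
      (pw (l * n * p⁻¹.toReal) * T * (pw (l * n * σ₁⁻¹.toReal) * I)) * g * pw (-(l * n) * (1 / r)) := by
    have : pw (-(l * n) * (1 / r - (p⁻¹.toReal + σ₁⁻¹.toReal))) =
      pw (l * n * p⁻¹.toReal) * pw (l * n * σ₁⁻¹.toReal) * pw (-(l * n) * (1 / r)) := by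
      rw [← pw_add, ← pw_add]; congr 1; ring
    rw [this]; ring
  rw [h8]
  refine mul_le_mul' (mul_le_mul' (h1.trans (le_of_eq ?_)) le_rfl) le_rfl
  congr 2; push_cast; ring

end weights

/-! ### Part 9: the weighted estimates -/

theorem iSup_rpow_le_tsum {ι : Type*} (a : ι → ℝ≥0∞) {s : ℝ} (hs : 0 < s) :
    (⨆ i, a i) ^ s ≤ ∑' i, a i ^ s := by
  rw [← ENNReal.le_rpow_inv_iff hs]
  refine iSup_le fun i => ?_
  rw [ENNReal.le_rpow_inv_iff hs]
  exact ENNReal.le_tsum i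

theorem sum_refl (l : ℕ) (a : ℝ) :
    ∑ k ∈ Finset.range (l + 1), pw (-(a * (l - k))) ≤ ∑' m : ℕ, pw (-(a * m)) := by
  rw [← Finset.sum_range_reflect]
  refine le_trans (Finset.sum_le_sum (g := fun m : ℕ => pw (-(a * m))) fun m hm => ?_) (ENNReal.sum_le_tsum _)
  have h : m ≤ l := by rw [Finset.mem_range] at hm; omega
  have : ((l + 1 - 1 - m : ℕ) : ℝ) = l - m := by
    rw [Nat.add_sub_cancel, Nat.cast_sub h]
  rw [this]
  apply le_of_eq; congr 1; ring

/-- control sequence -/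
def RR (N : ℕ → ℝ≥0∞) (ε : ℝ) (l : ℕ) : ℝ≥0∞ :=
  ⨆ (m : ℕ) (i : ℕ) (_ : m ≤ l), pw (-(ε * (m + i))) * N (l - m + i)

theorem le_RR (N : ℕ → ℝ≥0∞) (ε : ℝ) {l k : ℕ} (hk : k ≤ l) (i : ℕ) :
    N (k + i) ≤ pw (ε * ((l - k) + i)) * RR N ε l := by
  have h : pw (-(ε * ((l - k : ℕ) + i))) * N (l - (l - k) + i) ≤ RR N ε l :=
    le_iSup_of_le (l - k) (le_iSup_of_le i (le_iSup_of_le (Nat.sub_le _ _) le_rfl))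
  rw [Nat.sub_sub_self hk, Nat.cast_sub hk] at h
  refine le_trans (le_of_eq ?_) (mul_le_mul' le_rfl h)
  rw [← mul_assoc, pw_mul_neg, one_mul]

theorem lq_mono {q : ℝ≥0∞} {a b : ℕ → ℝ≥0∞} (h : ∀ k, a k ≤ b k) : lqNorm q a ≤ lqNorm q b := by
  unfold lqNorm
  split_ifs
  · exact iSup_mono h
  · exact ENNReal.rpow_le_rpow (ENNReal.tsum_le_tsum fun k => ENNReal.rpow_le_rpow (h k) ENNReal.toReal_nonneg)
      (by positivity)

theorem lq_const_mul {q : ℝ≥0∞} (hq : 0 < q) (C : ℝ≥0∞) (a : ℕ → ℝ≥0∞) :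
    lqNorm q (fun k => C * a k) = C * lqNorm q a := by
  unfold lqNorm
  split_ifs with h
  · rw [ENNReal.mul_iSup]
  · have hq' := ENNReal.toReal_pos hq.ne' h
    simp_rw [ENNReal.mul_rpow_of_nonneg _ _ hq'.le]
    rw [ENNReal.tsum_mul_left, ENNReal.mul_rpow_of_nonneg _ _ (by positivity), ← ENNReal.rpow_mul,
      mul_one_div_cancel hq'.ne', ENNReal.rpow_one]

theorem le_lq {q : ℝ≥0∞} (hq : 0 < q) (a : ℕ → ℝ≥0∞) (k : ℕ) : a k ≤ lqNorm q a := by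
  unfold lqNorm
  split_ifs with h
  · exact le_iSup a k
  · have hq' := ENNReal.toReal_pos hq.ne' h
    rw [one_div, ENNReal.le_rpow_inv_iff hq']
    exact ENNReal.le_tsum k

theorem lq_RR {q : ℝ≥0∞} (hq : 0 < q) {ε : ℝ} (hε : 0 < ε) :
    ∃ C : ℝ≥0∞, C ≠ ∞ ∧ ∀ N : ℕ → ℝ≥0∞, lqNorm q (RR N ε) ≤ C * lqNorm q N := by
  by_cases h : q = ∞
  · refine ⟨1, one_ne_top, fun N => ?_⟩
    rw [one_mul]
    simp only [lqNorm, if_pos h]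
    refine iSup_le fun l => iSup_le fun m => iSup_le fun i => iSup_le fun hm => ?_
    refine le_trans (mul_le_mul' (pw_mono (y := 0) ?_) (le_iSup N _)) ?_
    · have : 0 ≤ ε * (m + i) := by positivity
      linarith
    · rw [pw_zero, one_mul]
  · have hq' := ENNReal.toReal_pos hq.ne' h
    set s := q.toReal
    set Z := ∑' i : ℕ, pw (-((s * ε) * i)) with hZ
    have hZt : Z ≠ ∞ := pw_geom (by positivity)
    refine ⟨(Z * Z) ^ (1 / s), ENNReal.rpow_ne_top_of_nonneg (by positivity) (ENNReal.mul_ne_top hZt hZt),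
      fun N => ?_⟩
    simp only [lqNorm, if_neg h]
    rw [← ENNReal.mul_rpow_of_nonneg _ _ (by positivity)]
    refine ENNReal.rpow_le_rpow ?_ (by positivity)
    set W := ∑' k, N k ^ s with hW
    have h1 : ∀ l, RR N ε l ^ s ≤ ∑' m : ℕ, ∑' i : ℕ, pw (-((s * ε) * m)) * (pw (-((s * ε) * i)) *
        if m ≤ l then N (l - m + i) ^ s else 0) := by
      intro l
      unfold RR
      refine (iSup_rpow_le_tsum _ hq').trans (ENNReal.tsum_le_tsum fun m => ?_)
      refine (iSup_rpow_le_tsum _ hq').trans (ENNReal.tsum_le_tsum fun i => ?_)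
      by_cases hm : m ≤ l
      · simp only [hm, iSup_pos, if_true]
        rw [ENNReal.mul_rpow_of_nonneg _ _ hq'.le, pw_rpow, ← mul_assoc, ← pw_add]
        apply le_of_eq; congr 2; ring
      · simp only [hm, iSup_neg, not_false_eq_true, if_false]
        rw [ENNReal.bot_eq_zero, ENNReal.zero_rpow_of_pos hq']; exact bot_le
    refine (ENNReal.tsum_le_tsum h1).trans ?_
    rw [ENNReal.tsum_comm]
    have h2 : ∀ m i : ℕ, ∑' l, (if m ≤ l then N (l - m + i) ^ s else 0) ≤ W := by
      intro m i
      have e : ∑' l, (if m ≤ l then N (l - m + i) ^ s else 0) = ∑' k, N (k + i) ^ s := by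
        rw [← (add_left_injective m).tsum_eq (f := fun l => (if m ≤ l then N (l - m + i) ^ s else 0))]
        · simp
        · intro l hl
          simp only [Function.mem_support, ne_eq, ite_eq_right_iff, not_forall] at hl
          obtain ⟨h1, _⟩ := hl
          exact ⟨l - m, Nat.sub_add_cancel h1⟩
      rw [e]
      exact ENNReal.tsum_comp_le_tsum_of_injective (add_left_injective i) (fun k => N k ^ s)
    calc ∑' m : ℕ, ∑' l : ℕ, ∑' i : ℕ, pw (-((s * ε) * m)) * (pw (-((s * ε) * i)) *
        if m ≤ l then N (l - m + i) ^ s else 0)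
        = ∑' m : ℕ, pw (-((s * ε) * m)) * ∑' i : ℕ, pw (-((s * ε) * i)) *
            ∑' l, (if m ≤ l then N (l - m + i) ^ s else 0) := by
          refine tsum_congr fun m => ?_
          rw [ENNReal.tsum_comm, ← ENNReal.tsum_mul_left]
          refine tsum_congr fun i => ?_
          rw [ENNReal.tsum_mul_left, ENNReal.tsum_mul_left]
      _ ≤ ∑' m : ℕ, pw (-((s * ε) * m)) * ∑' i : ℕ, pw (-((s * ε) * i)) * W := by
          gcongr with m i
          exact h2 m i
      _ = Z * Z * W := by
          rw [ENNReal.tsum_mul_right, ENNReal.tsum_mul_right, ← hZ, mul_assoc]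

section weights
variable {n : ℕ} {p σ₁ σ₂ : ℝ≥0∞} {α₁ α₂ α₃ : ℝ} {t : ℕ → (Fin n → ℝ) → ℝ}

/-- local norms -/
def gN (p : ℝ≥0∞) (t Fr : ℕ → (Fin n → ℝ) → ℝ) (l i : ℕ) (ν : Fin n → ℤ) : ℝ≥0∞ :=
  eLpNorm (fun x => t (l + i) x * Fr (l + i) x) p (volume.restrict (hcube l ν))

/-- global norms -/
def NN (p : ℝ≥0∞) (t Fr : ℕ → (Fin n → ℝ) → ℝ) (j : ℕ) : ℝ≥0∞ :=
  eLpNorm (fun x => t j x * Fr j x) p volume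

theorem gN_le (t Fr : ℕ → (Fin n → ℝ) → ℝ) (l i : ℕ) (ν : Fin n → ℤ) : gN p t Fr l i ν ≤ NN p t Fr (l + i) :=
  eLpNorm_mono_measure _ Measure.restrict_le_self

theorem gN_sum (hp : 0 < p) (hp' : p ≠ ∞) (t Fr : ℕ → (Fin n → ℝ) → ℝ) (l i : ℕ) :
    ∑' ν, gN p t Fr l i ν ^ p.toReal = NN p t Fr (l + i) ^ p.toReal := by
  have h := ENNReal.toReal_pos hp.ne' hp'
  unfold gN NN
  simp_rw [eLpNorm_eq_lintegral_rpow_enorm_toReal hp.ne' hp', ← ENNReal.rpow_mul, one_div,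
    inv_mul_cancel₀ h.ne', ENNReal.rpow_one]
  exact (lint_cubes l _).symm

/-- local sup -/
def SS (p : ℝ≥0∞) (t Fr : ℕ → (Fin n → ℝ) → ℝ) (l : ℕ) (μ : Fin n → ℤ) : ℝ≥0∞ :=
  ⨆ (i : ℕ) (ν : Fin n → ℤ), pw (-(i + ‖μ - ν‖)) * gN p t Fr l i ν

theorem SS_sum (hp : 0 < p) (hp' : p ≠ ∞) (t Fr : ℕ → (Fin n → ℝ) → ℝ) (l : ℕ) :
    ∑' μ, SS p t Fr l μ ^ p.toReal ≤ (∑' ν : Fin n → ℤ, pw (-(p.toReal * ‖ν‖))) *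
      ∑' i : ℕ, pw (-(p.toReal * i)) * NN p t Fr (l + i) ^ p.toReal := by
  have h := ENNReal.toReal_pos hp.ne' hp'
  set s := p.toReal
  set Z := ∑' ν : Fin n → ℤ, pw (-(s * ‖ν‖)) with hZ
  have h1 : ∀ μ : Fin n → ℤ, SS p t Fr l μ ^ s ≤ ∑' i : ℕ, ∑' ν : Fin n → ℤ,
      pw (-(s * i)) * (gN p t Fr l i ν ^ s * pw (-(s * ‖μ - ν‖))) := by
    intro μ
    unfold SS
    refine (iSup_rpow_le_tsum _ h).trans (ENNReal.tsum_le_tsum fun i => ?_)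
    refine (iSup_rpow_le_tsum _ h).trans (ENNReal.tsum_le_tsum fun ν => ?_)
    rw [ENNReal.mul_rpow_of_nonneg _ _ h.le, pw_rpow, mul_left_comm, ← pw_add, mul_comm]
    apply le_of_eq; congr 2; ring
  refine (ENNReal.tsum_le_tsum h1).trans (le_of_eq ?_)
  rw [ENNReal.tsum_comm, ← ENNReal.tsum_mul_left]
  refine tsum_congr fun i => ?_
  rw [ENNReal.tsum_comm, ← gN_sum hp hp', mul_left_comm, ← ENNReal.tsum_mul_left, ← ENNReal.tsum_mul_left]
  refine tsum_congr fun ν => ?_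
  rw [ENNReal.tsum_mul_left, ENNReal.tsum_mul_left, sumZ_shift', ← hZ]
  ring

theorem SS_le (t Fr : ℕ → (Fin n → ℝ) → ℝ) (l : ℕ) (μ : Fin n → ℤ) {B : ℝ≥0∞}
    (hB : ∀ i : ℕ, pw (-(i : ℝ)) * NN p t Fr (l + i) ≤ B) : SS p t Fr l μ ≤ B := by
  refine iSup_le fun i => iSup_le fun ν => ?_
  refine le_trans (mul_le_mul' (pw_mono ?_) (gN_le t Fr l i ν)) (hB i)
  have := norm_nonneg (μ - ν)
  linarith

/-- the exponents -/
def A0 (n : ℕ) (p σ₁ : ℝ≥0∞) (α₁ : ℝ) : ℝ := n / (rE p σ₁).toReal + |α₁| + 2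

/-- enorm family -/
def eF (Fr : ℕ → (Fin n → ℝ) → ℝ) : ℕ → (Fin n → ℝ) → ℝ≥0∞ := fun k x => ‖Fr k x‖ₑ

/-- step function majorant -/
def Sd (p : ℝ≥0∞) (t Fr : ℕ → (Fin n → ℝ) → ℝ) (k : ℕ) (x : Fin n → ℝ) : ℝ≥0∞ :=
  SS p t Fr k (ix k x) * (tkm n p t k (ix k x))⁻¹

theorem IA_SS (ht : MemX n p σ₁ σ₂ α₁ α₂ α₃ t) (hp : 0 < p) (hs : 0 < σ₁) (hα₃ : 0 ≤ α₃) :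
    ∃ K : ℝ≥0∞, K ≠ ∞ ∧ ∀ Fr : ℕ → (Fin n → ℝ) → ℝ, (∀ k, Measurable (Fr k)) → ∀ l x,
      IA (eF Fr) (rE p σ₁).toReal (A0 n p σ₁ α₁) (α₃ + 2) l x ^ (1 / (rE p σ₁).toReal) ≤
        K * Sd p t Fr l x := by
  obtain ⟨C, hC, h1⟩ := ht.one hp hs
  have hr := rE_pos hp hs
  set r := (rE p σ₁).toReal with hrdef
  set A := A0 n p σ₁ α₁ with hA
  set Z := ∑' ν : Fin n → ℤ, pw (-(r * ‖ν‖)) with hZ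
  set Y := ∑' i : ℕ, pw (-(r * i)) with hY
  have hZt : Z ≠ ∞ := sumZ hr
  have hYt : Y ≠ ∞ := pw_geom hr
  refine ⟨(C ^ r * pw (r * (α₃ + 2)) * (Y * Z)) ^ (1 / r),
    ENNReal.rpow_ne_top_of_nonneg (by positivity) (ENNReal.mul_ne_top (ENNReal.mul_ne_top
      (ENNReal.rpow_ne_top_of_nonneg hr.le hC) (pw_ne_top _)) (ENNReal.mul_ne_top hYt hZt)), fun Fr hFr l x => ?_⟩
  set μ := ix l x with hμ
  set T := tkm n p t l with hT
  have hT0 : T μ ≠ 0 := ht.pos l μ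
  have hTt : T μ ≠ ∞ := ht.fin l μ
  set S := SS p t Fr l μ with hS
  have key : T μ ^ r * IA (eF Fr) r A (α₃ + 2) l x ≤ C ^ r * pw (r * (α₃ + 2)) * (Y * Z) * S ^ r := by
    have hterm : ∀ (i : ℕ) (ν : Fin n → ℤ), T μ ^ r * (pw (-(r * A * i) + (l + i) * n) *
        ∫⁻ z in hcube l ν, eF Fr (l + i) z ^ r * pw (-(r * (α₃ + 2) * 2 ^ l * ‖x - z‖))) ≤
        C ^ r * pw (r * (α₃ + 2)) * (pw (-(r * i)) * pw (-(r * ‖μ - ν‖))) * S ^ r := by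
      intro i ν
      have e1 : ∫⁻ z in hcube l ν, eF Fr (l + i) z ^ r * pw (-(r * (α₃ + 2) * 2 ^ l * ‖x - z‖)) ≤
          pw (r * (α₃ + 2) - r * (α₃ + 2) * ‖μ - ν‖) * ∫⁻ z in hcube l ν, eF Fr (l + i) z ^ r := by
        rw [← lintegral_const_mul' _ _ (pw_ne_top _)]
        refine setLIntegral_mono' (hcube_meas l ν) fun z hz => ?_
        rw [mul_comm]
        refine mul_le_mul' (pw_mono ?_) le_rfl
        have := ix_dist l x z
        rw [mem_hcube.1 hz, ← hμ] at this
        have h3 : r * (α₃ + 2) * ‖μ - ν‖ ≤ r * (α₃ + 2) * (2 ^ l * ‖x - z‖ + 1) := by gcongr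
        linarith
      have e2 : T μ ^ r ≤ pw (r * α₃ * ‖μ - ν‖) * T ν ^ r := by
        refine (ENNReal.rpow_le_rpow (ht.comp hα₃ l μ ν) hr.le).trans (le_of_eq ?_)
        rw [ENNReal.mul_rpow_of_nonneg _ _ hr.le, pw_rpow]
        congr 2; ring
      have e3 := h1 (Fr (l + i)) (hFr _) l i ν
      have e4 : gN p t Fr l i ν ≤ pw (i + ‖μ - ν‖) * S := by
        have : pw (-(i + ‖μ - ν‖)) * gN p t Fr l i ν ≤ S := le_iSup_of_le i (le_iSup_of_le ν le_rfl)
        refine le_trans (le_of_eq ?_) (mul_le_mul' le_rfl this)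
        rw [← mul_assoc, pw_mul_neg, one_mul]
      have e5 : (C * pw (-(α₁ * i)) * gN p t Fr l i ν) ^ r ≤
          C ^ r * pw (-(α₁ * i) * r) * (pw ((i + ‖μ - ν‖) * r) * S ^ r) := by
        refine (ENNReal.rpow_le_rpow (mul_le_mul' le_rfl e4) hr.le).trans (le_of_eq ?_)
        rw [ENNReal.mul_rpow_of_nonneg _ _ hr.le, ENNReal.mul_rpow_of_nonneg _ _ hr.le,
          ENNReal.mul_rpow_of_nonneg _ _ hr.le, pw_rpow, pw_rpow]
      set I := ∫⁻ z in hcube l ν, eF Fr (l + i) z ^ r with hI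
      have e3' : T ν ^ r * I ≤ C ^ r * pw (-(α₁ * i) * r) * (pw ((i + ‖μ - ν‖) * r) * S ^ r) * pw (-(l * n)) :=
        e3.trans (mul_le_mul' e5 le_rfl)
      calc _ ≤ (pw (r * α₃ * ‖μ - ν‖) * T ν ^ r) * (pw (-(r * A * i) + (l + i) * n) *
            (pw (r * (α₃ + 2) - r * (α₃ + 2) * ‖μ - ν‖) * I)) := by gcongr
        _ = pw (r * α₃ * ‖μ - ν‖) * pw (-(r * A * i) + (l + i) * n) *
            pw (r * (α₃ + 2) - r * (α₃ + 2) * ‖μ - ν‖) * (T ν ^ r * I) := by ring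
        _ ≤ pw (r * α₃ * ‖μ - ν‖) * pw (-(r * A * i) + (l + i) * n) *
            pw (r * (α₃ + 2) - r * (α₃ + 2) * ‖μ - ν‖) *
            (C ^ r * pw (-(α₁ * i) * r) * (pw ((i + ‖μ - ν‖) * r) * S ^ r) * pw (-(l * n))) := by gcongr
        _ = pw (r * α₃ * ‖μ - ν‖ + (-(r * A * i) + (l + i) * n) +
            (r * (α₃ + 2) - r * (α₃ + 2) * ‖μ - ν‖) + (-(α₁ * i) * r) + (i + ‖μ - ν‖) * r + -(l * n)) *
              (C ^ r * S ^ r) := by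
            simp only [pw_add]; ring
        _ ≤ pw (r * (α₃ + 2) + -(r * i) + -(r * ‖μ - ν‖)) * (C ^ r * S ^ r) := by
            refine mul_le_mul' (pw_mono ?_) le_rfl
            have hAr : r * A = n + r * |α₁| + 2 * r := by
              rw [hA, A0, ← hrdef]; field_simp
            have ha : -(α₁ * i) * r ≤ r * |α₁| * i := by
              have : -α₁ ≤ |α₁| := neg_le_abs α₁
              have : 0 ≤ (|α₁| + α₁) * (i * r) := mul_nonneg (by linarith) (by positivity)
              linarith
            rw [hAr]
            linarith
        _ = _ := by simp only [pw_add]; ring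
    unfold IA
    rw [← ENNReal.tsum_mul_left, hY, ENNReal.tsum_mul_right.symm]
    rw [← ENNReal.tsum_mul_left, ← ENNReal.tsum_mul_right]
    refine ENNReal.tsum_le_tsum fun i => ?_
    rw [lint_cubes l, ← ENNReal.tsum_mul_left, ← ENNReal.tsum_mul_left, hZ, ← sumZ_shift r μ,
      ← ENNReal.tsum_mul_left, ← ENNReal.tsum_mul_left, ← ENNReal.tsum_mul_right]
    exact ENNReal.tsum_le_tsum fun ν => hterm i ν
  have hTr0 : T μ ^ r ≠ 0 := by
    intro h0
    rcases ENNReal.rpow_eq_zero_iff.1 h0 with h | h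
    · exact hT0 h.1
    · exact hTt h.1
  have hTrt : T μ ^ r ≠ ∞ := ENNReal.rpow_ne_top_of_nonneg hr.le hTt
  rw [one_div, ENNReal.rpow_inv_le_iff hr, Sd, ← hμ, ← hS, ENNReal.mul_rpow_of_nonneg _ _ hr.le,
    ← ENNReal.rpow_mul, inv_mul_cancel₀ hr.ne', ENNReal.rpow_one, ENNReal.mul_rpow_of_nonneg _ _ hr.le,
    ENNReal.inv_rpow, ← mul_assoc, ← div_eq_mul_inv, ENNReal.le_div_iff_mul_le (Or.inl hTr0) (Or.inl hTrt),
    mul_comm]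
  exact key

end weights

/-! ### Part 10: the estimate for the extension -/

section weights
variable {n : ℕ} {p q σ₁ σ₂ : ℝ≥0∞} {α₁ α₂ α₃ : ℝ} {t : ℕ → (Fin n → ℝ) → ℝ}

/-- hypothesis on the outer family -/
def OB (F O : ℕ → (Fin n → ℝ) → ℝ≥0∞) (h : ℕ) (s : ℝ) (C : ℝ≥0∞) (c : ℝ) : Prop :=
  ∀ (l : ℕ) (x : Fin n → ℝ), O l x ≤ C * (∑ k ∈ Finset.range l, pw (k * n - (l - k) * s) *
        ∫⁻ y in Metric.closedBall x (c / 2 ^ k), F k y) +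
      C * ∑' i : ℕ, pw (l * n - i * h) * ∫⁻ y in Metric.closedBall x (c / 2 ^ l), F (l + i) y

theorem ball_int (F : (Fin n → ℝ) → ℝ≥0∞) (x : Fin n → ℝ) {c : ℝ} (hc : 0 ≤ c) (l : ℕ) {B : ℝ≥0∞}
    (hB : ∀ y, ‖x - y‖ ≤ c / 2 ^ l → F y ≤ B) :
    ∫⁻ y in Metric.closedBall x (c / 2 ^ l), F y ≤ B * (ENNReal.ofReal ((2 * c) ^ n) * pw (-(l * n))) := by
  calc ∫⁻ y in Metric.closedBall x (c / 2 ^ l), F y ≤ ∫⁻ y in Metric.closedBall x (c / 2 ^ l), B := by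
        refine setLIntegral_mono' Metric.isClosed_closedBall.measurableSet fun y hy => hB y ?_
        rw [Metric.mem_closedBall, dist_eq_norm] at hy; rwa [norm_sub_rev]
    _ = _ := by
        rw [setLIntegral_const, Real.volume_pi_closedBall _ (by positivity), Fintype.card_fin, pw,
          ← ENNReal.ofReal_mul (by positivity)]
        congr 2
        rw [Real.rpow_neg (by norm_num), ← Nat.cast_mul, Real.rpow_natCast, pow_mul, ← div_eq_mul_inv,
          ← div_pow, mul_div_assoc]

/-- J-bound -/
theorem F_le_J {F : ℕ → (Fin n → ℝ) → ℝ≥0∞} {Cm : ℕ → ℝ≥0∞} {cm : ℕ → ℝ} (hCm : ∀ h, Cm h ≠ ∞)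
    (hcm : ∀ h, 0 ≤ cm h) (hF : ∀ h, ML F h (Cm h) (cm h))
    (hap : ∃ (C : ℝ≥0∞) (A b : ℕ), C ≠ ∞ ∧ ∀ k y, F k y ≤ C * pw (A * k + b * ‖y‖))
    {r A b : ℝ} (hr : 0 < r) (hr1 : r ≤ 1) (hA : 0 ≤ A) (hb : 0 ≤ b) {h : ℕ} (hAh : A ≤ h)
    (l i : ℕ) (x y : Fin n → ℝ) :
    F (l + i) y ≤ (Cm h * pw (b * cm h)) ^ (1 / r) * pw (A * i + b * 2 ^ l * ‖x - y‖) *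
      IA F r A b l x ^ (1 / r) := by
  have h1 := (r_trick hCm hcm hF hap hr hr1 hA hb hAh (l + i) y).trans
    (mul_le_mul' le_rfl (IA_shift F hr hb l i x y))
  rw [← ENNReal.le_rpow_inv_iff hr] at h1
  refine h1.trans (le_of_eq ?_)
  have hi : 0 ≤ r⁻¹ := by positivity
  rw [ENNReal.mul_rpow_of_nonneg (Cm h * pw (b * cm h)) _ hi, ENNReal.mul_rpow_of_nonneg (pw _) _ hi, pw_rpow,
    one_div, ← mul_assoc]
  congr 3
  field_simp

theorem A0_nonneg (n : ℕ) (p σ₁ : ℝ≥0∞) (α₁ : ℝ) : 0 ≤ A0 n p σ₁ α₁ := by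
  unfold A0
  have : 0 ≤ (n : ℝ) / (rE p σ₁).toReal := by positivity
  have := abs_nonneg α₁
  linarith

theorem apw_e (a b : ℝ≥0∞) (c d : ℝ) : a * (b * pw c) * pw d = a * b * pw (c + d) := by
  rw [pw_add]; ring

theorem O_le (ht : MemX n p σ₁ σ₂ α₁ α₂ α₃ t) (hp : 0 < p) (hs : 0 < σ₁) (hα₃ : 0 ≤ α₃)
    {Cm : ℕ → ℝ≥0∞} {cm : ℕ → ℝ} (hCm : ∀ h, Cm h ≠ ∞) (hcm : ∀ h, 0 ≤ cm h) {h : ℕ}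
    (hh : A0 n p σ₁ α₁ + 1 ≤ h) (s : ℝ) {C : ℝ≥0∞} (hC : C ≠ ∞) {c : ℝ} (hc : 0 ≤ c) :
    ∃ K : ℝ≥0∞, K ≠ ∞ ∧ ∀ (Fr : ℕ → (Fin n → ℝ) → ℝ) (O : ℕ → (Fin n → ℝ) → ℝ≥0∞), (∀ k, Measurable (Fr k)) →
      (∀ h, ML (eF Fr) h (Cm h) (cm h)) →
      (∃ (C : ℝ≥0∞) (A b : ℕ), C ≠ ∞ ∧ ∀ k y, eF Fr k y ≤ C * pw (A * k + b * ‖y‖)) →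
      OB (eF Fr) O h s C c → ∀ l x, O l x ≤ K * ∑ k ∈ Finset.range (l + 1), pw (-(s * (l - k))) * Sd p t Fr k x := by
  obtain ⟨K₀, hK₀, h0⟩ := IA_SS ht hp hs hα₃
  have hr := rE_pos hp hs
  have hr1 : (rE p σ₁).toReal ≤ 1 := rE_le_one
  set r := (rE p σ₁).toReal with hrdef
  set A := A0 n p σ₁ α₁ with hA
  have hA0 : 0 ≤ A := A0_nonneg _ _ _ _
  set b := α₃ + 2 with hb
  have hb0 : 0 ≤ b := by linarith
  have hAh : A ≤ h := by linarith
  set K₁ := (Cm h * pw (b * cm h)) ^ (1 / r) * pw (b * c) * K₀ * ENNReal.ofReal ((2 * c) ^ n) with hK₁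
  have hK₁t : K₁ ≠ ∞ := by
    refine ENNReal.mul_ne_top (ENNReal.mul_ne_top (ENNReal.mul_ne_top ?_ (pw_ne_top _)) hK₀) ENNReal.ofReal_ne_top
    exact ENNReal.rpow_ne_top_of_nonneg (by positivity) (ENNReal.mul_ne_top (hCm _) (pw_ne_top _))
  set Y := ∑' i : ℕ, pw (-((1 : ℝ) * i)) with hY
  have hYt : Y ≠ ∞ := pw_geom one_pos
  refine ⟨C * K₁ * (1 + Y), ENNReal.mul_ne_top (ENNReal.mul_ne_top hC hK₁t) (ENNReal.add_ne_top.2 ⟨one_ne_top, hYt⟩),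
    fun Fr O hFr hML hap hO l x => ?_⟩
  have hint : ∀ (l i : ℕ), ∫⁻ y in Metric.closedBall x (c / 2 ^ l), eF Fr (l + i) y ≤
      K₁ * pw (A * i - l * n) * Sd p t Fr l x := by
    intro l i
    refine (ball_int _ x hc l (B := (Cm h * pw (b * cm h)) ^ (1 / r) * pw (A * i + b * c) *
      (K₀ * Sd p t Fr l x)) fun y hy => ?_).trans (le_of_eq ?_)
    · refine (F_le_J hCm hcm hML hap hr hr1 hA0 hb0 hAh l i x y).trans ?_
      refine mul_le_mul' (mul_le_mul' le_rfl (pw_mono ?_)) (h0 Fr hFr l x)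
      have h7 : 2 ^ l * ‖x - y‖ ≤ c := by
        rw [le_div_iff₀ (by positivity)] at hy; linarith
      have : b * (2 ^ l * ‖x - y‖) ≤ b * c := by gcongr
      linarith
    · rw [hK₁, sub_eq_add_neg, pw_add, pw_add]; ring
  refine (hO l x).trans ?_
  rw [Finset.sum_range_succ, mul_add]
  refine add_le_add ?_ ?_
  · rw [mul_assoc C, mul_assoc C]
    refine mul_le_mul' le_rfl ?_
    rw [Finset.mul_sum]
    refine Finset.sum_le_sum fun k _ => ?_
    have h2 := hint k 0
    rw [add_zero] at h2
    refine (mul_le_mul' le_rfl h2).trans ?_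
    calc _ = K₁ * 1 * ((pw (k * n - (l - k) * s) * pw (A * (0 : ℕ) - k * n)) * Sd p t Fr k x) := by ring
      _ ≤ K₁ * (1 + Y) * (pw (-(s * (l - k))) * Sd p t Fr k x) := by
        rw [← pw_add]
        gcongr
        · exact le_self_add
        · apply le_of_eq; congr 1; push_cast; ring
  · rw [mul_assoc C, mul_assoc C]
    refine mul_le_mul' le_rfl ?_
    rw [sub_self, mul_zero, neg_zero, pw_zero, one_mul]
    have : K₁ * Y * Sd p t Fr l x ≤ K₁ * (1 + Y) * Sd p t Fr l x := by gcongr; exact le_add_self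
    refine le_trans ?_ this
    rw [hY, ← ENNReal.tsum_mul_left, ← ENNReal.tsum_mul_right]
    refine ENNReal.tsum_le_tsum fun i => ?_
    refine (mul_le_mul' le_rfl (hint l i)).trans ?_
    calc _ = K₁ * (pw (l * n - i * h) * pw (A * i - l * n)) * Sd p t Fr l x := by ring
      _ ≤ _ := by
        rw [← pw_add]
        refine mul_le_mul' (mul_le_mul' le_rfl (pw_mono ?_)) le_rfl
        have : (A + 1) * i ≤ h * i := by gcongr
        linarith

theorem F_growth (ht : MemX n p σ₁ σ₂ α₁ α₂ α₃ t) (hp : 0 < p) (hq : 0 < q) (hs : 0 < σ₁) (hα₃ : 0 ≤ α₃)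
    {Cm : ℕ → ℝ≥0∞} {cm : ℕ → ℝ} (hCm : ∀ h, Cm h ≠ ∞) (hcm : ∀ h, 0 ≤ cm h)
    (Fr : ℕ → (Fin n → ℝ) → ℝ) (hFr : ∀ k, Measurable (Fr k))
    (hML : ∀ h, ML (eF Fr) h (Cm h) (cm h))
    (hap : ∃ (C : ℝ≥0∞) (A b : ℕ), C ≠ ∞ ∧ ∀ k y, eF Fr k y ≤ C * pw (A * k + b * ‖y‖))
    (hN : lqNorm q (NN p t Fr) ≠ ∞) :
    ∃ C : ℝ≥0∞, C ≠ ∞ ∧ ∀ k y, eF Fr k y ≤ C * pw (A0 n p σ₁ α₁ * k + α₃ * ‖y‖) := by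
  obtain ⟨K₀, hK₀, h0⟩ := IA_SS ht hp hs hα₃
  have hr := rE_pos hp hs
  have hr1 : (rE p σ₁).toReal ≤ 1 := rE_le_one
  set r := (rE p σ₁).toReal with hrdef
  set A := A0 n p σ₁ α₁ with hA
  have hA0 : 0 ≤ A := A0_nonneg _ _ _ _
  set b := α₃ + 2 with hb
  have hb0 : 0 ≤ b := by linarith
  obtain ⟨h, hAh⟩ := exists_nat_ge A
  set D := (Cm h * pw (b * cm h)) ^ (1 / r) with hD
  have hDt : D ≠ ∞ :=
    ENNReal.rpow_ne_top_of_nonneg (by positivity) (ENNReal.mul_ne_top (hCm _) (pw_ne_top _))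
  set L := lqNorm q (NN p t Fr) with hL
  set T0 := tkm n p t 0 0 with hT0
  have hT00 : T0 ≠ 0 := ht.pos 0 0
  refine ⟨D * K₀ * L * T0⁻¹ * pw α₃, ENNReal.mul_ne_top (ENNReal.mul_ne_top (ENNReal.mul_ne_top
    (ENNReal.mul_ne_top hDt hK₀) hN) (ENNReal.inv_ne_top.2 hT00)) (pw_ne_top _), fun k y => ?_⟩
  have h1 := (F_le_J hCm hcm hML hap hr hr1 hA0 hb0 hAh 0 k y y).trans
    (mul_le_mul' le_rfl (h0 Fr hFr 0 y))
  rw [zero_add, sub_self, norm_zero, mul_zero, add_zero, ← hD] at h1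
  have h2 : SS p t Fr 0 (ix 0 y) ≤ L := by
    refine SS_le t Fr 0 _ fun i => ?_
    refine le_trans (mul_le_mul' (pw_mono (y := 0) (by simp)) (le_lq hq _ _)) ?_
    rw [pw_zero, one_mul]
  have h3 : (tkm n p t 0 (ix 0 y))⁻¹ ≤ pw (α₃ + α₃ * ‖y‖) * T0⁻¹ := by
    have h4 := ht.comp hα₃ 0 0 (ix 0 y)
    have h5 : ‖(0 : Fin n → ℤ) - ix 0 y‖ ≤ ‖y‖ + 1 := by
      have := ix_dist 0 0 y
      have e : ix 0 (0 : Fin n → ℝ) = 0 := by ext i; simp [ix]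
      rw [e] at this
      simpa using this
    have h6 : T0 ≤ pw (α₃ + α₃ * ‖y‖) * tkm n p t 0 (ix 0 y) := by
      refine h4.trans (mul_le_mul' (pw_mono ?_) le_rfl)
      have : α₃ * ‖(0 : Fin n → ℤ) - ix 0 y‖ ≤ α₃ * (‖y‖ + 1) := by gcongr
      linarith
    have h7 : T0⁻¹ ≥ (pw (α₃ + α₃ * ‖y‖) * tkm n p t 0 (ix 0 y))⁻¹ := ENNReal.inv_le_inv.2 h6
    rw [ENNReal.mul_inv (Or.inl (pw_ne_zero _)) (Or.inl (pw_ne_top _))] at h7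
    refine le_trans (le_of_eq ?_) (mul_le_mul' le_rfl h7)
    rw [← mul_assoc, ENNReal.mul_inv_cancel (pw_ne_zero _) (pw_ne_top _), one_mul]
  refine h1.trans ?_
  calc _ ≤ D * pw (A * k) * (K₀ * (L * (pw (α₃ + α₃ * ‖y‖) * T0⁻¹))) := by
        unfold Sd; gcongr
    _ = _ := by rw [pw_add, pw_add]; ring

theorem Lp_est (ht : MemX n p σ₁ σ₂ α₁ α₂ α₃ t) (hp : 0 < p) (hps : p ≤ σ₂) {s : ℝ} (hsα : α₂ < s) :
    ∃ (K : ℝ≥0∞) (ε : ℝ), K ≠ ∞ ∧ 0 < ε ∧ ∀ (Fr Or : ℕ → (Fin n → ℝ) → ℝ) (K₁ : ℝ≥0∞),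
      (∀ l x, ‖Or l x‖ₑ ≤ K₁ * ∑ k ∈ Finset.range (l + 1), pw (-(s * (l - k))) * Sd p t Fr k x) → ∀ l,
      NN p t Or l ≤ K₁ * K * RR (NN p t Fr) ε l := by
  obtain ⟨C₂, hC₂, h2⟩ := ht.two hps
  set δ := (s - α₂) / 2 with hδ
  have hδ0 : 0 < δ := by rw [hδ]; linarith
  set ε := min δ 1 / 2 with hε
  have hε0 : 0 < ε := by rw [hε]; positivity
  have hε1 : ε ≤ 1 / 2 := by rw [hε]; have := min_le_right δ 1; linarith
  have hε2 : ε ≤ δ / 2 := by rw [hε]; have := min_le_left δ 1; linarith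
  set Zδ := ∑' m : ℕ, pw (-(δ * m)) with hZδ
  have hZδt : Zδ ≠ ∞ := pw_geom hδ0
  -- pointwise
  have hpt : ∀ (l : ℕ) (a : ℕ → ℝ≥0∞), ∑ k ∈ Finset.range (l + 1), pw (-(s * (l - k))) * a k ≤
      Zδ * ⨆ k : Fin (l + 1), pw (-((s - δ) * (l - k.1))) * a k.1 := by
    intro l a
    refine le_trans (Finset.sum_le_sum fun k hk => ?_) (le_trans (le_of_eq (Finset.sum_mul _ _ _).symm)
      (mul_le_mul' (sum_refl l δ) le_rfl))
    have e : pw (-(s * (l - k))) * a k = pw (-(δ * (l - k))) * (pw (-((s - δ) * (l - k))) * a k) := by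
      rw [← mul_assoc, ← pw_add]; congr 2; ring
    rw [e]
    exact mul_le_mul' le_rfl (le_iSup (fun k : Fin (l + 1) => pw (-((s - δ) * (l - k.1))) * a k.1)
      ⟨k, Finset.mem_range.1 hk⟩)
  by_cases hp' : p = ∞
  · refine ⟨Zδ * C₂, ε, ENNReal.mul_ne_top hZδt hC₂, hε0, fun Fr Or K₁ hOr l => ?_⟩
    have hae : ∀ k : Fin (l + 1), ∀ᵐ x : Fin n → ℝ, ‖t l x‖ₑ ≤ C₂ * pw (α₂ * (l - k.1)) * tkm n p t k.1 (ix k.1 x) := by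
      intro k
      have h3 : ∀ μ : Fin n → ℤ, ∀ᵐ x : Fin n → ℝ, x ∈ hcube k.1 μ → ‖t l x‖ₑ ≤ C₂ * pw (α₂ * (l - k.1)) * tkm n p t k.1 μ := by
        intro μ
        rw [← ae_restrict_iff' (hcube_meas _ _)]
        have h4 := (eLpNorm_mono_measure (p := p) (t l) (Measure.restrict_mono (hcube_sub k.1 μ)
          (le_refl (volume : Measure (Fin n → ℝ))))).trans (h2 k.1 l (Nat.lt_succ_iff.1 k.2) μ)
        rw [hp', eLpNorm_exponent_top] at h4
        filter_upwards [ae_le_eLpNormEssSup (f := t l) (μ := volume.restrict (hcube k.1 μ))] with x hx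
        rw [hp']
        exact hx.trans h4
      filter_upwards [ae_all_iff.2 h3] with x hx
      exact hx (ix k.1 x) rfl
    change eLpNorm (fun x => t l x * Or l x) p volume ≤ _
    generalize hRR : RR (NN p t Fr) ε l = R
    rw [hp', eLpNorm_exponent_top]
    refine eLpNormEssSup_le_of_ae_enorm_bound ?_
    filter_upwards [ae_all_iff.2 hae] with x hx
    rw [enorm_mul]
    refine (mul_le_mul' le_rfl ((hOr l x).trans (mul_le_mul' le_rfl (hpt l _)))).trans ?_
    rw [← hRR]
    have h5 : (⨆ k : Fin (l + 1), pw (-((s - δ) * (l - k.1))) * Sd p t Fr k.1 x) * ‖t l x‖ₑ ≤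
        C₂ * RR (NN p t Fr) ε l := by
      rw [ENNReal.iSup_mul]
      refine iSup_le fun k => ?_
      have hk : k.1 ≤ l := Nat.lt_succ_iff.1 k.2
      have hkl : (0 : ℝ) ≤ l - k.1 := by
        have : (k.1 : ℝ) ≤ l := by exact_mod_cast hk
        linarith
      have h6 : SS p t Fr k.1 (ix k.1 x) ≤ pw (ε * (l - k.1)) * RR (NN p t Fr) ε l := by
        refine SS_le t Fr _ _ fun i => ?_
        refine (mul_le_mul' le_rfl (le_RR (NN p t Fr) ε hk i)).trans ?_
        rw [← mul_assoc, ← pw_add]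
        refine mul_le_mul' (pw_mono ?_) le_rfl
        have : ε * i ≤ 1 * i := by gcongr; linarith
        linarith
      calc _ ≤ pw (-((s - δ) * (l - k.1))) * ((pw (ε * (l - k.1)) * RR (NN p t Fr) ε l) *
            (tkm n p t k.1 (ix k.1 x))⁻¹) * (C₂ * pw (α₂ * (l - k.1)) * tkm n p t k.1 (ix k.1 x)) := by
            unfold Sd; gcongr; exact hx k
        _ = C₂ * (pw (-((s - δ) * (l - k.1))) * pw (ε * (l - k.1)) * pw (α₂ * (l - k.1)) * RR (NN p t Fr) ε l) *
            ((tkm n p t k.1 (ix k.1 x))⁻¹ * tkm n p t k.1 (ix k.1 x)) := by ring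
        _ = C₂ * (pw (-((δ - ε) * (l - k.1))) * RR (NN p t Fr) ε l) := by
            rw [ENNReal.inv_mul_cancel (ht.pos _ _) (ht.fin _ _), mul_one, ← pw_add, ← pw_add]
            have e : s = α₂ + 2 * δ := by rw [hδ]; ring
            have e' : -((s - δ) * ((l : ℝ) - k.1)) + ε * (l - k.1) + α₂ * (l - k.1) = -((δ - ε) * (l - k.1)) := by
              rw [e]; ring
            rw [e']
        _ ≤ C₂ * (1 * RR (NN p t Fr) ε l) := by
            gcongr
            rw [← pw_zero]
            apply pw_mono
            have : 0 ≤ (δ - ε) * (l - k.1) := mul_nonneg (by linarith) hkl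
            linarith
        _ = _ := by rw [one_mul]
    calc _ = K₁ * Zδ * ((⨆ k : Fin (l + 1), pw (-((s - δ) * (l - k.1))) * Sd p t Fr k.1 x) * ‖t l x‖ₑ) := by ring
      _ ≤ K₁ * Zδ * (C₂ * RR (NN p t Fr) ε l) := by gcongr
      _ = _ := by ring
  · have hpr := ENNReal.toReal_pos hp.ne' hp'
    set P := p.toReal with hP
    set Z := ∑' ν : Fin n → ℤ, pw (-(P * ‖ν‖)) with hZ
    have hZt : Z ≠ ∞ := sumZ hpr
    set Y := ∑' i : ℕ, pw (-((P * ε) * i)) with hY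
    have hYt : Y ≠ ∞ := pw_geom (by positivity)
    refine ⟨Zδ * C₂ * (Y * Z * Y) ^ (1 / P), ε, ENNReal.mul_ne_top (ENNReal.mul_ne_top hZδt hC₂)
      (ENNReal.rpow_ne_top_of_nonneg (by positivity) (ENNReal.mul_ne_top (ENNReal.mul_ne_top hYt hZt) hYt)), hε0,
      fun Fr Or K₁ hOr l => ?_⟩
    set R := RR (NN p t Fr) ε l with hR
    unfold NN
    rw [eLpNorm_eq_lintegral_rpow_enorm_toReal hp.ne' hp', ← hP, one_div, ENNReal.rpow_inv_le_iff hpr]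
    have hSd : ∀ k, k ≤ l → ∫⁻ x, (‖t l x‖ₑ * Sd p t Fr k x) ^ P ≤
        C₂ ^ P * pw (P * (α₂ + ε) * (l - k)) * (Z * Y) * R ^ P := by
      intro k hk
      rw [lint_cubes k]
      have e1 : ∀ μ, ∫⁻ x in hcube k μ, (‖t l x‖ₑ * Sd p t Fr k x) ^ P ≤
          (C₂ * pw (α₂ * (l - k))) ^ P * SS p t Fr k μ ^ P := by
        intro μ
        have hT0 := ht.pos k μ
        have hTt := ht.fin k μ
        have e2 : ∫⁻ x in hcube k μ, (‖t l x‖ₑ * Sd p t Fr k x) ^ P =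
            (∫⁻ x in hcube k μ, ‖t l x‖ₑ ^ P) * (SS p t Fr k μ * (tkm n p t k μ)⁻¹) ^ P := by
          rw [← lintegral_mul_const _ ((ht.1.1 l).enorm.pow_const _)]
          refine setLIntegral_congr_fun (hcube_meas k μ) fun x hx => ?_
          have hx' : ix k x = μ := hx
          simp only [Sd, hx']
          rw [ENNReal.mul_rpow_of_nonneg _ _ hpr.le]
        have e3 := (eLpNorm_mono_measure (p := p) (t l) (Measure.restrict_mono (hcube_sub k μ)
          (le_refl (volume : Measure (Fin n → ℝ))))).trans (h2 k l hk μ)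
        rw [eLpNorm_eq_lintegral_rpow_enorm_toReal hp.ne' hp', ← hP, one_div, ENNReal.rpow_inv_le_iff hpr] at e3
        rw [e2]
        refine (mul_le_mul' e3 le_rfl).trans (le_of_eq ?_)
        rw [← ENNReal.mul_rpow_of_nonneg _ _ hpr.le, ← ENNReal.mul_rpow_of_nonneg _ _ hpr.le]
        congr 1
        calc _ = C₂ * pw (α₂ * (l - k)) * SS p t Fr k μ * (tkm n p t k μ * (tkm n p t k μ)⁻¹) := by ring
          _ = _ := by rw [ENNReal.mul_inv_cancel hT0 hTt, mul_one]
      refine (ENNReal.tsum_le_tsum e1).trans ?_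
      rw [ENNReal.tsum_mul_left]
      refine (mul_le_mul' le_rfl (SS_sum hp hp' t Fr k)).trans ?_
      rw [← hP, ← hZ]
      have e4 : ∑' i : ℕ, pw (-(P * i)) * NN p t Fr (k + i) ^ P ≤ pw (P * ε * (l - k)) * Y * R ^ P := by
        rw [hY, ← ENNReal.tsum_mul_left, ← ENNReal.tsum_mul_right]
        refine ENNReal.tsum_le_tsum fun i => ?_
        refine (mul_le_mul' le_rfl (ENNReal.rpow_le_rpow (le_RR (NN p t Fr) ε hk i) hpr.le)).trans ?_
        rw [ENNReal.mul_rpow_of_nonneg _ _ hpr.le, pw_rpow, ← mul_assoc, ← pw_add, ← pw_add]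
        refine mul_le_mul' (pw_mono ?_) le_rfl
        have : P * (2 * ε) * i ≤ P * 1 * i := by gcongr; linarith
        linarith
      refine (mul_le_mul' le_rfl (mul_le_mul' le_rfl e4)).trans (le_of_eq ?_)
      rw [ENNReal.mul_rpow_of_nonneg _ _ hpr.le, pw_rpow,
        show P * (α₂ + ε) * (l - k) = α₂ * (l - k) * P + P * ε * (l - k) by ring, pw_add]
      ring
    have hpt2 : ∀ x, ‖t l x * Or l x‖ₑ ^ P ≤ (K₁ * Zδ) ^ P * ∑ k ∈ Finset.range (l + 1),
        pw (-(P * (s - δ) * (l - k))) * (‖t l x‖ₑ * Sd p t Fr k x) ^ P := by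
      intro x
      have e1 : ‖t l x * Or l x‖ₑ ≤ (K₁ * Zδ) *
          ⨆ k : Fin (l + 1), pw (-((s - δ) * (l - k.1))) * (‖t l x‖ₑ * Sd p t Fr k.1 x) := by
        rw [enorm_mul]
        refine (mul_le_mul' le_rfl ((hOr l x).trans (mul_le_mul' le_rfl (hpt l _)))).trans (le_of_eq ?_)
        simp_rw [mul_left_comm _ (‖t l x‖ₑ) _]
        rw [← ENNReal.mul_iSup]
        ring
      refine (ENNReal.rpow_le_rpow e1 hpr.le).trans ?_
      rw [ENNReal.mul_rpow_of_nonneg _ _ hpr.le]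
      refine mul_le_mul' le_rfl ?_
      refine (iSup_rpow_le_tsum _ hpr).trans ?_
      rw [tsum_fintype, Finset.sum_range]
      refine Finset.sum_le_sum fun k _ => ?_
      rw [ENNReal.mul_rpow_of_nonneg _ _ hpr.le, pw_rpow]
      apply le_of_eq; congr 2; ring
    refine (lintegral_mono hpt2).trans ?_
    have hmeas : ∀ k, Measurable fun x => (‖t l x‖ₑ * Sd p t Fr k x) ^ P := by
      intro k
      refine ((ht.1.1 l).enorm.mul ?_).pow_const _
      exact (measurable_of_countable (fun μ : Fin n → ℤ => SS p t Fr k μ * (tkm n p t k μ)⁻¹)).comp (ix_meas k)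
    rw [lintegral_const_mul _ (Finset.measurable_sum _ fun k _ => (hmeas k).const_mul _),
      lintegral_finsetSum _ (fun k _ => (hmeas k).const_mul _)]
    have e5 : ∑ k ∈ Finset.range (l + 1), ∫⁻ x, pw (-(P * (s - δ) * (l - k))) * (‖t l x‖ₑ * Sd p t Fr k x) ^ P ≤
        ∑ k ∈ Finset.range (l + 1), pw (-((P * ε) * (l - k))) * (C₂ ^ P * (Z * Y) * R ^ P) := by
      refine Finset.sum_le_sum fun k hk => ?_
      have hk' : k ≤ l := by rw [Finset.mem_range] at hk; omega
      have hkl : (0 : ℝ) ≤ l - k := by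
        have : (k : ℝ) ≤ l := by exact_mod_cast hk'
        linarith
      rw [lintegral_const_mul _ (hmeas k)]
      refine (mul_le_mul' le_rfl (hSd k hk')).trans ?_
      calc _ = (pw (-(P * (s - δ) * (l - k))) * pw (P * (α₂ + ε) * (l - k))) * (C₂ ^ P * (Z * Y) * R ^ P) := by
            ring
        _ ≤ _ := by
            rw [← pw_add]
            refine mul_le_mul' (pw_mono ?_) le_rfl
            have : 0 ≤ P * (δ - 2 * ε) * (l - k) := mul_nonneg (mul_nonneg hpr.le (by linarith)) hkl
            have e : s = α₂ + 2 * δ := by rw [hδ]; ring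
            rw [e]
            linarith
    refine (mul_le_mul' le_rfl e5).trans ?_
    rw [← Finset.sum_mul]
    refine (mul_le_mul' le_rfl (mul_le_mul' (sum_refl l (P * ε)) le_rfl)).trans (le_of_eq ?_)
    rw [← hY, ENNReal.mul_rpow_of_nonneg _ _ hpr.le, ENNReal.mul_rpow_of_nonneg _ _ hpr.le,
      ENNReal.mul_rpow_of_nonneg _ _ hpr.le, ENNReal.mul_rpow_of_nonneg _ _ hpr.le,
      ENNReal.mul_rpow_of_nonneg _ _ hpr.le, ← ENNReal.rpow_mul (Y * Z * Y), inv_mul_cancel₀ hpr.ne',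
      ENNReal.rpow_one]
    ring

end weights

/-! ### Part 11: the extension operator -/

section ext
variable {n : ℕ} {φ₀ : (Fin n → ℝ) → ℝ} {c I : ℝ}

/-- total size of the pairing series -/
def QQ (D : KD φ₀ c I) (h : ℕ) (F : ℕ → (Fin n → ℝ) → ℝ) (θ : Sm n) : ℝ≥0∞ :=
  ∑' k, ∫⁻ y, ‖(gPsi (So D.test) h k θ).1 y * F k y‖ₑ

theorem QQ_int (D : KD φ₀ c I) (h : ℕ) {F : ℕ → (Fin n → ℝ) → ℝ} (hF : ∀ k, Measurable (F k)) {θ : Sm n}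
    (hθ : QQ D h F θ ≠ ∞) (k : ℕ) : Integrable fun y => (gPsi (So D.test) h k θ).1 y * F k y := by
  refine ⟨((Sm_cd _).continuous.measurable.mul (hF k)).aestronglyMeasurable, ?_⟩
  exact lt_of_le_of_lt (ENNReal.le_tsum (f := fun k => ∫⁻ y, ‖(gPsi (So D.test) h k θ).1 y * F k y‖ₑ) k)
    hθ.lt_top

theorem QQ_sum (D : KD φ₀ c I) (h : ℕ) {F : ℕ → (Fin n → ℝ) → ℝ} {θ : Sm n}
    (hθ : QQ D h F θ ≠ ∞) : Summable fun k => ∫ y, (gPsi (So D.test) h k θ).1 y * F k y := by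
  apply Summable.of_enorm
  refine ne_top_of_le_ne_top hθ (ENNReal.tsum_le_tsum fun k => enorm_integral_le_lintegral_enorm _)

/-- functions with convergent pairing series -/
def VV (D : KD φ₀ c I) (h : ℕ) (F : ℕ → (Fin n → ℝ) → ℝ) (hF : ∀ k, Measurable (F k)) :
    Submodule ℝ (Sm n) where
  carrier := {θ | QQ D h F θ ≠ ∞}
  zero_mem' := by
    change QQ D h F 0 ≠ ∞
    simp [QQ]
  add_mem' := by
    intro a b ha hb
    change QQ D h F a ≠ ∞ at ha
    change QQ D h F b ≠ ∞ at hb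
    change QQ D h F (a + b) ≠ ∞
    refine ne_top_of_le_ne_top (ENNReal.add_ne_top.2 ⟨ha, hb⟩) ?_
    unfold QQ
    rw [← ENNReal.tsum_add]
    refine ENNReal.tsum_le_tsum fun k => ?_
    have hm : Measurable fun y => ‖(gPsi (So D.test) h k a).1 y * F k y‖ₑ :=
      ((Sm_cd (gPsi (So D.test) h k a)).continuous.measurable.mul (hF k)).enorm
    rw [← lintegral_add_left hm]
    refine lintegral_mono fun y => ?_
    rw [map_add]
    refine le_trans (le_of_eq ?_) (enorm_add_le _ _)
    rw [Submodule.coe_add, Pi.add_apply, add_mul]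
  smul_mem' := by
    intro r a ha
    change QQ D h F a ≠ ∞ at ha
    change QQ D h F (r • a) ≠ ∞
    refine ne_top_of_le_ne_top (ENNReal.mul_ne_top (enorm_ne_top (x := r)) ha) ?_
    unfold QQ
    rw [← ENNReal.tsum_mul_left]
    refine ENNReal.tsum_le_tsum fun k => ?_
    rw [← lintegral_const_mul' _ _ enorm_ne_top]
    refine lintegral_mono fun y => ?_
    rw [map_smul, Submodule.coe_smul, Pi.smul_apply, smul_eq_mul, mul_assoc, enorm_mul]

theorem VV_iff (D : KD φ₀ c I) (h : ℕ) (F : ℕ → (Fin n → ℝ) → ℝ) (hF : ∀ k, Measurable (F k)) (θ : Sm n) :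
    θ ∈ VV D h F hF ↔ QQ D h F θ ≠ ∞ := Iff.rfl

/-- The functional on `VV`. -/
def E0 (D : KD φ₀ c I) (h : ℕ) (F : ℕ → (Fin n → ℝ) → ℝ) (hF : ∀ k, Measurable (F k)) :
    VV D h F hF →ₗ[ℝ] ℝ where
  toFun θ := ∑' k, ∫ y, (gPsi (So D.test) h k θ.1).1 y * F k y
  map_add' a b := by
    rw [← (QQ_sum D h a.2).tsum_add (QQ_sum D h b.2)]
    refine tsum_congr fun k => ?_
    rw [← integral_add (QQ_int D h hF a.2 k) (QQ_int D h hF b.2 k)]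
    refine integral_congr_ae (Eventually.of_forall fun y => ?_)
    simp only [Submodule.coe_add, map_add, Pi.add_apply, add_mul]
  map_smul' r a := by
    rw [RingHom.id_apply, smul_eq_mul, ← tsum_mul_left]
    refine tsum_congr fun k => ?_
    rw [← integral_const_mul]
    refine integral_congr_ae (Eventually.of_forall fun y => ?_)
    simp only [Submodule.coe_smul, map_smul, Pi.smul_apply, smul_eq_mul, mul_assoc]

theorem exists_E (D : KD φ₀ c I) (h : ℕ) (F : ℕ → (Fin n → ℝ) → ℝ) (hF : ∀ k, Measurable (F k)) :
    ∃ E : Dstrb n, ∀ θ : Sm n, QQ D h F θ ≠ ∞ →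
      HasSum (fun k => ∫ y, (gPsi (So D.test) h k θ).1 y * F k y) (E θ.1) := by
  obtain ⟨E1, h1⟩ := LinearMap.exists_extend (E0 D h F hF)
  obtain ⟨E, h2⟩ := LinearMap.exists_extend E1
  refine ⟨E, fun θ hθ => ?_⟩
  have e1 : E θ.1 = E1 θ := congrArg (fun T => T θ) h2
  have e2 : E1 θ = E0 D h F hF ⟨θ, hθ⟩ := congrArg (fun T => T ⟨θ, hθ⟩) h1
  rw [e1, e2]
  exact (QQ_sum D h hθ).hasSum

theorem E_le_QQ {D : KD φ₀ c I} {h : ℕ} {F : ℕ → (Fin n → ℝ) → ℝ} {E : Dstrb n}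
    (hE : ∀ θ : Sm n, QQ D h F θ ≠ ∞ →
      HasSum (fun k => ∫ y, (gPsi (So D.test) h k θ).1 y * F k y) (E θ.1)) (θ : Sm n) :
    ‖E θ.1‖ₑ ≤ QQ D h F θ := by
  by_cases hθ : QQ D h F θ = ∞
  · rw [hθ]; exact le_top
  refine le_of_tendsto (hE θ hθ).tendsto_sum_nat.enorm (Eventually.of_forall fun J => ?_)
  refine (enorm_sum_le _ _).trans ?_
  exact le_trans (Finset.sum_le_sum fun i _ => enorm_integral_le_lintegral_enorm _)
    (ENNReal.sum_le_tsum (Finset.range J))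

theorem exp_int {N : ℕ} {a : ℝ} (ha : 0 ≤ a) (hN : a + n + 1 ≤ N) :
    ∫⁻ y : Fin n → ℝ, ENNReal.ofReal (Real.exp (-(N * ‖y‖))) * pw (a * ‖y‖) ≠ ∞ := by
  have h1 := finite_integral_one_add_norm (E := Fin n → ℝ) (μ := volume) (r := n + 1) (by simp)
  refine ne_top_of_le_ne_top h1.ne (lintegral_mono fun y => ?_)
  rw [pw, ← ENNReal.ofReal_mul (by positivity)]
  refine ENNReal.ofReal_le_ofReal ?_
  have h2 : (2 : ℝ) ^ (a * ‖y‖) ≤ Real.exp (a * ‖y‖) := by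
    rw [← Real.exp_one_rpow]
    refine Real.rpow_le_rpow (by norm_num) ?_ (by positivity)
    have := Real.add_one_le_exp (1 : ℝ); linarith
  have h3 : (1 + ‖y‖) ≤ Real.exp ‖y‖ := by have := Real.add_one_le_exp ‖y‖; linarith
  calc Real.exp (-(N * ‖y‖)) * 2 ^ (a * ‖y‖) ≤ Real.exp (-(N * ‖y‖)) * Real.exp (a * ‖y‖) := by gcongr
    _ ≤ Real.exp (‖y‖ * (-(n + 1))) := by
        rw [← Real.exp_add]
        refine Real.exp_le_exp.2 ?_
        nlinarith [norm_nonneg y]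
    _ = Real.exp ‖y‖ ^ (-((n : ℝ) + 1)) := Real.exp_mul _ _
    _ ≤ _ := by
        have h5 : (0:ℝ) ≤ n := Nat.cast_nonneg n
        exact Real.rpow_le_rpow_of_nonpos (by positivity) h3 (by linarith)

theorem se_bound {N : ℕ} {θ : (Fin n → ℝ) → ℝ} (hZ : seSeminorm n N θ ≠ ∞) {j : ℕ} (hj : j ≤ N)
    (x : Fin n → ℝ) : ‖iteratedFDeriv ℝ j θ x‖ ≤ (seSeminorm n N θ).toReal * Real.exp (-(N * ‖x‖)) := by
  have h1 : ENNReal.ofReal (Real.exp (N * ‖x‖) * ∑ i ∈ Finset.range (N + 1), ‖iteratedFDeriv ℝ i θ x‖) ≤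
      seSeminorm n N θ := le_iSup (fun x : Fin n → ℝ => ENNReal.ofReal
    (Real.exp (N * ‖x‖) * ∑ i ∈ Finset.range (N + 1), ‖iteratedFDeriv ℝ i θ x‖)) x
  rw [ENNReal.ofReal_le_iff_le_toReal hZ] at h1
  have h2 : ‖iteratedFDeriv ℝ j θ x‖ ≤ ∑ i ∈ Finset.range (N + 1), ‖iteratedFDeriv ℝ i θ x‖ :=
    Finset.single_le_sum (f := fun i => ‖iteratedFDeriv ℝ i θ x‖) (fun _ _ => norm_nonneg _)
      (Finset.mem_range.2 (by omega))
  rw [Real.exp_neg, ← div_eq_mul_inv, le_div_iff₀ (Real.exp_pos _), mul_comm]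
  refine le_trans ?_ h1
  gcongr

theorem QQ_bound (D : KD φ₀ c I) {h N : ℕ} {F : ℕ → (Fin n → ℝ) → ℝ} {A a : ℝ} (ha : 0 ≤ a)
    (hA : A + 1 ≤ h) (hN : a + n + 1 ≤ N) (hhN : h ≤ N) {C : ℝ≥0∞} (hC : C ≠ ∞)
    (hF : ∀ k y, ‖F k y‖ₑ ≤ C * pw (A * k + a * ‖y‖)) :
    ∃ K : ℝ, 0 < K ∧ ∀ θ : Sm n, QQ D h F θ ≤ ENNReal.ofReal K * seSeminorm n N θ.1 := by
  obtain ⟨C1, hC1, hb⟩ := D.Psi0 h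
  obtain ⟨C2, hC2, hb'⟩ := D.Psih h
  set R := cR h c with hR
  have hR0 : 0 ≤ R := by have := D.hc0; rw [hR]; unfold cR; positivity
  set C3 := (C1 + C2) * Real.exp (N * R) with hC3
  set J := ∫⁻ y : Fin n → ℝ, ENNReal.ofReal (Real.exp (-(N * ‖y‖))) * pw (a * ‖y‖) with hJ
  have hJt : J ≠ ∞ := exp_int ha hN
  set Z := ∑' m : ℕ, pw (-(1 * m)) with hZ
  have hZt : Z ≠ ∞ := pw_geom one_pos
  set K := ENNReal.ofReal C3 * C * Z * J with hK
  have hKt : K ≠ ∞ := by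
    rw [hK]
    exact ENNReal.mul_ne_top (ENNReal.mul_ne_top (ENNReal.mul_ne_top ENNReal.ofReal_ne_top hC) hZt) hJt
  refine ⟨K.toReal + 1, by positivity, fun θ => ?_⟩
  by_cases hS : seSeminorm n N θ.1 = ∞
  · rw [hS, ENNReal.mul_top]
    · exact le_top
    · simp only [ne_eq, ENNReal.ofReal_eq_zero, not_le]; positivity
  set S := (seSeminorm n N θ.1).toReal with hSd
  have hS0 : 0 ≤ S := ENNReal.toReal_nonneg
  have hder : ∀ j, j ≤ N → ∀ (k : ℕ) (y z : Fin n → ℝ), ‖z - y‖ ≤ R / 2 ^ k →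
      ‖iteratedFDeriv ℝ j θ.1 z‖ ≤ S * Real.exp (N * R) * Real.exp (-(N * ‖y‖)) := by
    intro j hj k y z hz
    refine (se_bound hS hj z).trans ?_
    rw [mul_assoc, ← Real.exp_add]
    gcongr
    have h1 : R / 2 ^ k ≤ R := div_le_self hR0 (one_le_pow₀ (by norm_num))
    have h2 : ‖y‖ ≤ ‖z‖ + R := by
      have := norm_sub_norm_le y z
      rw [norm_sub_rev] at this
      linarith
    have : (N:ℝ) * ‖y‖ ≤ N * (‖z‖ + R) := by gcongr
    linarith
  have hpt : ∀ k y, |(gPsi (So D.test) h k θ).1 y| ≤ C3 * S * Real.exp (-(N * ‖y‖)) * (2:ℝ) ^ (-(h * k : ℝ)) := by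
    intro k y
    cases k with
    | zero =>
      refine ((hb 0).pt θ y (hder 0 (Nat.zero_le _) 0 y)).trans ?_
      rw [hC3]
      simp only [Nat.cast_zero, mul_zero, neg_zero, Real.rpow_zero, mul_one]
      have : 0 ≤ C2 * (S * Real.exp (N * R) * Real.exp (-(N * ‖y‖))) := by positivity
      linarith
    | succ k =>
      refine ((hb' k).pt θ y (hder h hhN (k+1) y)).trans ?_
      have e : (2:ℝ) ^ (-((h:ℝ) * (k+1 : ℕ))) = ((2 ^ (k+1)) ^ h)⁻¹ := by
        rw [Real.rpow_neg (by norm_num), ← Nat.cast_mul, Real.rpow_natCast, mul_comm, pow_mul]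
      rw [e, hC3, div_eq_mul_inv]
      have : 0 ≤ C1 * (S * Real.exp (N * R) * Real.exp (-(N * ‖y‖))) * ((2 ^ (k+1)) ^ h)⁻¹ := by positivity
      linarith
  have hterm : ∀ k, ∫⁻ y, ‖(gPsi (So D.test) h k θ).1 y * F k y‖ₑ ≤
      ENNReal.ofReal C3 * ENNReal.ofReal S * C * J * pw (-(1 * k)) := by
    intro k
    have e1 : ENNReal.ofReal C3 * ENNReal.ofReal S * C * J * pw (-(1 * k)) =
        ∫⁻ y : Fin n → ℝ, (ENNReal.ofReal C3 * ENNReal.ofReal S * C * pw (-(1 * k))) *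
          (ENNReal.ofReal (Real.exp (-(N * ‖y‖))) * pw (a * ‖y‖)) := by
      rw [lintegral_const_mul']
      · rw [hJ]; ring
      · exact ENNReal.mul_ne_top (ENNReal.mul_ne_top (ENNReal.mul_ne_top ENNReal.ofReal_ne_top
          ENNReal.ofReal_ne_top) hC) (pw_ne_top _)
    rw [e1]
    refine lintegral_mono fun y => ?_
    rw [enorm_mul, Real.enorm_eq_ofReal_abs]
    calc _ ≤ ENNReal.ofReal (C3 * S * Real.exp (-(N * ‖y‖)) * (2:ℝ) ^ (-(h * k : ℝ))) *
          (C * pw (A * k + a * ‖y‖)) := mul_le_mul' (ENNReal.ofReal_le_ofReal (hpt k y)) (hF k y)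
      _ = ENNReal.ofReal C3 * ENNReal.ofReal S * C * ENNReal.ofReal (Real.exp (-(N * ‖y‖))) *
          (pw (-(h * k) + A * k + a * ‖y‖)) := by
          have : 0 ≤ C3 := by rw [hC3]; positivity
          rw [ENNReal.ofReal_mul (by positivity), ENNReal.ofReal_mul (by positivity),
            ENNReal.ofReal_mul (by positivity), add_assoc, pw_add (-(h * k))]
          change _ * pw (-(h * k)) * _ = _
          ring
      _ ≤ ENNReal.ofReal C3 * ENNReal.ofReal S * C * ENNReal.ofReal (Real.exp (-(N * ‖y‖))) *
          (pw (-(1 * k) + a * ‖y‖)) := by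
          gcongr
          apply pw_mono
          have : (A + 1) * k ≤ h * (k:ℝ) := by gcongr
          linarith
      _ = _ := by rw [pw_add]; ring
  calc QQ D h F θ ≤ ∑' k : ℕ, ENNReal.ofReal C3 * ENNReal.ofReal S * C * J * pw (-(1 * k)) :=
        ENNReal.tsum_le_tsum hterm
    _ = K * ENNReal.ofReal S := by rw [ENNReal.tsum_mul_left, hK, hZ]; ring
    _ = K * seSeminorm n N θ.1 := by rw [hSd, ENNReal.ofReal_toReal hS]
    _ ≤ _ := by
        gcongr
        rw [ENNReal.le_ofReal_iff_toReal_le hKt (by positivity)]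
        linarith

theorem se_test {θ : (Fin n → ℝ) → ℝ} (hθ : IsTestFun n θ) (N : ℕ) : seSeminorm n N θ ≠ ∞ := by
  have hc : Continuous fun x : Fin n → ℝ =>
      Real.exp (N * ‖x‖) * ∑ i ∈ Finset.range (N + 1), ‖iteratedFDeriv ℝ i θ x‖ := by
    refine Continuous.mul (by fun_prop) (continuous_finsetSum _ fun i _ => ?_)
    exact (hθ.1.continuous_iteratedFDeriv (by exact_mod_cast le_top)).norm
  have hs : HasCompactSupport fun x : Fin n → ℝ =>
      Real.exp (N * ‖x‖) * ∑ i ∈ Finset.range (N + 1), ‖iteratedFDeriv ℝ i θ x‖ := by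
    refine HasCompactSupport.intro hθ.2.isCompact (fun x hx => ?_)
    rw [Finset.sum_eq_zero, mul_zero]
    intro i _
    rw [norm_eq_zero]
    exact image_eq_zero_of_notMem_tsupport (fun hx' => hx (tsupport_iteratedFDeriv_subset i hx'))
  obtain ⟨B, hB⟩ := hs.exists_bound_of_continuous hc
  refine ne_top_of_le_ne_top (ENNReal.ofReal_ne_top (r := B)) (iSup_le fun x => ?_)
  exact ENNReal.ofReal_le_ofReal ((le_abs_self _).trans (hB x))

theorem E_OB (D : KD φ₀ c I) (h : ℕ) {L : ℤ} (hL : -1 ≤ L)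
    (hm : MomentsVanish n L (phiOf n φ₀)) {s : ℕ} (hs : (s : ℤ) = L + 1) :
    ∃ C : ℝ≥0∞, C ≠ ∞ ∧ ∀ F : ℕ → (Fin n → ℝ) → ℝ,
      OB (eF F) (fun l x => QQ D h F (eta D.test l x)) h s C (cR h c + 2 * c) := by
  obtain ⟨C1, hC1, hlo⟩ := D.kern_lo h hL hm hs
  obtain ⟨C2, hC2, hhi⟩ := D.kern_hi h
  refine ⟨ENNReal.ofReal (C1 + C2), ENNReal.ofReal_ne_top, fun F l x => ?_⟩
  have hQ : QQ D h F (eta D.test l x) = (∑ k ∈ Finset.range l,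
      ∫⁻ y, ‖(gPsi (So D.test) h k (eta D.test l x)).1 y * F k y‖ₑ) +
      ∑' i, ∫⁻ y, ‖(gPsi (So D.test) h (i + l) (eta D.test l x)).1 y * F (i + l) y‖ₑ :=
    (Summable.sum_add_tsum_nat_add' (f := fun k =>
      ∫⁻ y, ‖(gPsi (So D.test) h k (eta D.test l x)).1 y * F k y‖ₑ) (k := l) ENNReal.summable).symm
  refine le_trans (le_of_eq hQ) ?_
  refine add_le_add ?_ ?_
  · rw [Finset.mul_sum]
    refine Finset.sum_le_sum fun k hk => ?_
    have hkl : k < l := Finset.mem_range.1 hk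
    refine (lint_ker (fun y => hlo k l x y hkl) (fun y hy => D.kern_supp h k l x y hy)).trans ?_
    rw [min_eq_left hkl.le, ← mul_assoc]
    refine mul_le_mul' ?_ le_rfl
    rw [pw, ← ENNReal.ofReal_mul (by positivity)]
    refine ENNReal.ofReal_le_ofReal ?_
    have e : (2:ℝ) ^ ((k:ℝ) * n - (l - k) * s) = 2 ^ (k * n) * (2 ^ k / 2 ^ l) ^ s := by
      rw [← Real.rpow_natCast 2 (k * n), ← Real.rpow_natCast 2 k, ← Real.rpow_natCast 2 l,
        ← Real.rpow_sub (by norm_num), ← Real.rpow_mul_natCast (by norm_num), ← Real.rpow_add (by norm_num)]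
      congr 1; push_cast; ring
    rw [e, mul_assoc]
    gcongr; linarith
  · rw [← ENNReal.tsum_mul_left]
    refine ENNReal.tsum_le_tsum fun i => ?_
    rw [add_comm i l]
    refine (lint_ker (fun y => hhi (l + i) l x y (by omega)) (fun y hy => D.kern_supp h (l+i) l x y hy)).trans ?_
    rw [min_eq_right (by omega), ← mul_assoc]
    refine mul_le_mul' ?_ le_rfl
    rw [pw, ← ENNReal.ofReal_mul (by positivity)]
    refine ENNReal.ofReal_le_ofReal ?_
    have e : (2:ℝ) ^ ((l:ℝ) * n - i * h) = 2 ^ (l * n) * (2 ^ l / 2 ^ (l + i)) ^ h := by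
      rw [← Real.rpow_natCast 2 (l * n), ← Real.rpow_natCast 2 l, ← Real.rpow_natCast 2 (l + i),
        ← Real.rpow_sub (by norm_num), ← Real.rpow_mul_natCast (by norm_num), ← Real.rpow_add (by norm_num)]
      congr 1; push_cast; ring
    rw [e, mul_assoc]
    gcongr; linarith

end ext

/-! ### Part 12: Lipschitz domains and conclusion -/

theorem sqNorm_smul (d : ℕ) {r : ℝ} (hr : 0 ≤ r) (y : Fin d → ℝ) :
    sqNorm d (fun i => r * y i) = r * sqNorm d y := by
  unfold sqNorm
  simp_rw [mul_pow]
  rw [← Finset.mul_sum, Real.sqrt_mul (by positivity), Real.sqrt_sq hr]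

theorem Lip_cont {d : ℕ} {M : ℝ} {ϖ : (Fin d → ℝ) → ℝ} (hϖ : IsLipFun d M ϖ) : Continuous ϖ := by
  rw [continuous_iff_continuousAt]
  intro z
  rw [ContinuousAt, tendsto_iff_dist_tendsto_zero]
  have h1 : Continuous fun y : Fin d → ℝ => M * sqNorm d (fun i => y i - z i) := by
    unfold sqNorm; fun_prop
  have h2 := h1.tendsto z
  have h3 : M * sqNorm d (fun i => z i - z i) = 0 := by simp [sqNorm]
  rw [h3] at h2
  refine squeeze_zero (fun _ => dist_nonneg) (fun y => ?_) h2
  rw [Real.dist_eq]; exact hϖ y z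

theorem specialLip_DomK {d : ℕ} {M : ℝ} {ϖ : (Fin d → ℝ) → ℝ} (hϖ : IsLipFun d M ϖ)
    {φ₀ : (Fin (d + 1) → ℝ) → ℝ} (hs : tsupport φ₀ ⊆ negConeK d M) : DomK (specialLip d ϖ) φ₀ := by
  refine ⟨?_, ?_⟩
  · have hl : Continuous (lowerPart d) := by unfold lowerPart; fun_prop
    exact isOpen_lt ((Lip_cont hϖ).comp hl) (continuous_apply _)
  · intro k x hx z hz
    have h1 : tsupport (Ph (d + 1) φ₀ k) ⊆ (fun z => (2:ℝ) ^ k • z) ⁻¹' tsupport φ₀ := by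
      refine closure_minimal (fun w hw => ?_) ((isClosed_tsupport φ₀).preimage (by fun_prop))
      apply subset_tsupport
      rw [Function.mem_support] at hw ⊢
      intro h0
      exact hw (by rw [Ph, h0, mul_zero])
    have h2 : M * sqNorm d (lowerPart d ((2:ℝ) ^ k • z)) < -((2:ℝ) ^ k • z) (Fin.last d) := hs (h1 hz)
    have e : lowerPart d ((2:ℝ) ^ k • z) = fun i => (2:ℝ) ^ k * lowerPart d z i := rfl
    rw [e, sqNorm_smul d (by positivity), Pi.smul_apply, smul_eq_mul] at h2
    have h3 : M * sqNorm d (lowerPart d z) < -z (Fin.last d) := by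
      have hp : (0:ℝ) < 2 ^ k := by positivity
      nlinarith
    have h4 := hϖ (lowerPart d (x - z)) (lowerPart d x)
    have e2 : sqNorm d (fun i => lowerPart d (x - z) i - lowerPart d x i) = sqNorm d (lowerPart d z) := by
      unfold sqNorm
      congr 1
      refine Finset.sum_congr rfl fun i _ => ?_
      simp only [lowerPart, Pi.sub_apply]; ring
    rw [e2] at h4
    have h5 : ϖ (lowerPart d x) < x (Fin.last d) := hx
    change ϖ (lowerPart d (x - z)) < (x - z) (Fin.last d)
    rw [Pi.sub_apply]
    have := (abs_le.1 h4).2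
    linarith

section concl
variable {n : ℕ} {p q σ₁ σ₂ : ℝ≥0∞} {α₁ α₂ α₃ : ℝ} {t : ℕ → (Fin n → ℝ) → ℝ}
  {φ₀ : (Fin n → ℝ) → ℝ} {G : Set (Fin n → ℝ)} {c I : ℝ} {f : Dstrb n}

theorem NN_FI (hG : MeasurableSet G) (p : ℝ≥0∞) (t : ℕ → (Fin n → ℝ) → ℝ) (f : Dstrb n)
    (φ₀ : (Fin n → ℝ) → ℝ) (j : ℕ) :
    NN p t (FI n G f φ₀) j =
      eLpNorm (fun x => t j x * distConv n f (phiFam n φ₀ j) x) p (volume.restrict G) := by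
  rw [← eLpNorm_indicator_eq_eLpNorm_restrict hG]
  unfold NN
  congr 1
  funext x
  by_cases hx : x ∈ G
  · simp [FI, hx]
  · simp [FI, hx]

theorem FI_ap (hf : MemSeG n G f) (H : DomK G φ₀) (D : KD φ₀ c I) :
    ∃ (C : ℝ≥0∞) (A b : ℕ), C ≠ ∞ ∧ ∀ k y, eF (FI n G f φ₀) k y ≤ C * pw (A * k + b * ‖y‖) := by
  obtain ⟨C, A, b, hC, hb⟩ := FI_apriori hf H D
  refine ⟨ENNReal.ofReal C, A, 2 * b, ENNReal.ofReal_ne_top, fun k y => ?_⟩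
  rw [eF, Real.enorm_eq_ofReal_abs, pw, ← ENNReal.ofReal_mul hC.le]
  refine ENNReal.ofReal_le_ofReal ((hb k y).trans ?_)
  rw [mul_assoc]
  gcongr
  rw [Real.rpow_add (by norm_num)]
  have e1 : (2:ℝ) ^ ((A:ℝ) * k) = (2 ^ k) ^ A := by
    rw [← Nat.cast_mul, Real.rpow_natCast, mul_comm, pow_mul]
  rw [e1]
  gcongr
  rw [← Real.exp_one_rpow]
  have e2 : (2:ℝ) ^ (((2 * b : ℕ) : ℝ) * ‖y‖) = 4 ^ ((b:ℝ) * ‖y‖) := by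
    rw [show (4:ℝ) = 2 ^ (2:ℝ) by norm_num, ← Real.rpow_mul (by norm_num)]
    congr 1; push_cast; ring
  rw [e2]
  refine Real.rpow_le_rpow (by positivity) ?_ (by positivity)
  have := Real.exp_one_lt_d9; linarith

theorem easy_dir (H : DomK G φ₀) (h0 : IsTestFun n φ₀) (p q : ℝ≥0∞) (t : ℕ → (Fin n → ℝ) → ℝ) (f : Dstrb n) :
    lqNorm q (fun j =>
          eLpNorm (fun x => t j x * distConv n f (phiFam n φ₀ j) x) p (volume.restrict G)) ≤
      besovTraceNorm n p q t φ₀ G f := by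
  refine le_iInf fun g => ?_
  obtain ⟨g, hg, hgf⟩ := g
  refine lq_mono fun k => ?_
  refine le_trans (le_of_eq ?_) (eLpNorm_mono_measure _ (Measure.restrict_le_self (s := G)))
  refine eLpNorm_congr_ae ?_
  filter_upwards [ae_restrict_mem H.op.measurableSet] with x hx
  have h1 := eta_DG H h0 k x hx
  have h2 := hgf _ (DG_test h1) (DG_iff.1 h1).2
  have h3 : distConv n f (phiFam n φ₀ k) x = distConv n g (phiFam n φ₀ k) x := h2.symm
  simp only [h3]

theorem hard_dir (hp : 0 < p) (hq : 0 < q) (hσ₁ : 0 < σ₁) (hα₃ : 0 ≤ α₃)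
    (ht : MemX n p σ₁ σ₂ α₁ α₂ α₃ t) (hps : p ≤ σ₂) (H : DomK G φ₀) (D : KD φ₀ c I)
    {L : ℤ} (hL : -1 ≤ L) (hm : MomentsVanish n L (phiOf n φ₀)) (hLα : α₂ < (L : ℝ) + 1) :
    ∃ K : ℝ≥0∞, K ≠ ∞ ∧ ∀ f : Dstrb n, MemSeG n G f → lqNorm q (NN p t (FI n G f φ₀)) ≠ ∞ →
      besovTraceNorm n p q t φ₀ G f ≤ K * lqNorm q (NN p t (FI n G f φ₀)) := by
  have hc0 := D.hc0
  choose Cm0 hCm0 hCm using fun h => main_local H D h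
  obtain ⟨h, hh⟩ := exists_nat_ge (A0 n p σ₁ α₁ + 1)
  obtain ⟨s, hs⟩ : ∃ s : ℕ, (s : ℤ) = L + 1 := ⟨(L + 1).toNat, Int.toNat_of_nonneg (by omega)⟩
  have hsα : α₂ < (s : ℝ) := by
    have : ((s : ℤ) : ℝ) = ((L + 1 : ℤ) : ℝ) := by rw [hs]
    push_cast at this
    rw [this]; exact hLα
  obtain ⟨C1, hC1, hOB⟩ := E_OB D h hL hm hs
  have hcR : ∀ h, 0 ≤ cR h c + 2 * c := fun h => by unfold cR; positivity
  have hCmt : ∀ h, ENNReal.ofReal (Cm0 h) ≠ ∞ := fun h => ENNReal.ofReal_ne_top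
  obtain ⟨K1, hK1, hO⟩ := O_le ht hp hσ₁ hα₃ hCmt hcR hh (s : ℝ) hC1 (hcR h)
  obtain ⟨K2, ε, hK2, hε, hLp⟩ := Lp_est ht hp hps hsα
  obtain ⟨K3, hK3, hRR⟩ := lq_RR hq hε
  refine ⟨K1 * K2 * K3, ENNReal.mul_ne_top (ENNReal.mul_ne_top hK1 hK2) hK3, fun f hf hN => ?_⟩
  have hmeas := fun k => FI_meas hf H D.test k
  have hML : ∀ h, ML (eF (FI n G f φ₀)) h (ENNReal.ofReal (Cm0 h)) (cR h c + 2 * c) :=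
    fun h => hCm h f hf
  have hap := FI_ap hf H D
  obtain ⟨C4, hC4, hgr⟩ := F_growth ht hp hq hσ₁ hα₃ hCmt hcR _ hmeas hML hap hN
  obtain ⟨N0, hN0⟩ := exists_nat_ge (α₃ + n + 1)
  obtain ⟨K5, hK5, hQ⟩ := QQ_bound D (N := N0 + h) hα₃ hh (by push_cast; have : (0:ℝ) ≤ h := Nat.cast_nonneg h; linarith)
    (by omega) hC4 hgr
  obtain ⟨E, hE⟩ := exists_E D h _ hmeas
  have hEQ := E_le_QQ hE
  have hmem : MemSe' n E ∧ ∀ θ : (Fin n → ℝ) → ℝ, IsTestFun n θ → tsupport θ ⊆ G → E θ = f θ := by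
    refine ⟨⟨K5, N0 + h, hK5, fun g hg => ?_⟩, fun θ hθ hθG => ?_⟩
    · rw [← Real.enorm_eq_ofReal_abs]
      exact (hEQ ⟨g, hg⟩).trans (hQ ⟨g, hg⟩)
    · have hfin : QQ D h (FI n G f φ₀) ⟨θ, hθ.1⟩ ≠ ∞ :=
        ne_top_of_le_ne_top (ENNReal.mul_ne_top ENNReal.ofReal_ne_top (se_test hθ (N0 + h))) (hQ ⟨θ, hθ.1⟩)
      exact tendsto_nhds_unique (hE _ hfin).tendsto_sum_nat
        (repr_zero hf H D h ⟨θ, hθ.1⟩ (DG_iff.2 ⟨hθ.2, hθG⟩))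
  refine (iInf_le (fun g : {g : Dstrb n // MemSe' n g ∧
      ∀ θ : (Fin n → ℝ) → ℝ, IsTestFun n θ → tsupport θ ⊆ G → g θ = f θ} =>
    besovNorm n p q t φ₀ g.1) ⟨E, hmem⟩).trans ?_
  have h1 := hO (FI n G f φ₀) _ hmeas hML hap (hOB (FI n G f φ₀))
  have h2 := hLp (FI n G f φ₀) (fun l => distConv n E (phiFam n φ₀ l)) K1
    (fun l x => (hEQ (eta D.test l x)).trans (h1 l x))
  calc besovNorm n p q t φ₀ E ≤ lqNorm q (fun l => K1 * K2 * RR (NN p t (FI n G f φ₀)) ε l) :=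
        lq_mono h2
    _ = K1 * K2 * lqNorm q (RR (NN p t (FI n G f φ₀)) ε) := lq_const_mul hq _ _
    _ ≤ K1 * K2 * (K3 * lqNorm q (NN p t (FI n G f φ₀))) := by gcongr; exact hRR _
    _ = _ := by ring

end concl

/-- Theorem 3.2, intrinsic characterization of the trace space
`B^{φ₀}_{p,q}(G,{t_k})` on a special Lipschitz domain. -/
theorem intrinsic_trace_characterization (d : ℕ) (p q σ₁ σ₂ : ℝ≥0∞) (α₁ α₂ α₃ : ℝ)
    (hp : 0 < p) (hq : 0 < q) (hσ₁ : 0 < σ₁) (hσ₂ : 0 < σ₂) (hα₃ : 0 ≤ α₃)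
    (t : ℕ → (Fin (d + 1) → ℝ) → ℝ) (ht : MemX (d + 1) p σ₁ σ₂ α₁ α₂ α₃ t)
    (hσ₂p : p ≤ σ₂)
    (M : ℝ) (hM : 1 ≤ M) (ϖ : (Fin d → ℝ) → ℝ) (hϖ : IsLipFun d M ϖ)
    (φ₀ : (Fin (d + 1) → ℝ) → ℝ) (hφ₀ : IsTestFun (d + 1) φ₀)
    (hsuppφ : tsupport φ₀ ⊆ negConeK d M) (hint : (∫ x, φ₀ x) = 1)
    (Lφ : ℤ) (hLφ : -1 ≤ Lφ) (hmomφ : MomentsVanish (d + 1) Lφ (phiOf (d + 1) φ₀))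
    (hLφα : α₂ < (Lφ : ℝ) + 1) :
    ∃ C : ℝ, 0 < C ∧ ∀ f : Dstrb (d + 1),
      MemSeG (d + 1) (specialLip d ϖ) f →
      besovTraceNorm (d + 1) p q t φ₀ (specialLip d ϖ) f ≤
        ENNReal.ofReal C *
          lqNorm q (fun j =>
            eLpNorm (fun x => t j x * distConv (d + 1) f (phiFam (d + 1) φ₀ j) x)
              p (volume.restrict (specialLip d ϖ))) ∧
      lqNorm q (fun j =>
          eLpNorm (fun x => t j x * distConv (d + 1) f (phiFam (d + 1) φ₀ j) x)
            p (volume.restrict (specialLip d ϖ))) ≤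
        ENNReal.ofReal C * besovTraceNorm (d + 1) p q t φ₀ (specialLip d ϖ) f := by
  have H := specialLip_DomK hϖ hsuppφ
  obtain ⟨c, I, D⟩ := KD.exists hφ₀ hint
  obtain ⟨K, hK, hb⟩ := hard_dir (q := q) hp hq hσ₁ hα₃ ht hσ₂p H D hLφ hmomφ hLφα
  refine ⟨K.toReal + 1, by positivity, fun f hf => ⟨?_, ?_⟩⟩
  · have e : (fun j => eLpNorm (fun x => t j x * distConv (d + 1) f (phiFam (d + 1) φ₀ j) x)
        p (volume.restrict (specialLip d ϖ))) = NN p t (FI (d + 1) (specialLip d ϖ) f φ₀) :=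
      funext fun j => (NN_FI H.op.measurableSet p t f φ₀ j).symm
    rw [e]
    by_cases hN : lqNorm q (NN p t (FI (d + 1) (specialLip d ϖ) f φ₀)) = ∞
    · rw [hN, ENNReal.mul_top]
      · exact le_top
      · simp only [ne_eq, ENNReal.ofReal_eq_zero, not_le]; positivity
    · refine (hb f hf hN).trans ?_
      gcongr
      rw [ENNReal.le_ofReal_iff_toReal_le hK (by positivity)]
      linarith
  · refine (easy_dir H hφ₀ p q t f).trans ?_
    refine le_mul_of_one_le_left bot_le ?_
    rw [ENNReal.one_le_ofReal]
    linarith [ENNReal.toReal_nonneg (a := K)]
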